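/- Let m ≥ 3 be an integer, let 1 < q < p < ∞ and 0 < γ < 3/2 satisfy 1/q = 1/p + γ/3. Then for every sufficiently small ε > 0 there is a constant C_ε, independent of m and f, such that for every smooth function f compactly supported in (0,∞)×ℝ: ‖r^{γ} L_m^{-1}(∇̃∇̃ f)‖_{L^p} ≤ C_ε ( m^{−1/2 + γ/3 + ε} ‖L_m^{-1}(∇̃∇̃ f)‖_{L^q} + ‖r^{γ} f‖_{L^p} + ‖L_m^{-1}((1/r) ∇̃(r^{γ} f))‖_{L^p} + ‖L_m^{-1}(r^{γ−2} f)‖_{L^p} ), where ∇̃∇̃ f stands for any of the second derivatives ∂_r² f, ∂_r ∂_z f, ∂_z² f, each estimated separately. -/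

import Mathlib

open Real MeasureTheory Set

noncomputable section

/-- `F_m(s) = ∫₀^π cos(mθ)/√(s + 2(1 − cos θ)) dθ`. -/
def Fm (m : ℕ) (s : ℝ) : ℝ :=
  ∫ θ in (0:ℝ)..Real.pi, Real.cos (m * θ) / Real.sqrt (s + 2 * (1 - Real.cos θ))

/-- `ξ² = ((r − r̄)² + (z − z̄)²)/(r r̄)`. -/
def xiSq (r r' z z' : ℝ) : ℝ := ((r - r')^2 + (z - z')^2) / (r * r')

/-- The explicit integral kernel realisation of
`L_m^{-1} = (−(∂_r² + ∂_r/r + ∂_z²) + m²/r²)^{-1}` on axisymmetric functions. -/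
def Lminv (m : ℕ) (g : ℝ → ℝ → ℝ) (r z : ℝ) : ℝ :=
  (1/(2*Real.pi)) * ∫ r' in Set.Ioi (0:ℝ), ∫ z' : ℝ,
    Fm m (xiSq r r' z z') * g r' z' * Real.sqrt (r'/r)

/-- The `L^p(ℝ³)` norm of the axisymmetric function corresponding to `f(r,z)`:
`‖f‖_{L^p}^p = 2π ∫₀^∞ ∫_ℝ |f(r,z)|^p r dz dr`. -/
def cylLp (p : ℝ) (f : ℝ → ℝ → ℝ) : ℝ :=
  (2*Real.pi * ∫ r in Set.Ioi (0:ℝ), ∫ z : ℝ, |f r z| ^ p * r) ^ (1/p)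

/-- A smooth function compactly supported in `(0,∞) × ℝ`. -/
def TestFun (f : ℝ → ℝ → ℝ) : Prop :=
  ContDiff ℝ (⊤ : ℕ∞) (Function.uncurry f) ∧ HasCompactSupport (Function.uncurry f) ∧
    tsupport (Function.uncurry f) ⊆ Set.Ioi (0:ℝ) ×ˢ Set.univ

/-- The second derivatives `∂_r²`, `∂_r∂_z`, `∂_z²` of a function of `(r,z)`. -/
def d2rr (f : ℝ → ℝ → ℝ) (r z : ℝ) : ℝ := deriv (fun s => deriv (fun s' => f s' z) s) r
def d2rz (f : ℝ → ℝ → ℝ) (r z : ℝ) : ℝ := deriv (fun s => deriv (fun s' => f s s') z) r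
def d2zz (f : ℝ → ℝ → ℝ) (r z : ℝ) : ℝ := deriv (fun s => deriv (fun s' => f r s') s) z

/-- The one-dimensional heat kernel. -/
def heat1 (t x : ℝ) : ℝ := (√(4 * π * t))⁻¹ * exp (-x ^ 2 / (4 * t))

/-- The heat kernel of `ℝ³`. -/
def heat (t : ℝ) (x : Fin 3 → ℝ) : ℝ := ∏ i, heat1 t (x i)

lemma heat1_pos {t : ℝ} (ht : 0 < t) (x : ℝ) : 0 < heat1 t x := by
  unfold heat1; positivity

lemma heat_pos {t : ℝ} (ht : 0 < t) (x : Fin 3 → ℝ) : 0 < heat t x :=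
  Finset.prod_pos fun _ _ => heat1_pos ht _

lemma heat_eq (t : ℝ) (x : Fin 3 → ℝ) :
    heat t x = ((√(4 * π * t))⁻¹) ^ 3 * exp (-(∑ i, x i ^ 2) / (4 * t)) := by
  unfold heat heat1
  rw [Finset.prod_mul_distrib, ← exp_sum, Finset.prod_const, Finset.card_univ, Fintype.card_fin,
    ← Finset.sum_div, ← Finset.sum_neg_distrib]

lemma heat1_eq_exp (t x : ℝ) : heat1 t x = (√(4 * π * t))⁻¹ * exp (-(4 * t)⁻¹ * x ^ 2) := by
  unfold heat1; congr 2; rw [neg_div, div_eq_inv_mul, neg_mul]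

lemma integrable_pow_mul_heat1 {t : ℝ} (ht : 0 < t) (n : ℕ) :
    Integrable fun x => x ^ n * heat1 t x := by
  have h := (integrable_rpow_mul_exp_neg_mul_sq (b := (4 * t)⁻¹) (by positivity)
    (s := n) (by have : (0 : ℝ) ≤ n := by positivity
                 linarith)).const_mul (√(4 * π * t))⁻¹
  refine h.congr (ae_of_all _ fun x => ?_)
  simp only [heat1_eq_exp, rpow_natCast]; ring

lemma integrable_heat1 {t : ℝ} (ht : 0 < t) : Integrable (heat1 t) := by
  simpa using integrable_pow_mul_heat1 ht 0

lemma integral_heat1 {t : ℝ} (ht : 0 < t) : ∫ x, heat1 t x = 1 := by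
  simp only [heat1_eq_exp]
  rw [integral_const_mul, integral_gaussian, show π / (4 * t)⁻¹ = 4 * π * t by field_simp]
  exact inv_mul_cancel₀ (by positivity)

lemma hasDerivAt_heat1 (t x : ℝ) : HasDerivAt (heat1 t) (-x / (2 * t) * heat1 t x) x := by
  have h := (((hasDerivAt_pow 2 x).neg.div_const (4 * t)).exp).const_mul (√(4 * π * t))⁻¹
  refine h.congr_deriv ?_
  unfold heat1
  by_cases ht : t = 0
  · simp [ht]
  · simp only [Pi.neg_apply]; push_cast; field_simp; ring

lemma integral_mul_heat1 {t : ℝ} (_ht : 0 < t) : ∫ x, x * heat1 t x = 0 := by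
  have h := integral_neg_eq_self (fun x => x * heat1 t x) volume
  have e : ∀ x, -x * heat1 t (-x) = -(x * heat1 t x) := by intro x; simp [heat1]
  simp only [e, integral_neg] at h
  linarith

lemma integral_sq_mul_heat1 {t : ℝ} (ht : 0 < t) : ∫ x, x ^ 2 * heat1 t x = 2 * t := by
  have h := integral_mul_deriv_eq_deriv_mul_of_integrable (u := fun x => x) (v := heat1 t)
    (u' := fun _ => 1) (v' := fun x => -x / (2 * t) * heat1 t x)
    (fun x _ => hasDerivAt_id x) (fun x _ => hasDerivAt_heat1 t x)
    (((integrable_pow_mul_heat1 ht 2).const_mul (-(2 * t)⁻¹)).congr (ae_of_all _ fun x => by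
      simp only [Pi.mul_apply]; field_simp))
    (((integrable_heat1 ht)).congr (ae_of_all _ fun x => by simp))
    (((integrable_pow_mul_heat1 ht 1)).congr (ae_of_all _ fun x => by simp))
  simp only [one_mul, integral_heat1 ht] at h
  have e : ∀ x, x * (-x / (2 * t) * heat1 t x) = -(2 * t)⁻¹ * (x ^ 2 * heat1 t x) := by
    intro x; field_simp
  simp only [e, integral_const_mul] at h
  field_simp at h
  linarith

/-- Product of two heat kernels, completing the square. -/
lemma heat1_mul_heat1 {s : ℝ} (hs : 0 < s) (x w y : ℝ) :
    heat1 s (x - w) * heat1 s (w - y) = heat1 (2 * s) (x - y) * heat1 (s / 2) (w - (x + y) / 2) := by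
  unfold heat1
  have e : (√(4 * π * (2 * s)))⁻¹ * (√(4 * π * (s / 2)))⁻¹ = (√(4 * π * s))⁻¹ * (√(4 * π * s))⁻¹ := by
    rw [← mul_inv, ← mul_inv, ← sqrt_mul (by positivity), ← sqrt_mul (by positivity)]
    congr 2; ring
  have e2 : exp (-(x - w) ^ 2 / (4 * s)) * exp (-(w - y) ^ 2 / (4 * s)) =
      exp (-(x - y) ^ 2 / (4 * (2 * s))) * exp (-(w - (x + y) / 2) ^ 2 / (4 * (s / 2))) := by
    rw [← exp_add, ← exp_add]; congr 1; field_simp; ring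
  calc _ = ((√(4 * π * s))⁻¹ * (√(4 * π * s))⁻¹) *
      (exp (-(x - w) ^ 2 / (4 * s)) * exp (-(w - y) ^ 2 / (4 * s))) := by ring
    _ = _ := by rw [← e, e2]; ring

lemma integrable_pow_mul_heat1_mul_heat1 {s : ℝ} (hs : 0 < s) (x y : ℝ) (a b c : ℝ) :
    Integrable (fun w => (a + b * (w - (x + y) / 2) + c * (w - (x + y) / 2) ^ 2)
      * (heat1 s (x - w) * heat1 s (w - y))) := by
  simp only [heat1_mul_heat1 hs]
  have h0 := ((integrable_heat1 (t := s / 2) (by positivity)).comp_sub_right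
    ((x + y) / 2)).const_mul (a * heat1 (2 * s) (x - y))
  have h1 := ((integrable_pow_mul_heat1 (t := s / 2) (by positivity) 1).comp_sub_right
    ((x + y) / 2)).const_mul (b * heat1 (2 * s) (x - y))
  have h2 := ((integrable_pow_mul_heat1 (t := s / 2) (by positivity) 2).comp_sub_right
    ((x + y) / 2)).const_mul (c * heat1 (2 * s) (x - y))
  refine ((h0.add h1).add h2).congr (ae_of_all _ fun w => ?_)
  simp only [Pi.add_apply]; ring

lemma integral_quad_mul_heat1_mul_heat1 {s : ℝ} (hs : 0 < s) (x y : ℝ) (a b c : ℝ) :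
    ∫ w, (a + b * (w - (x + y) / 2) + c * (w - (x + y) / 2) ^ 2)
      * (heat1 s (x - w) * heat1 s (w - y)) = (a + c * s) * heat1 (2 * s) (x - y) := by
  simp only [heat1_mul_heat1 hs]
  have hs2 : 0 < s / 2 := by positivity
  rw [integral_sub_right_eq_self (fun w => (a + b * w + c * w ^ 2)
    * (heat1 (2 * s) (x - y) * heat1 (s / 2) w)) ((x + y) / 2)]
  have h0 := ((integrable_heat1 hs2)).const_mul (a * heat1 (2 * s) (x - y))
  have h1 := ((integrable_pow_mul_heat1 hs2 1)).const_mul (b * heat1 (2 * s) (x - y))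
  have h2 := ((integrable_pow_mul_heat1 hs2 2)).const_mul (c * heat1 (2 * s) (x - y))
  have e : ∀ w, (a + b * w + c * w ^ 2) * (heat1 (2 * s) (x - y) * heat1 (s / 2) w) =
    (a * heat1 (2 * s) (x - y)) * heat1 (s / 2) w
    + (b * heat1 (2 * s) (x - y)) * (w ^ 1 * heat1 (s / 2) w)
    + (c * heat1 (2 * s) (x - y)) * (w ^ 2 * heat1 (s / 2) w) := by intro w; ring
  simp only [e]
  have h01 : Integrable (fun w => a * heat1 (2 * s) (x - y) * heat1 (s / 2) w
    + b * heat1 (2 * s) (x - y) * (w ^ 1 * heat1 (s / 2) w)) := h0.add h1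
  rw [integral_add h01 h2, integral_add h0 h1, integral_const_mul, integral_const_mul,
    integral_const_mul, integral_heat1 hs2, integral_sq_mul_heat1 hs2]
  simp only [pow_one, integral_mul_heat1 hs2]
  ring

/-- The spatial gradient of the heat kernel. -/
def heatG (i : Fin 3) (t : ℝ) (x : Fin 3 → ℝ) : ℝ := -x i / (2 * t) * heat t x

/-- The spatial Hessian of the heat kernel. -/
def heatH (i j : Fin 3) (t : ℝ) (x : Fin 3 → ℝ) : ℝ :=
  (x i * x j / (4 * t ^ 2) - (if i = j then 1 else 0) / (2 * t)) * heat t x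

lemma integrable_heatG_mul_heatG {s : ℝ} (hs : 0 < s) (i j : Fin 3) (x y : Fin 3 → ℝ) :
    Integrable (fun w => heatG i s (x - w) * heatG j s (w - y)) ∧
    ∫ w, heatG i s (x - w) * heatG j s (w - y) = heatH i j (2 * s) (x - y) := by
  set φ : Fin 3 → ℝ → ℝ := fun k w => ((if k = i then (x k - w) else 1) *
    (if k = j then (w - y k) else 1)) * (heat1 s (x k - w) * heat1 s (w - y k)) with hφ
  have hquad : ∀ k, ∃ a b c : ℝ, (a + c * s = if i = j then
        (if k = i then (x k - y k) ^ 2 / 4 - s else 1) else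
        (if k = i then (x k - y k) / 2 else 1) * (if k = j then (x k - y k) / 2 else 1)) ∧
      φ k = fun w => (a + b * (w - (x k + y k) / 2)
      + c * (w - (x k + y k) / 2) ^ 2) * (heat1 s (x k - w) * heat1 s (w - y k)) := by
    intro k
    by_cases hi : k = i <;> by_cases hj : k = j
    · refine ⟨(x k - y k) ^ 2 / 4, 0, -1, ?_, ?_⟩
      · simp [hi, ← hi.symm.trans hj]; ring
      · funext w; simp only [hφ]; rw [if_pos hi, if_pos hj]; ring
    · refine ⟨(x k - y k) / 2, -1, 0, ?_, ?_⟩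
      · have : i ≠ j := fun h => hj (hi.trans h)
        simp [hi, this]
      · funext w; simp only [hφ, hi, if_true]; congr 1; subst hi; simp [hj]; ring
    · refine ⟨(x k - y k) / 2, 1, 0, ?_, ?_⟩
      · have : i ≠ j := fun h => hi (hj.trans h.symm)
        simp [hj, this, this.symm]
      · funext w; simp only [hφ, hj, if_true]; congr 1; subst hj; simp [hi]; ring
    · refine ⟨1, 0, 0, ?_, ?_⟩
      · simp [hi, hj]
      · funext w; simp [hφ, hi, hj]
  have hInt : ∀ k, Integrable (φ k) := by
    intro k
    obtain ⟨a, b, c, -, h2⟩ := hquad k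
    rw [h2]; exact integrable_pow_mul_heat1_mul_heat1 hs _ _ a b c
  have hprod : ∀ w : Fin 3 → ℝ, heatG i s (x - w) * heatG j s (w - y) =
      (4 * s ^ 2)⁻¹ * ∏ k, φ k (w k) := by
    intro w
    have e : ∏ k, φ k (w k) = (x i - w i) * (w j - y j) * (heat s (x - w) * heat s (w - y)) := by
      simp only [hφ, Finset.prod_mul_distrib, heat, Finset.prod_ite_eq', Finset.mem_univ, if_true,
        Pi.sub_apply]
    rw [e]; unfold heatG
    simp only [Pi.sub_apply]; field_simp; ring
  have hval : ∀ k, ∫ w, φ k w = (if i = j then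
        (if k = i then (x k - y k) ^ 2 / 4 - s else 1) else
        (if k = i then (x k - y k) / 2 else 1) * (if k = j then (x k - y k) / 2 else 1))
        * heat1 (2 * s) (x k - y k) := by
    intro k
    obtain ⟨a, b, c, h1, h2⟩ := hquad k
    rw [h2, integral_quad_mul_heat1_mul_heat1 hs, h1]
  simp only [hprod]
  refine ⟨(Integrable.fintype_prod hInt).const_mul _, ?_⟩
  rw [integral_const_mul]
  have := integral_fintype_prod_volume_eq_prod (ι := Fin 3) (E := fun _ => ℝ) φ
  rw [this]
  simp only [hval, Finset.prod_mul_distrib]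
  unfold heatH
  rw [show (∏ k, heat1 (2 * s) (x k - y k)) = heat (2 * s) (x - y) from rfl]
  by_cases h : i = j
  · subst h; simp; field_simp; ring
  · simp only [h, if_false, Finset.prod_mul_distrib, Finset.prod_ite_eq', Finset.mem_univ, if_true,
      Pi.sub_apply]
    field_simp; ring

lemma integrable_heat {t : ℝ} (ht : 0 < t) : Integrable (heat t) :=
  Integrable.fintype_prod (f := fun _ : Fin 3 => heat1 t) fun _ => integrable_heat1 ht

lemma integral_heat {t : ℝ} (ht : 0 < t) : ∫ x, heat t x = 1 := by
  have := integral_fintype_prod_volume_eq_prod (ι := Fin 3) (E := fun _ => ℝ) fun _ => heat1 t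
  unfold heat
  rw [this]; simp [integral_heat1 ht]

/-- The homogeneous gauge `u^{2p} + v^{2q}`. -/
def bellW (p q u v : ℝ) : ℝ := u ^ (2 * p) + v ^ (2 * q)

/-- The share of `u^{2p}` in the gauge. -/
def bellRho (p q u v : ℝ) : ℝ := u ^ (2 * p) / bellW p q u v

def bellP (p q u v : ℝ) : ℝ := u ^ 2 * bellW p q u v ^ ((p - 2) / (2 * p))

/-- A smooth Bellman function for the bilinear embedding theorem on positive functions. -/
def bellQ (p q K u v : ℝ) : ℝ := K * v ^ q + bellP p q u v

/-- The first differential of `bellQ`. -/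
def bellD (p q K u v a b : ℝ) : ℝ :=
  K * q * v ^ q * (b / v) + bellP p q u v * ((2 + (p - 2) * bellRho p q u v) * (a / u)
    + 2 * q * ((p - 2) / (2 * p)) * (1 - bellRho p q u v) * (b / v))

/-- The second differential of `bellQ`. -/
def bellH (p q K u v a b : ℝ) : ℝ :=
  K * q * (q - 1) * v ^ q * (b / v) ^ 2 + bellP p q u v *
    (((2 + (p - 2) * bellRho p q u v) * (a / u)
        + 2 * q * ((p - 2) / (2 * p)) * (1 - bellRho p q u v) * (b / v)) ^ 2
      - (2 + (p - 2) * bellRho p q u v) * (a / u) ^ 2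
      - 2 * q * ((p - 2) / (2 * p)) * (1 - bellRho p q u v) * (b / v) ^ 2
      + bellRho p q u v * (1 - bellRho p q u v) * ((p - 2) / (2 * p))
        * (2 * p * (a / u) - 2 * q * (b / v)) ^ 2)

lemma bellW_pos (p q : ℝ) {u v : ℝ} (hu : 0 < u) (hv : 0 < v) : 0 < bellW p q u v := by
  unfold bellW; positivity

lemma bellP_pos (p q : ℝ) {u v : ℝ} (hu : 0 < u) (hv : 0 < v) : 0 < bellP p q u v := by
  have := bellW_pos p q hu hv
  unfold bellP; positivity

lemma bellRho_nonneg (p q : ℝ) {u v : ℝ} (hu : 0 < u) (hv : 0 < v) : 0 ≤ bellRho p q u v := by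
  have := bellW_pos p q hu hv
  unfold bellRho; positivity

lemma one_sub_bellRho (p q : ℝ) {u v : ℝ} (hu : 0 < u) (hv : 0 < v) :
    1 - bellRho p q u v = v ^ (2 * q) / bellW p q u v := by
  have := bellW_pos p q hu hv
  unfold bellRho
  field_simp
  unfold bellW; ring

lemma bellRho_le_one (p q : ℝ) {u v : ℝ} (hu : 0 < u) (hv : 0 < v) : bellRho p q u v ≤ 1 := by
  have h1 := one_sub_bellRho p q hu hv
  have := bellW_pos p q hu hv
  have : 0 ≤ v ^ (2 * q) / bellW p q u v := by positivity
  linarith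

lemma hasDerivAt_bellW (p q : ℝ) {u v : ℝ → ℝ} {u1 v1 s : ℝ} (hu : 0 < u s) (hv : 0 < v s)
    (du : HasDerivAt u u1 s) (dv : HasDerivAt v v1 s) :
    HasDerivAt (fun s => bellW p q (u s) (v s)) (bellW p q (u s) (v s) *
      (2 * p * bellRho p q (u s) (v s) * (u1 / u s)
        + 2 * q * (1 - bellRho p q (u s) (v s)) * (v1 / v s))) s := by
  have hW := bellW_pos p q hu hv
  have h1 := (du.rpow_const (p := 2 * p) (Or.inl hu.ne')).add
    (dv.rpow_const (p := 2 * q) (Or.inl hv.ne'))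
  refine h1.congr_deriv ?_
  rw [one_sub_bellRho p q hu hv, rpow_sub_one hu.ne', rpow_sub_one hv.ne']
  unfold bellRho
  field_simp

lemma hasDerivAt_bellRho (p q : ℝ) {u v : ℝ → ℝ} {u1 v1 s : ℝ} (hu : 0 < u s) (hv : 0 < v s)
    (du : HasDerivAt u u1 s) (dv : HasDerivAt v v1 s) :
    HasDerivAt (fun s => bellRho p q (u s) (v s)) (bellRho p q (u s) (v s) *
      (1 - bellRho p q (u s) (v s)) * (2 * p * (u1 / u s) - 2 * q * (v1 / v s))) s := by
  have hW := bellW_pos p q hu hv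
  have h1 := (du.rpow_const (p := 2 * p) (Or.inl hu.ne')).div
    (hasDerivAt_bellW p q hu hv du dv) hW.ne'
  refine h1.congr_deriv ?_
  rw [rpow_sub_one hu.ne']
  unfold bellRho
  field_simp
  ring

lemma hasDerivAt_bellP (p q : ℝ) (hp : 0 < p) {u v : ℝ → ℝ} {u1 v1 s : ℝ}
    (hu : 0 < u s) (hv : 0 < v s)
    (du : HasDerivAt u u1 s) (dv : HasDerivAt v v1 s) :
    HasDerivAt (fun s => bellP p q (u s) (v s)) (bellP p q (u s) (v s) *
      ((2 + (p - 2) * bellRho p q (u s) (v s)) * (u1 / u s)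
        + 2 * q * ((p - 2) / (2 * p)) * (1 - bellRho p q (u s) (v s)) * (v1 / v s))) s := by
  have hW := bellW_pos p q hu hv
  have h1 := (du.pow 2).mul ((hasDerivAt_bellW p q hu hv du dv).rpow_const
    (p := (p - 2) / (2 * p)) (Or.inl hW.ne'))
  refine h1.congr_deriv ?_
  rw [rpow_sub_one hW.ne']
  simp only [Nat.cast_ofNat, Nat.add_one_sub_one, pow_one, Pi.pow_apply]
  unfold bellP
  generalize bellW p q (u s) (v s) ^ ((p - 2) / (2 * p)) = w
  field_simp
  ring

lemma hasDerivAt_bellQ (p q K : ℝ) (hp : 0 < p) {u v : ℝ → ℝ} {u1 v1 s : ℝ}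
    (hu : 0 < u s) (hv : 0 < v s)
    (du : HasDerivAt u u1 s) (dv : HasDerivAt v v1 s) :
    HasDerivAt (fun s => bellQ p q K (u s) (v s)) (bellD p q K (u s) (v s) u1 v1) s := by
  have h1 := ((dv.rpow_const (p := q) (Or.inl hv.ne')).const_mul K).add
    (hasDerivAt_bellP p q hp hu hv du dv)
  refine h1.congr_deriv ?_
  rw [rpow_sub_one hv.ne']
  unfold bellD
  ring

lemma hasDerivAt_bellD (p q K : ℝ) (hp : 0 < p) {u v u' v' : ℝ → ℝ} {u2 v2 s : ℝ}
    (hu : 0 < u s) (hv : 0 < v s)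
    (du : HasDerivAt u (u' s) s) (dv : HasDerivAt v (v' s) s)
    (du' : HasDerivAt u' u2 s) (dv' : HasDerivAt v' v2 s) :
    HasDerivAt (fun s => bellD p q K (u s) (v s) (u' s) (v' s))
      (bellD p q K (u s) (v s) u2 v2 + bellH p q K (u s) (v s) (u' s) (v' s)) s := by
  have hrho := hasDerivAt_bellRho p q hu hv du dv
  have hα := du'.div du hu.ne'
  have hβ := dv'.div dv hv.ne'
  have h1 := (((dv.rpow_const (p := q) (Or.inl hv.ne')).const_mul (K * q)).mul hβ).add
    ((hasDerivAt_bellP p q hp hu hv du dv).mul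
      ((((hrho.const_mul (p - 2)).const_add 2).mul hα).add
        (((hrho.const_sub 1).const_mul (2 * q * ((p - 2) / (2 * p)))).mul hβ)))
  refine h1.congr_deriv ?_
  rw [rpow_sub_one hv.ne']
  unfold bellD bellH
  simp only [Pi.div_apply, Pi.mul_apply, Pi.add_apply]
  field_simp
  ring

lemma bellD_add (p q K u v a b a' b' : ℝ) :
    bellD p q K u v (a + a') (b + b') = bellD p q K u v a b + bellD p q K u v a' b' := by
  unfold bellD; ring

lemma sq_le_bellW_rpow {p q : ℝ} (hp : 0 < p) {u v : ℝ} (hu : 0 < u) (hv : 0 < v) :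
    u ^ 2 ≤ bellW p q u v ^ (1 / p) := by
  have h : u ^ (2 * p) ≤ bellW p q u v := by
    unfold bellW; have : 0 ≤ v ^ (2 * q) := by positivity
    linarith
  have := rpow_le_rpow (by positivity) h (by positivity : 0 ≤ 1 / p)
  rwa [← rpow_mul hu.le, show 2 * p * (1 / p) = (2 : ℕ) by field_simp; norm_num,
    rpow_natCast] at this

lemma bellP_le_sqrt {p q : ℝ} (hp : 0 < p) {u v : ℝ} (hu : 0 < u) (hv : 0 < v) :
    bellP p q u v ≤ bellW p q u v ^ (1 / 2 : ℝ) := by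
  have hW := bellW_pos p q hu hv
  unfold bellP
  calc _ ≤ bellW p q u v ^ (1 / p) * bellW p q u v ^ ((p - 2) / (2 * p)) := by
        gcongr; exact sq_le_bellW_rpow hp hu hv
    _ = _ := by rw [← rpow_add hW]; congr 1; field_simp; ring

lemma bellP_le {p q : ℝ} (hp : 0 < p) {u v : ℝ} (hu : 0 < u) (hv : 0 < v) :
    bellP p q u v ≤ u ^ p + v ^ q := by
  refine (bellP_le_sqrt hp hu hv).trans ?_
  rw [← sqrt_eq_rpow]
  apply sqrt_le_iff.2 ⟨by positivity, ?_⟩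
  have h1 : u ^ (2 * p) = (u ^ p) ^ 2 := by
    rw [← rpow_natCast, ← rpow_mul hu.le]; congr 1; push_cast; ring
  have h2 : v ^ (2 * q) = (v ^ q) ^ 2 := by
    rw [← rpow_natCast, ← rpow_mul hv.le]; congr 1; push_cast; ring
  have : 0 ≤ u ^ p * v ^ q := by positivity
  unfold bellW
  rw [h1, h2]; nlinarith

lemma bellP_mul_one_sub_le {p q : ℝ} (hp : 0 < p) {u v : ℝ} (hu : 0 < u) (hv : 0 < v) :
    bellP p q u v * (1 - bellRho p q u v) ≤ v ^ q := by
  have hW := bellW_pos p q hu hv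
  rw [one_sub_bellRho p q hu hv]
  have h2 : v ^ (2 * q) = (v ^ q) ^ 2 := by
    rw [← rpow_natCast, ← rpow_mul hv.le]; congr 1; push_cast; ring
  have hs : v ^ q ≤ bellW p q u v ^ (1 / 2 : ℝ) := by
    rw [← sqrt_eq_rpow]
    apply le_sqrt_of_sq_le
    unfold bellW; rw [h2]; have : 0 ≤ u ^ (2 * p) := by positivity
    linarith
  have hsq : bellW p q u v ^ (1 / 2 : ℝ) * bellW p q u v ^ (1 / 2 : ℝ) = bellW p q u v := by
    rw [← rpow_add hW]; norm_num
  have hvq : 0 < v ^ q := by positivity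
  rw [h2]
  rw [← mul_div_assoc, div_le_iff₀ hW]
  calc _ ≤ bellW p q u v ^ (1 / 2 : ℝ) * (v ^ q * v ^ q) := by
        rw [sq]; gcongr; exact bellP_le_sqrt hp hu hv
    _ ≤ bellW p q u v ^ (1 / 2 : ℝ) * (v ^ q * bellW p q u v ^ (1 / 2 : ℝ)) := by gcongr
    _ = v ^ q * (bellW p q u v ^ (1 / 2 : ℝ) * bellW p q u v ^ (1 / 2 : ℝ)) := by ring
    _ = _ := by rw [hsq]

lemma bellH_algebra {p q c ρ : ℝ} (hp : 2 ≤ p) (hq : 1 < q) (hc0 : 0 ≤ c)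
    (hpc : p - 2 = 2 * p * c) (hr0 : 0 ≤ ρ) (hr1 : ρ ≤ 1) (α β : ℝ) :
    α ^ 2 - ((2 * p * (2 * q * c) + 8 * p * q * c) ^ 2 / 4 + 2 * q * c) * (1 - ρ) * β ^ 2 ≤
      (((2 + 2 * p * c * ρ) * α + 2 * q * c * (1 - ρ) * β) ^ 2
      - (2 + 2 * p * c * ρ) * α ^ 2 - 2 * q * c * (1 - ρ) * β ^ 2
      + ρ * (1 - ρ) * c * (2 * p * α - 2 * q * β) ^ 2) := by
  set C1 := 2 * p * (2 * q * c) + 8 * p * q * c with hC1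
  have hC10 : 0 ≤ C1 := by positivity
  set C2 := C1 ^ 2 / 4 + 2 * q * c with hC2
  set σ := 1 - ρ with hσ
  have hσ0 : 0 ≤ σ := by linarith
  have hσ1 : σ ≤ 1 := by linarith
  set X := 2 + 2 * p * c * ρ with hX
  set Y := 2 * q * c * σ with hY
  have hY0 : 0 ≤ Y := by positivity
  have hX2 : 2 ≤ X := by
    have : 0 ≤ 2 * p * c * ρ := by positivity
    linarith
  have hXp : X ≤ p := by
    have : 2 * p * c * ρ ≤ 2 * p * c * 1 := by gcongr
    linarith
  have hT : |2 * X * Y - 8 * p * q * c * ρ * σ| ≤ C1 * σ := by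
    rw [abs_le]
    have h1 : 2 * X * Y ≤ 2 * p * Y := by gcongr
    have h2 : 0 ≤ 2 * X * Y := by positivity
    have h3 : 0 ≤ 8 * p * q * c * ρ * σ := by positivity
    have h4 : 8 * p * q * c * ρ * σ ≤ 8 * p * q * c * 1 * σ := by gcongr
    have h5 : 0 ≤ 2 * p * Y := by positivity
    have h6 : C1 * σ = 2 * p * Y + 8 * p * q * c * σ := by rw [hC1, hY]; ring
    constructor <;> linarith
  set T := 2 * X * Y - 8 * p * q * c * ρ * σ with hTd
  have hcross : - (α ^ 2 + (C1 * σ) ^ 2 / 4 * β ^ 2) ≤ T * (α * β) := by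
    have h7 : T ^ 2 ≤ (C1 * σ) ^ 2 := sq_le_sq' (by linarith [abs_le.1 hT]) (abs_le.1 hT).2
    have h8 : 0 ≤ ((C1 * σ) ^ 2 - T ^ 2) * β ^ 2 := mul_nonneg (by linarith) (sq_nonneg _)
    have h9 := sq_nonneg (α + T * β / 2)
    have h10 : (α + T * β / 2) ^ 2 = α ^ 2 + T * (α * β) + T ^ 2 * β ^ 2 / 4 := by ring
    have h11 : ((C1 * σ) ^ 2 - T ^ 2) * β ^ 2 = (C1 * σ) ^ 2 * β ^ 2 - T ^ 2 * β ^ 2 := by ring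
    linarith
  have hσ2 : (C1 * σ) ^ 2 / 4 * β ^ 2 ≤ C1 ^ 2 / 4 * σ * β ^ 2 := by
    have : σ ^ 2 ≤ σ := by nlinarith
    calc _ = C1 ^ 2 / 4 * σ ^ 2 * β ^ 2 := by ring
      _ ≤ _ := by gcongr
  have hα2 : 2 * α ^ 2 ≤ (X ^ 2 - X) * α ^ 2 := by
    gcongr; nlinarith
  have hr : 0 ≤ ρ * σ * c * (4 * p ^ 2 * α ^ 2 + 4 * q ^ 2 * β ^ 2) := by positivity
  have hY2 : 0 ≤ Y ^ 2 * β ^ 2 := by positivity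
  have e : (X * α + Y * β) ^ 2 - X * α ^ 2 - Y * β ^ 2
      + ρ * σ * c * (2 * p * α - 2 * q * β) ^ 2 = (X ^ 2 - X) * α ^ 2 + T * (α * β)
        + Y ^ 2 * β ^ 2 - Y * β ^ 2
        + ρ * σ * c * (4 * p ^ 2 * α ^ 2 + 4 * q ^ 2 * β ^ 2) := by
    rw [hTd]; ring
  rw [e]
  have e2 : C2 * σ * β ^ 2 = C1 ^ 2 / 4 * σ * β ^ 2 + Y * β ^ 2 := by rw [hC2, hY]; ring
  rw [e2]
  linarith

lemma bellH_lower {p q : ℝ} (hp : 2 ≤ p) (hpq : p.HolderConjugate q) :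
    ∃ K : ℝ, 0 ≤ K ∧ ∀ u v : ℝ, 0 < u → 0 < v → ∀ a b : ℝ,
      v ^ (2 - q) * a ^ 2 + v ^ (q - 2) * b ^ 2 ≤ bellH p q K u v a b := by
  have hp0 : 0 < p := by linarith
  have hq1 : 1 < q := hpq.symm.lt
  set c := (p - 2) / (2 * p) with hc
  have hc0 : 0 ≤ c := div_nonneg (by linarith) (by linarith)
  have hpc : p - 2 = 2 * p * c := by rw [hc]; field_simp
  set C1 := 2 * p * (2 * q * c) + 8 * p * q * c with hC1
  have hC10 : 0 ≤ C1 := by positivity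
  set C2 := C1 ^ 2 / 4 + 2 * q * c with hC2
  have hC20 : 0 ≤ C2 := by positivity
  refine ⟨(C2 + 1) / (q * (q - 1)), div_nonneg (by linarith) (by nlinarith), ?_⟩
  intro u v hu hv a b
  have hP := bellP_pos p q hu hv
  have hW := bellW_pos p q hu hv
  have hr0 := bellRho_nonneg p q hu hv
  have hr1 := bellRho_le_one p q hu hv
  have hP1 := bellP_mul_one_sub_le (p := p) (q := q) hp0 hu hv
  have hK : (C2 + 1) / (q * (q - 1)) * q * (q - 1) = C2 + 1 := by
    have : q - 1 ≠ 0 := by linarith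
    field_simp
  unfold bellH
  rw [hK, ← hc, hpc]
  have hPu : v ^ (2 - q) * a ^ 2 ≤ bellP p q u v * (a / u) ^ 2 := by
    have e1 : bellP p q u v * (a / u) ^ 2 = bellW p q u v ^ c * a ^ 2 := by
      unfold bellP; rw [← hc]; field_simp
    rw [e1]
    gcongr
    have h : v ^ (2 * q) ≤ bellW p q u v := by
      unfold bellW; have : 0 ≤ u ^ (2 * p) := by positivity
      linarith
    have := rpow_le_rpow (by positivity) h hc0
    rwa [← rpow_mul hv.le, show 2 * q * c = 2 - q from ?_] at this
    have := hpq.mul_eq_add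
    rw [hc]; field_simp; nlinarith
  have hvb : v ^ (q - 2) * b ^ 2 = v ^ q * (b / v) ^ 2 := by
    rw [rpow_sub hv]
    have : v ^ (2 : ℝ) = v ^ 2 := by norm_cast
    rw [this]; field_simp
  set α := a / u
  set β := b / v
  set ρ := bellRho p q u v
  set P := bellP p q u v
  set V := v ^ q
  rw [hvb]
  have key := bellH_algebra hp hq1 hc0 hpc hr0 hr1 α β
  rw [← hC1, ← hC2] at key
  have h10 := mul_le_mul_of_nonneg_left key hP.le
  have h11 : C2 * (P * (1 - ρ)) * β ^ 2 ≤ C2 * V * β ^ 2 := by gcongr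
  have h12 : 0 ≤ V * β ^ 2 := by positivity
  linear_combination h10 + h11 + hPu

lemma bellH_bracket_le {p q c ρ X Y : ℝ} (hp : 0 < p) (hqc : 0 ≤ 2 * q * c) (hc0 : 0 ≤ c)
    (hr0 : 0 ≤ ρ) (hr1 : ρ ≤ 1) (hX0 : 0 ≤ X) (hXp : X ≤ p) (hY0 : 0 ≤ Y)
    (hYq : Y ≤ 2 * q * c) (α β : ℝ) :
    |(X * α + Y * β) ^ 2 - X * α ^ 2 - Y * β ^ 2 + ρ * (1 - ρ) * c * (2 * p * α - 2 * q * β) ^ 2|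
      ≤ (2 * p ^ 2 + 2 * (2 * q * c) ^ 2 + p + 2 * q * c + 8 * c * p ^ 2 + 8 * c * q ^ 2)
        * (α ^ 2 + β ^ 2) := by
  set C3 := 2 * p ^ 2 + 2 * (2 * q * c) ^ 2 + p + 2 * q * c + 8 * c * p ^ 2 + 8 * c * q ^ 2 with hC3
  have h1 : (X * α + Y * β) ^ 2 ≤ 2 * p ^ 2 * α ^ 2 + 2 * (2 * q * c) ^ 2 * β ^ 2 := by
    have e1 : (X * α) ^ 2 ≤ p ^ 2 * α ^ 2 := by rw [mul_pow]; gcongr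
    have e2 : (Y * β) ^ 2 ≤ (2 * q * c) ^ 2 * β ^ 2 := by rw [mul_pow]; gcongr
    nlinarith [sq_nonneg (X * α - Y * β)]
  have h2 : X * α ^ 2 ≤ p * α ^ 2 := by gcongr
  have h3 : Y * β ^ 2 ≤ 2 * q * c * β ^ 2 := by gcongr
  have h4 : ρ * (1 - ρ) * c * (2 * p * α - 2 * q * β) ^ 2 ≤
      8 * c * p ^ 2 * α ^ 2 + 8 * c * q ^ 2 * β ^ 2 := by
    have e1 : ρ * (1 - ρ) ≤ 1 := by nlinarith
    have e2 : (2 * p * α - 2 * q * β) ^ 2 ≤ 8 * p ^ 2 * α ^ 2 + 8 * q ^ 2 * β ^ 2 := by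
      nlinarith [sq_nonneg (2 * p * α + 2 * q * β)]
    calc _ ≤ 1 * c * (8 * p ^ 2 * α ^ 2 + 8 * q ^ 2 * β ^ 2) := by gcongr
      _ = _ := by ring
  have h5 : 0 ≤ ρ * (1 - ρ) * c * (2 * p * α - 2 * q * β) ^ 2 := by
    have : 0 ≤ 1 - ρ := by linarith
    positivity
  have h6 : 0 ≤ X * α ^ 2 := by positivity
  have h7 : 0 ≤ Y * β ^ 2 := by positivity
  have h8 : ∀ x y z : ℝ, 0 ≤ x → x * α ^ 2 ≤ x * (α ^ 2 + β ^ 2) := by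
    intro x y z hx; gcongr; nlinarith
  have a2 : 0 ≤ α ^ 2 := by positivity
  have b2 : 0 ≤ β ^ 2 := by positivity
  have h9 : C3 * (α ^ 2 + β ^ 2) = (2 * p ^ 2 * α ^ 2 + 2 * (2 * q * c) ^ 2 * β ^ 2)
    + p * α ^ 2 + 2 * q * c * β ^ 2 + (8 * c * p ^ 2 * α ^ 2 + 8 * c * q ^ 2 * β ^ 2)
    + (2 * p ^ 2 * β ^ 2 + 2 * (2 * q * c) ^ 2 * α ^ 2
      + p * β ^ 2 + 2 * q * c * α ^ 2 + 8 * c * p ^ 2 * β ^ 2 + 8 * c * q ^ 2 * α ^ 2) := by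
    rw [hC3]; ring
  have h10 : 0 ≤ (2 * p ^ 2 * β ^ 2 + 2 * (2 * q * c) ^ 2 * α ^ 2
      + p * β ^ 2 + 2 * q * c * α ^ 2 + 8 * c * p ^ 2 * β ^ 2 + 8 * c * q ^ 2 * α ^ 2) := by
    positivity
  rw [h9, abs_le]
  have h11 := sq_nonneg (X * α + Y * β)
  have h12 : 0 ≤ 2 * p ^ 2 * α ^ 2 + 2 * (2 * q * c) ^ 2 * β ^ 2 := by positivity
  have h13 : 0 ≤ 8 * c * p ^ 2 * α ^ 2 + 8 * c * q ^ 2 * β ^ 2 := by positivity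
  have h14 : 0 ≤ p * α ^ 2 := by positivity
  have h15 : 0 ≤ 2 * q * c * β ^ 2 := by positivity
  constructor <;> linarith

set_option maxHeartbeats 800000 in
lemma bell_bounds {p q K : ℝ} (hp : 2 ≤ p) (hq : 1 < q) (hK : 0 ≤ K) :
    ∃ C : ℝ, 0 ≤ C ∧ ∀ u v : ℝ, 0 < u → 0 < v →
      (0 ≤ bellQ p q K u v ∧ bellQ p q K u v ≤ C * (u ^ p + v ^ q)) ∧
      (∀ a b : ℝ, |bellD p q K u v a b| ≤ C * (u ^ p + v ^ q) * (|a / u| + |b / v|)) ∧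
      (∀ a b : ℝ, |bellH p q K u v a b| ≤ C * (u ^ p + v ^ q) * ((a / u) ^ 2 + (b / v) ^ 2)) := by
  have hp0 : 0 < p := by linarith
  set c := (p - 2) / (2 * p) with hc
  have hc0 : 0 ≤ c := div_nonneg (by linarith) (by linarith)
  set C3 := 2 * p ^ 2 + 2 * (2 * q * c) ^ 2 + p + 2 * q * c + 8 * c * p ^ 2 + 8 * c * q ^ 2 with hC3
  have hC30 : 0 ≤ C3 := by positivity
  set C := (K + 1) + (K * q + p + 2 * q * c) + (K * q * (q - 1) + C3) with hC
  have hKq : 0 ≤ K * q := by positivity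
  have hKqq : 0 ≤ K * q * (q - 1) := mul_nonneg hKq (by linarith)
  have hqc : 0 ≤ 2 * q * c := by positivity
  refine ⟨C, by positivity, ?_⟩
  intro u v hu hv
  have hP := bellP_pos p q hu hv
  have hr0 := bellRho_nonneg p q hu hv
  have hr1 := bellRho_le_one p q hu hv
  have hPle := bellP_le (p := p) (q := q) hp0 hu hv
  have hup : 0 < u ^ p := by positivity
  have hvq : 0 < v ^ q := by positivity
  unfold bellQ bellD bellH
  rw [← hc]
  set ρ := bellRho p q u v
  set P := bellP p q u v
  set V := v ^ q
  set U := u ^ p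
  have hX0 : 0 ≤ 2 + (p - 2) * ρ := by nlinarith
  have hXp : 2 + (p - 2) * ρ ≤ p := by nlinarith
  have hY0 : 0 ≤ 2 * q * c * (1 - ρ) := mul_nonneg hqc (by linarith)
  have hYq : 2 * q * c * (1 - ρ) ≤ 2 * q * c := by nlinarith
  set X := 2 + (p - 2) * ρ
  set Y := 2 * q * c * (1 - ρ)
  refine ⟨⟨by positivity, ?_⟩, fun a b => ?_, fun a b => ?_⟩
  · have h1 : K * V ≤ K * (U + V) := by gcongr; linarith
    have h2 : (K + 1) * (U + V) ≤ C * (U + V) := by gcongr; linarith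
    linarith
  · generalize a / u = α
    generalize b / v = β
    calc |K * q * V * β + P * (X * α + Y * β)|
        ≤ K * q * V * |β| + P * (X * |α| + Y * |β|) := by
          refine (abs_add_le _ _).trans ?_
          rw [abs_mul (K * q * V), abs_mul P, abs_of_nonneg (by positivity : 0 ≤ K * q * V), abs_of_pos hP]
          gcongr
          refine (abs_add_le _ _).trans ?_
          rw [abs_mul X, abs_mul Y, abs_of_nonneg hX0, abs_of_nonneg hY0]
      _ ≤ K * q * (U + V) * (|α| + |β|) + (U + V) * (p * (|α| + |β|) + 2 * q * c * (|α| + |β|)) := by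
          gcongr <;> first | linarith | (linarith [abs_nonneg α, abs_nonneg β])
      _ = (K * q + p + 2 * q * c) * (U + V) * (|α| + |β|) := by ring
      _ ≤ _ := by gcongr; linarith
  · generalize a / u = α
    generalize b / v = β
    have hbr := bellH_bracket_le hp0 hqc hc0 hr0 hr1 hX0 hXp hY0 hYq α β
    rw [← hC3] at hbr
    refine (abs_add_le _ _).trans ?_
    rw [abs_mul P, abs_of_pos hP, abs_of_nonneg (by positivity)]
    calc _ ≤ K * q * (q - 1) * (U + V) * (α ^ 2 + β ^ 2) + (U + V) * (C3 * (α ^ 2 + β ^ 2)) := by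
          gcongr
          · linarith
          · nlinarith [sq_nonneg α]
      _ = (K * q * (q - 1) + C3) * (U + V) * (α ^ 2 + β ^ 2) := by ring
      _ ≤ _ := by gcongr; linarith

/-- Bounded measurable functions supported in the ball of radius `ρ`. -/
structure BddSupp (A : (Fin 3 → ℝ) → ℝ) (ρ M : ℝ) : Prop where
  meas : Measurable A
  bdd : ∀ y, |A y| ≤ M
  supp : ∀ y, ρ < ‖y‖ → A y = 0

lemma BddSupp.integrable_mul {A : (Fin 3 → ℝ) → ℝ} {ρ M : ℝ} (hA : BddSupp A ρ M)
    {k : (Fin 3 → ℝ) → ℝ} (hk : Continuous k) : Integrable fun y => k y * A y := by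
  obtain ⟨C, hC⟩ := (isCompact_closedBall (0 : Fin 3 → ℝ) ρ).exists_bound_of_continuousOn
    hk.continuousOn
  have h1 : IntegrableOn (fun y => k y * A y) (Metric.closedBall 0 ρ) := by
    refine Measure.integrableOn_of_bounded (M := C * M) (measure_closedBall_lt_top).ne
      (hk.measurable.mul hA.meas).aestronglyMeasurable ?_
    refine (ae_restrict_iff' measurableSet_closedBall).2 (ae_of_all _ fun y hy => ?_)
    rw [norm_mul]
    exact mul_le_mul (hC y hy) (hA.bdd y) (norm_nonneg _) ((norm_nonneg _).trans (hC y hy))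
  refine (integrableOn_iff_integrable_of_support_subset fun y hy => ?_).1 h1
  by_contra h
  refine hy ?_
  simp only [Metric.mem_closedBall, dist_zero_right, not_le] at h
  simp [hA.supp y h]

lemma BddSupp.integrable {A : (Fin 3 → ℝ) → ℝ} {ρ M : ℝ} (hA : BddSupp A ρ M) :
    Integrable A := by
  simpa using hA.integrable_mul (k := fun _ => 1) continuous_const

lemma BddSupp.rpow {A : (Fin 3 → ℝ) → ℝ} {ρ M : ℝ} (hA : BddSupp A ρ M) (h0 : ∀ y, 0 ≤ A y)
    {p : ℝ} (hp : 0 < p) : BddSupp (fun y => A y ^ p) ρ (M ^ p) where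
  meas := hA.meas.pow_const p
  bdd y := by
    rw [abs_of_nonneg (rpow_nonneg (h0 y) _)]
    exact rpow_le_rpow (h0 y) ((le_abs_self _).trans (hA.bdd y)) hp.le
  supp y hy := by simp only [hA.supp y hy, zero_rpow hp.ne']

/-- The potential of `A` with kernel `k`. -/
def pot (k A : (Fin 3 → ℝ) → ℝ) (x : Fin 3 → ℝ) : ℝ := ∫ y, k (x - y) * A y

lemma hasDerivAt_integral_mul {A : (Fin 3 → ℝ) → ℝ} {ρ M : ℝ} (hA : BddSupp A ρ M)
    {k k' : ℝ → (Fin 3 → ℝ) → ℝ} {s₀ δ : ℝ} (hδ : 0 < δ)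
    (hk : ∀ s ∈ Icc (s₀ - δ) (s₀ + δ), Continuous (k s))
    (hk' : ContinuousOn (Function.uncurry k') (Icc (s₀ - δ) (s₀ + δ) ×ˢ univ))
    (hder : ∀ s ∈ Icc (s₀ - δ) (s₀ + δ), ∀ y, HasDerivAt (fun s => k s y) (k' s y) s) :
    HasDerivAt (fun s => ∫ y, k s y * A y) (∫ y, k' s₀ y * A y) s₀ := by
  obtain ⟨C, hC⟩ := (isCompact_Icc.prod
    (isCompact_closedBall (0 : Fin 3 → ℝ) ρ)).exists_bound_of_continuousOn
    (hk'.mono (prod_mono_right (subset_univ _)))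
  have hs0 : s₀ ∈ Icc (s₀ - δ) (s₀ + δ) := ⟨by linarith, by linarith⟩
  have hcont : Continuous (k' s₀) := by
    rw [← continuousOn_univ]
    exact hk'.comp (f := fun y => (s₀, y)) (by fun_prop) (fun y _ => ⟨hs0, mem_univ _⟩)
  refine (hasDerivAt_integral_of_dominated_loc_of_deriv_le
    (F := fun s y => k s y * A y) (F' := fun s y => k' s y * A y)
    (bound := fun y => C * |A y|) (s := Icc (s₀ - δ) (s₀ + δ))
    (Icc_mem_nhds (by linarith) (by linarith)) ?_ (hA.integrable_mul (hk _ hs0))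
    (hcont.measurable.mul hA.meas).aestronglyMeasurable ?_ ?_ ?_).2
  · filter_upwards [Icc_mem_nhds (show s₀ - δ < s₀ by linarith) (show s₀ < s₀ + δ by linarith)]
      with s hs
    exact ((hk s hs).measurable.mul hA.meas).aestronglyMeasurable
  · refine ae_of_all _ fun y s hs => ?_
    rw [norm_mul]
    by_cases hy : ρ < ‖y‖
    · simp [hA.supp y hy]
    · exact mul_le_mul_of_nonneg_right (hC (s, y) ⟨hs, by simpa using hy⟩) (norm_nonneg _)
  · exact hA.integrable.abs.const_mul C
  · exact ae_of_all _ fun y s hs => (hder s hs y).mul_const _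

lemma continuous_heat (t : ℝ) : Continuous (heat t) := by
  unfold heat heat1; fun_prop

lemma continuous_heatG (i : Fin 3) (t : ℝ) : Continuous (heatG i t) := by
  unfold heatG; have := continuous_heat t; fun_prop

lemma continuous_heatH (i j : Fin 3) (t : ℝ) : Continuous (heatH i j t) := by
  unfold heatH; have := continuous_heat t; fun_prop

lemma measurable_heat : Measurable (Function.uncurry heat) := by
  unfold Function.uncurry heat heat1; fun_prop

lemma measurable_heatG (i : Fin 3) : Measurable (Function.uncurry (heatG i)) := by
  have := measurable_heat
  unfold Function.uncurry at *
  unfold heatG; fun_prop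

lemma measurable_heatH (i j : Fin 3) : Measurable (Function.uncurry (heatH i j)) := by
  have := measurable_heat
  unfold Function.uncurry at *
  unfold heatH; fun_prop

lemma measurable_pot {k : ℝ → (Fin 3 → ℝ) → ℝ} (hk : Measurable (Function.uncurry k))
    {A : (Fin 3 → ℝ) → ℝ} (hA : Measurable A) :
    Measurable fun z : ℝ × (Fin 3 → ℝ) => pot (k z.1) A z.2 := by
  have h : Measurable fun w : (ℝ × (Fin 3 → ℝ)) × (Fin 3 → ℝ) =>
      Function.uncurry k (w.1.1, w.1.2 - w.2) * A w.2 := by fun_prop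
  exact (h.stronglyMeasurable.integral_prod_right').measurable

/-- The point at height `s` on the `i`-th coordinate axis. -/
abbrev axis (i : Fin 3) (s : ℝ) : Fin 3 → ℝ := Pi.single i s

lemma hasDerivAt_sum_sq (x : Fin 3 → ℝ) (i : Fin 3) (s : ℝ) :
    HasDerivAt (fun s => ∑ k, (x + axis i s) k ^ 2) (2 * (x + axis i s) i) s := by
  have h : ∀ k ∈ Finset.univ, HasDerivAt (fun s => (x + axis i s) k ^ 2)
      (if k = i then 2 * (x + axis i s) i else 0) s := by
    intro k _
    by_cases hk : k = i
    · subst hk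
      simp only [Pi.add_apply, Pi.single_eq_same, if_true]
      refine (((hasDerivAt_id s).const_add (x k)).pow 2).congr_deriv ?_
      simp
    · simp only [Pi.add_apply, Pi.single_eq_of_ne hk, if_neg hk]
      exact hasDerivAt_const _ _
  refine (HasDerivAt.fun_sum h).congr_deriv ?_
  simp

lemma hasDerivAt_heat_single (t : ℝ) (x : Fin 3 → ℝ) (i : Fin 3) (s : ℝ) :
    HasDerivAt (fun s => heat t (x + axis i s)) (heatG i t (x + axis i s)) s := by
  simp only [heatG, heat_eq]
  refine ((((hasDerivAt_sum_sq x i s).fun_neg.div_const (4 * t)).exp).const_mul _).congr_deriv ?_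
  by_cases ht : t = 0
  · simp [ht]
  · field_simp; norm_num

lemma hasDerivAt_heatG_single {t : ℝ} (ht : t ≠ 0) (x : Fin 3 → ℝ) (i : Fin 3) (s : ℝ) :
    HasDerivAt (fun s => heatG i t (x + axis i s)) (heatH i i t (x + axis i s)) s := by
  have h1 : HasDerivAt (fun s => -(x + axis i s) i / (2 * t)) (-1 / (2 * t)) s := by
    simp only [Pi.add_apply, Pi.single_eq_same]
    exact (((hasDerivAt_id s).const_add (x i)).fun_neg.div_const _)
  refine (h1.mul (hasDerivAt_heat_single t x i s)).congr_deriv ?_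
  unfold heatH heatG
  simp only [if_true]; field_simp; ring

lemma hasDerivAt_heat_time {t : ℝ} (ht : 0 < t) (x : Fin 3 → ℝ) :
    HasDerivAt (fun t => heat t x) (∑ i, heatH i i t x) t := by
  have e : ∀ᶠ t in nhds t, heat t x =
      ((4 * π) ^ (-(3 / 2) : ℝ)) * (t ^ (-(3 / 2) : ℝ) * exp (-(∑ i, x i ^ 2) * (4 * t)⁻¹)) := by
    filter_upwards [lt_mem_nhds ht] with t ht
    rw [heat_eq, ← mul_assoc, ← mul_rpow (by positivity) ht.le, div_eq_mul_inv, sqrt_eq_rpow,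
      ← rpow_neg (by positivity), ← rpow_natCast, ← rpow_mul (by positivity)]
    norm_num
  have h0 : HasDerivAt (fun t : ℝ => (4 * t)⁻¹) (-4 / (4 * t) ^ 2) t := by
    refine (((hasDerivAt_id t).const_mul 4).fun_inv (by simp [ht.ne'])).congr_deriv ?_
    simp
  have h := ((((hasDerivAt_id t).rpow_const (p := (-(3 / 2) : ℝ)) (Or.inl ht.ne')).mul
    ((h0.const_mul (-(∑ i, x i ^ 2))).exp)).const_mul ((4 * π) ^ (-(3 / 2) : ℝ)))
  refine (h.congr_of_eventuallyEq e).congr_deriv ?_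
  unfold heatH
  simp only [if_true]
  rw [← Finset.sum_mul, e.self_of_nhds]
  simp only [id]
  rw [rpow_sub_one ht.ne', Finset.sum_sub_distrib, ← Finset.sum_div]
  simp only [Finset.sum_const, Finset.card_univ, Fintype.card_fin, ← sq, nsmul_eq_mul]
  generalize t ^ (-(3 / 2) : ℝ) = T
  field_simp
  ring

lemma continuousOn_heatH (i j : Fin 3) :
    ContinuousOn (Function.uncurry (heatH i j)) (Ioi 0 ×ˢ univ) := by
  unfold Function.uncurry heatH heat heat1
  have h1 : ∀ p ∈ (Ioi (0 : ℝ) ×ˢ (univ : Set (Fin 3 → ℝ))), 0 < p.1 := fun p hp => hp.1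
  have h : ∀ p ∈ (Ioi (0 : ℝ) ×ˢ (univ : Set (Fin 3 → ℝ))), p.1 ≠ 0 := fun p hp => (h1 p hp).ne'
  refine ContinuousOn.mul (ContinuousOn.sub (ContinuousOn.div (by fun_prop) (by fun_prop) ?_)
    (ContinuousOn.div (by fun_prop) (by fun_prop) ?_))
    (continuousOn_finsetProd _ fun k _ => ContinuousOn.mul (ContinuousOn.inv₀ (by fun_prop) ?_)
      (ContinuousOn.rexp (ContinuousOn.div (by fun_prop) (by fun_prop) ?_)))
  · intro p hp; have := h1 p hp; positivity
  · intro p hp; have := h1 p hp; positivity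
  · intro p hp; have := h1 p hp; positivity
  · intro p hp; have := h1 p hp; positivity

section
variable {A : (Fin 3 → ℝ) → ℝ} {ρ M : ℝ}

lemma hasDerivAt_pot_single (hA : BddSupp A ρ M) {k k' : (Fin 3 → ℝ) → ℝ}
    (hk : Continuous k) (hk' : Continuous k') (i : Fin 3)
    (hd : ∀ x s, HasDerivAt (fun s => k (x + axis i s)) (k' (x + axis i s)) s)
    (x : Fin 3 → ℝ) (s : ℝ) :
    HasDerivAt (fun s => pot k A (x + axis i s)) (pot k' A (x + axis i s)) s := by
  have hs : Continuous fun s : ℝ => axis i s :=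
    continuous_single (A := fun _ : Fin 3 => ℝ) i
  refine hasDerivAt_integral_mul hA (k := fun s y => k (x + axis i s - y))
    (k' := fun s y => k' (x + axis i s - y)) one_pos (fun s _ => by fun_prop)
    (Continuous.continuousOn ?_) (fun s _ y => ?_)
  · unfold Function.uncurry; fun_prop
  · simpa only [add_sub_right_comm] using hd (x - y) s

lemma hasDerivAt_pot_heat (hA : BddSupp A ρ M) (t : ℝ) (i : Fin 3) (x : Fin 3 → ℝ) (s : ℝ) :
    HasDerivAt (fun s => pot (heat t) A (x + axis i s))
      (pot (heatG i t) A (x + axis i s)) s :=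
  hasDerivAt_pot_single hA (continuous_heat t) (continuous_heatG i t) i
    (fun x s => hasDerivAt_heat_single t x i s) x s

lemma hasDerivAt_pot_heatG (hA : BddSupp A ρ M) {t : ℝ} (ht : 0 < t) (i : Fin 3)
    (x : Fin 3 → ℝ) (s : ℝ) :
    HasDerivAt (fun s => pot (heatG i t) A (x + axis i s))
      (pot (heatH i i t) A (x + axis i s)) s :=
  hasDerivAt_pot_single hA (continuous_heatG i t) (continuous_heatH i i t) i
    (fun x s => hasDerivAt_heatG_single ht.ne' x i s) x s

lemma hasDerivAt_pot_time (hA : BddSupp A ρ M) {t : ℝ} (ht : 0 < t) (x : Fin 3 → ℝ) :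
    HasDerivAt (fun t => pot (heat t) A x) (∑ i, pot (heatH i i t) A x) t := by
  have hpos : ∀ s ∈ Icc (t - t / 2) (t + t / 2), 0 < s := fun s hs => by linarith [hs.1]
  have hc : Continuous fun p : ℝ × (Fin 3 → ℝ) => (p.1, x - p.2) := by fun_prop
  have h := hasDerivAt_integral_mul hA (k := fun t y => heat t (x - y))
    (k' := fun t y => ∑ i, heatH i i t (x - y)) (half_pos ht)
    (fun s _ => (continuous_heat s).comp (by fun_prop))
    (continuousOn_finsetSum _ fun i _ => (continuousOn_heatH i i).comp
      (f := fun p : ℝ × (Fin 3 → ℝ) => (p.1, x - p.2)) hc.continuousOn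
      fun p hp => ⟨hpos _ hp.1, mem_univ _⟩)
    (fun s hs y => hasDerivAt_heat_time (hpos s hs) (x - y))
  refine h.congr_deriv ?_
  simp only [Finset.sum_mul]
  exact integral_finsetSum _ fun i _ => hA.integrable_mul
    ((continuous_heatH i i t).comp (by fun_prop : Continuous fun y => x - y))

lemma abs_pot_le (hA : BddSupp A ρ M) (h0 : ∀ y, 0 ≤ A y) {k l : (Fin 3 → ℝ) → ℝ}
    (hk : Continuous k) (hl : Continuous l) (x : Fin 3 → ℝ) {C : ℝ}
    (h : ∀ y, ‖y‖ ≤ ρ → |k (x - y)| ≤ C * l (x - y)) :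
    |pot k A x| ≤ C * pot l A x := by
  unfold pot
  rw [← integral_const_mul]
  refine (abs_integral_le_integral_abs).trans (integral_mono ?_ ?_ fun y => ?_)
  · exact (hA.integrable_mul (hk.comp (by fun_prop : Continuous fun y => x - y))).abs
  · exact (hA.integrable_mul (hl.comp (by fun_prop : Continuous fun y => x - y))).const_mul _
  · simp only
    rw [abs_mul, abs_of_nonneg (h0 y), ← mul_assoc]
    by_cases hy : ρ < ‖y‖
    · simp [hA.supp y hy]
    · exact mul_le_mul_of_nonneg_right (h y (not_lt.1 hy)) (h0 y)

lemma pot_heat_nonneg (h0 : ∀ y, 0 ≤ A y) {t : ℝ} (ht : 0 < t) (x : Fin 3 → ℝ) :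
    0 ≤ pot (heat t) A x :=
  integral_nonneg fun y => mul_nonneg (heat_pos ht _).le (h0 y)

lemma pot_heat_pos (hA : BddSupp A ρ M) (h0 : ∀ y, 0 ≤ A y) (hpos : 0 < ∫ y, A y)
    {t : ℝ} (ht : 0 < t) (x : Fin 3 → ℝ) : 0 < pot (heat t) A x := by
  unfold pot
  rw [integral_pos_iff_support_of_nonneg (fun y => mul_nonneg (heat_pos ht _).le (h0 y))
    (hA.integrable_mul ((continuous_heat t).comp (by fun_prop : Continuous fun y => x - y)))]
  rw [integral_pos_iff_support_of_nonneg h0 hA.integrable] at hpos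
  convert hpos using 2
  ext y
  simp [(heat_pos ht _).ne']

lemma abs_pot_heatG_le (hA : BddSupp A ρ M) (h0 : ∀ y, 0 ≤ A y) {τ t : ℝ} (hτ : 0 < τ)
    (ht : τ ≤ t) (i : Fin 3) (x : Fin 3 → ℝ) :
    |pot (heatG i t) A x| ≤ ((‖x‖ + ρ) / (2 * τ)) * pot (heat t) A x := by
  have ht0 : 0 < t := hτ.trans_le ht
  refine abs_pot_le hA h0 (continuous_heatG i t) (continuous_heat t) x fun y hy => ?_
  unfold heatG
  have hh := heat_pos ht0 (x - y)
  rw [abs_mul, abs_of_pos hh, abs_div, abs_neg, abs_of_pos (by positivity : 0 < 2 * t)]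
  have h1 : |(x - y) i| ≤ ‖x‖ + ρ := by
    have := norm_le_pi_norm (x - y) i
    have := norm_sub_le x y
    simp only [norm_eq_abs] at *; linarith
  gcongr
  exact (abs_nonneg _).trans h1

lemma abs_pot_heatH_le (hA : BddSupp A ρ M) (h0 : ∀ y, 0 ≤ A y) {τ t : ℝ} (hτ : 0 < τ)
    (ht : τ ≤ t) (i : Fin 3) (x : Fin 3 → ℝ) :
    |pot (heatH i i t) A x| ≤ ((‖x‖ + ρ) ^ 2 / (4 * τ ^ 2) + 1 / (2 * τ)) * pot (heat t) A x := by
  have ht0 : 0 < t := hτ.trans_le ht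
  refine abs_pot_le hA h0 (continuous_heatH i i t) (continuous_heat t) x fun y hy => ?_
  unfold heatH
  have hh := heat_pos ht0 (x - y)
  rw [abs_mul, abs_of_pos hh, if_pos rfl]
  have h1 : |(x - y) i| ≤ ‖x‖ + ρ := by
    have := norm_le_pi_norm (x - y) i
    have := norm_sub_le x y
    simp only [norm_eq_abs] at *; linarith
  gcongr
  refine (abs_sub _ _).trans ?_
  rw [← sq, abs_div, abs_div, abs_pow, abs_one, abs_of_pos (by positivity : 0 < 2 * t),
    abs_of_pos (by positivity : 0 < 4 * t ^ 2)]
  gcongr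

lemma pot_heat_le_exp (hA : BddSupp A ρ M) (h0 : ∀ y, 0 ≤ A y) {τ S : ℝ} (hτ : 0 < τ) :
    ∃ C : ℝ, 0 ≤ C ∧ ∀ t ∈ Icc τ S, ∀ x, pot (heat t) A x ≤ C * exp (-(∑ i, x i ^ 2) / (8 * S)) := by
  refine ⟨((√(4 * π * τ))⁻¹) ^ 3 * exp (3 * ρ ^ 2 / (4 * τ)) * ∫ y, A y,
    mul_nonneg (by positivity) (integral_nonneg h0), fun t ht x => ?_⟩
  have ht0 : 0 < t := hτ.trans_le ht.1
  have hS : 0 < S := ht0.trans_le ht.2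
  unfold pot
  rw [mul_right_comm, ← integral_const_mul]
  refine integral_mono (hA.integrable_mul ((continuous_heat t).comp
    (by fun_prop : Continuous fun y => x - y))) (hA.integrable.const_mul _) fun y => ?_
  simp only
  by_cases hy : ρ < ‖y‖
  · simp [hA.supp y hy]
  refine mul_le_mul_of_nonneg_right ?_ (h0 y)
  rw [heat_eq, mul_assoc (_ ^ 3), ← exp_add]
  have e1 : (√(4 * π * t))⁻¹ ≤ (√(4 * π * τ))⁻¹ := by gcongr; exact ht.1
  have e2 : -(∑ i, (x - y) i ^ 2) / (4 * t) ≤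
      3 * ρ ^ 2 / (4 * τ) + -(∑ i, x i ^ 2) / (8 * S) := by
    have hyi : ∀ i, y i ^ 2 ≤ ρ ^ 2 := fun i => by
      have := norm_le_pi_norm y i
      rw [← sq_abs]
      simp only [norm_eq_abs] at *
      gcongr; linarith
    have hxi : ∀ i, x i ^ 2 / 2 - ρ ^ 2 ≤ (x - y) i ^ 2 := fun i => by
      have := hyi i
      simp only [Pi.sub_apply]
      nlinarith [sq_nonneg (x i - 2 * y i)]
    have hsum : (∑ i, x i ^ 2) / 2 - 3 * ρ ^ 2 ≤ ∑ i, (x - y) i ^ 2 := by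
      simp only [Fin.sum_univ_three]; linarith [hxi 0, hxi 1, hxi 2]
    have hq0 : 0 ≤ ∑ i, x i ^ 2 := Finset.sum_nonneg fun i _ => sq_nonneg _
    calc -(∑ i, (x - y) i ^ 2) / (4 * t) ≤ -((∑ i, x i ^ 2) / 2 - 3 * ρ ^ 2) / (4 * t) := by
          gcongr
      _ = 3 * ρ ^ 2 / (4 * t) - (∑ i, x i ^ 2) / (8 * t) := by field_simp; ring
      _ ≤ 3 * ρ ^ 2 / (4 * τ) - (∑ i, x i ^ 2) / (8 * S) := by
          gcongr
          · exact ht.1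
          · exact ht.2
      _ = _ := by ring
  gcongr

lemma integral_pot_heat_rpow_le (hA : BddSupp A ρ M) (h0 : ∀ y, 0 ≤ A y) {p : ℝ} (hp : 1 ≤ p)
    {t : ℝ} (ht : 0 < t) (hInt : Integrable fun x => pot (heat t) A x ^ p) :
    ∫ x, pot (heat t) A x ^ p ≤ ∫ y, A y ^ p := by
  have hp0 : 0 < p := by linarith
  have hAp := hA.rpow h0 hp0
  have hconv : ∀ x, pot (heat t) (fun y => A y ^ p) x =
      convolution (fun y => A y ^ p) (heat t) (ContinuousLinearMap.mul ℝ ℝ) volume x := by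
    intro x; unfold pot convolution
    simp [mul_comm]
  have hint2 : Integrable (pot (heat t) (fun y => A y ^ p)) := by
    have := hAp.integrable.integrable_convolution (ContinuousLinearMap.mul ℝ ℝ) (integrable_heat ht)
    exact this.congr (ae_of_all _ fun x => (hconv x).symm)
  have hval : ∫ x, pot (heat t) (fun y => A y ^ p) x = ∫ y, A y ^ p := by
    simp only [hconv]
    rw [integral_convolution _ hAp.integrable (integrable_heat ht)]
    simp [integral_heat ht]
  rw [← hval]
  refine integral_mono hInt hint2 fun x => ?_
  simp only
  set u := pot (heat t) A x with hu
  have hu0 : 0 ≤ u := pot_heat_nonneg h0 ht x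
  have hc : Continuous fun y => heat t (x - y) :=
    (continuous_heat t).comp (by fun_prop : Continuous fun y => x - y)
  rcases hu0.eq_or_lt with h | h
  · rw [← h, zero_rpow hp0.ne']
    exact pot_heat_nonneg (fun y => rpow_nonneg (h0 y) p) ht x
  have hheat : ∫ y, heat t (x - y) = 1 := by
    rw [integral_sub_left_eq_self (heat t) volume x, integral_heat ht]
  have hiheat : Integrable fun y => heat t (x - y) := (integrable_heat ht).comp_sub_left x
  have key : ∀ y, u ^ p * heat t (x - y) + (p * u ^ (p - 1)) * (heat t (x - y) * A y)
      - (p * u ^ (p - 1)) * u * heat t (x - y) ≤ heat t (x - y) * A y ^ p := by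
    intro y
    have hb := one_add_mul_self_le_rpow_one_add (s := A y / u - 1)
      (by have : 0 ≤ A y / u := div_nonneg (h0 y) hu0
          linarith) hp
    rw [show 1 + (A y / u - 1) = A y / u by ring, div_rpow (h0 y) hu0,
      le_div_iff₀ (by positivity)] at hb
    have hup : u ^ p = u ^ (p - 1) * u := by rw [rpow_sub_one h.ne']; field_simp
    have e : (1 + p * (A y / u - 1)) * u ^ p = u ^ p + p * u ^ (p - 1) * A y
        - p * u ^ (p - 1) * u := by rw [hup]; field_simp; ring
    rw [e] at hb
    have := mul_le_mul_of_nonneg_left hb (heat_pos ht (x - y)).le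
    linarith
  have hi1 := hiheat.const_mul (u ^ p)
  have hi2 := (hA.integrable_mul hc).const_mul (p * u ^ (p - 1))
  have hi3 := hiheat.const_mul (p * u ^ (p - 1) * u)
  have h1 := integral_mono ((hi1.add hi2).sub hi3) (hAp.integrable_mul hc) key
  simp only [Pi.sub_apply, Pi.add_apply] at h1
  have hi12 : Integrable (fun y => u ^ p * heat t (x - y) +
    (p * u ^ (p - 1)) * (heat t (x - y) * A y)) := hi1.add hi2
  rw [integral_sub hi12 hi3, integral_add hi1 hi2, integral_const_mul, integral_const_mul,
    integral_const_mul, hheat] at h1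
  have hu' : ∫ y, heat t (x - y) * A y = u := rfl
  rw [hu'] at h1
  have : pot (heat t) (fun y => A y ^ p) x = ∫ y, heat t (x - y) * A y ^ p := rfl
  rw [this]; linarith

end

lemma measurable_bellQ (p q K : ℝ) {X : Type*} [MeasurableSpace X] {u v : X → ℝ}
    (hu : Measurable u) (hv : Measurable v) : Measurable fun x => bellQ p q K (u x) (v x) := by
  unfold bellQ bellP bellW; fun_prop

lemma measurable_bellD (p q K : ℝ) {X : Type*} [MeasurableSpace X] {u v a b : X → ℝ}
    (hu : Measurable u) (hv : Measurable v) (ha : Measurable a) (hb : Measurable b) :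
    Measurable fun x => bellD p q K (u x) (v x) (a x) (b x) := by
  unfold bellD bellP bellRho bellW; fun_prop

lemma measurable_bellH (p q K : ℝ) {X : Type*} [MeasurableSpace X] {u v a b : X → ℝ}
    (hu : Measurable u) (hv : Measurable v) (ha : Measurable a) (hb : Measurable b) :
    Measurable fun x => bellH p q K (u x) (v x) (a x) (b x) := by
  unfold bellH bellP bellRho bellW; fun_prop

/-- The Bellman function along the heat flow of the pair `(A, B)`. -/
def flowQ (p q K : ℝ) (A B : (Fin 3 → ℝ) → ℝ) (t : ℝ) (x : Fin 3 → ℝ) : ℝ :=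
  bellQ p q K (pot (heat t) A x) (pot (heat t) B x)

/-- The `i`-th spatial derivative of `flowQ`. -/
def flowD (p q K : ℝ) (A B : (Fin 3 → ℝ) → ℝ) (i : Fin 3) (t : ℝ) (x : Fin 3 → ℝ) : ℝ :=
  bellD p q K (pot (heat t) A x) (pot (heat t) B x) (pot (heatG i t) A x) (pot (heatG i t) B x)

/-- The part of the second derivative of `flowQ` coming from the heat equation. -/
def flowT (p q K : ℝ) (A B : (Fin 3 → ℝ) → ℝ) (i : Fin 3) (t : ℝ) (x : Fin 3 → ℝ) : ℝ :=
  bellD p q K (pot (heat t) A x) (pot (heat t) B x) (pot (heatH i i t) A x) (pot (heatH i i t) B x)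

/-- The part of the second derivative of `flowQ` coming from convexity. -/
def flowH (p q K : ℝ) (A B : (Fin 3 → ℝ) → ℝ) (i : Fin 3) (t : ℝ) (x : Fin 3 → ℝ) : ℝ :=
  bellH p q K (pot (heat t) A x) (pot (heat t) B x) (pot (heatG i t) A x) (pot (heatG i t) B x)

lemma integrable_exp_neg_sum_sq {b : ℝ} (hb : 0 < b) :
    Integrable fun x : Fin 3 → ℝ => exp (-(∑ i, x i ^ 2) / b) := by
  have h := (integrable_heat (t := b / 4) (by positivity)).const_mul (√(4 * π * (b / 4)) ^ 3)
  refine h.congr (ae_of_all _ fun x => ?_)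
  simp only [heat_eq]
  have : √(4 * π * (b / 4)) ≠ 0 := by positivity
  field_simp

lemma one_add_norm_sq_le_exp {b : ℝ} (hb : 0 < b) (x : Fin 3 → ℝ) :
    (1 + ‖x‖) ^ 2 ≤ (2 + 2 * b) * exp ((∑ i, x i ^ 2) / b) := by
  have h1 : ‖x‖ ^ 2 ≤ ∑ i, x i ^ 2 := by
    have h : ‖x‖ ≤ √(∑ i, x i ^ 2) := by
      refine (pi_norm_le_iff_of_nonneg (sqrt_nonneg _)).2 fun i => ?_
      apply le_sqrt_of_sq_le
      rw [norm_eq_abs, sq_abs]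
      exact Finset.single_le_sum (f := fun i => x i ^ 2) (fun i _ => sq_nonneg _)
        (Finset.mem_univ i)
    have h0 : 0 ≤ ∑ i, x i ^ 2 := Finset.sum_nonneg fun i _ => sq_nonneg _
    calc _ ≤ (√(∑ i, x i ^ 2)) ^ 2 := by gcongr
      _ = _ := sq_sqrt h0
  set Y := ∑ i, x i ^ 2
  have hY : 0 ≤ Y := (sq_nonneg _).trans h1
  have h2 := add_one_le_exp (Y / b)
  have h3 : (2 + 2 * b) * (Y / b + 1) ≤ (2 + 2 * b) * exp (Y / b) := by gcongr
  have h4 : (2 + 2 * b) * (Y / b + 1) = 2 * Y / b + 2 * Y + 2 + 2 * b := by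
    field_simp; ring
  have h5 : 0 ≤ 2 * Y / b := by positivity
  nlinarith [sq_nonneg (1 - ‖x‖)]

section
variable {p q K : ℝ} {A B : (Fin 3 → ℝ) → ℝ} {ρ M : ℝ}

set_option maxHeartbeats 1000000 in
lemma flow_dominated (hp : 2 ≤ p) (hq : 1 < q) (hK : 0 ≤ K)
    (hA : BddSupp A ρ M) (hB : BddSupp B ρ M) (hρ : 0 ≤ ρ)
    (hA0 : ∀ y, 0 ≤ A y) (hB0 : ∀ y, 0 ≤ B y) (hAp : 0 < ∫ y, A y) (hBp : 0 < ∫ y, B y)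
    {τ S : ℝ} (hτ : 0 < τ) (hS : 0 < S) :
    ∃ C : ℝ, ∀ t ∈ Icc τ S, ∀ x i,
      |flowQ p q K A B t x| ≤ C * exp (-(∑ i, x i ^ 2) / (16 * S)) ∧
      |flowD p q K A B i t x| ≤ C * exp (-(∑ i, x i ^ 2) / (16 * S)) ∧
      |flowT p q K A B i t x| ≤ C * exp (-(∑ i, x i ^ 2) / (16 * S)) ∧
      |flowH p q K A B i t x| ≤ C * exp (-(∑ i, x i ^ 2) / (16 * S)) := by
  obtain ⟨C₀, hC₀, hb⟩ := bell_bounds hp hq hK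
  obtain ⟨CA, hCA, hA1⟩ := pot_heat_le_exp hA hA0 (S := S) hτ
  obtain ⟨CB, hCB, hB1⟩ := pot_heat_le_exp hB hB0 (S := S) hτ
  set R := 1 + (1 + ρ) ^ 2 / (4 * τ ^ 2) + 1 / (2 * τ) + (1 + ρ) / (2 * τ)
    + ((1 + ρ) / (2 * τ)) ^ 2 with hR
  have hR0 : 0 ≤ R := by positivity
  set D := C₀ * (CA ^ p + CB ^ q) * (2 * R) * (2 + 2 * (16 * S)) with hD
  refine ⟨D, fun t ht x i => ?_⟩
  have ht0 : 0 < t := hτ.trans_le ht.1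
  have hu := pot_heat_pos hA hA0 hAp ht0 x
  have hv := pot_heat_pos hB hB0 hBp ht0 x
  have hu1 := hA1 t ht x
  have hv1 := hB1 t ht x
  have gA := abs_pot_heatG_le hA hA0 hτ ht.1 i x
  have gB := abs_pot_heatG_le hB hB0 hτ ht.1 i x
  have hhA := abs_pot_heatH_le hA hA0 hτ ht.1 i x
  have hhB := abs_pot_heatH_le hB hB0 hτ ht.1 i x
  unfold flowQ flowD flowT flowH
  set u := pot (heat t) A x
  set v := pot (heat t) B x
  obtain ⟨⟨hQ0, hQ⟩, hDb, hHb⟩ := hb u v hu hv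
  set Y := ∑ i, x i ^ 2 with hYd
  have hY : 0 ≤ Y := Finset.sum_nonneg fun i _ => sq_nonneg _
  have hpow : ∀ {w Cw s : ℝ}, 0 < w → 0 ≤ Cw → 1 < s → w ≤ Cw * exp (-Y / (8 * S)) →
      w ^ s ≤ Cw ^ s * exp (-Y / (8 * S)) := by
    intro w Cw s hw hCw hs h
    calc w ^ s ≤ (Cw * exp (-Y / (8 * S))) ^ s := by gcongr
      _ = Cw ^ s * exp (-Y / (8 * S) * s) := by
          rw [mul_rpow hCw (exp_pos _).le, ← exp_mul]
      _ ≤ _ := by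
          have : 0 ≤ Y / (8 * S) := by positivity
          gcongr
          rw [neg_div]; nlinarith
  have huv : u ^ p + v ^ q ≤ (CA ^ p + CB ^ q) * exp (-Y / (8 * S)) := by
    have h1 := hpow hu hCA (by linarith : 1 < p) hu1
    have h2 := hpow hv hCB hq hv1
    linarith
  set N := 1 + ‖x‖ with hN
  have hx0 := norm_nonneg x
  have hN1 : 1 ≤ N := by linarith
  have hNN : N ≤ N ^ 2 := by nlinarith
  have hxρ : ‖x‖ + ρ ≤ (1 + ρ) * N := by
    have h1 := mul_nonneg hρ hx0
    have h2 : (1 + ρ) * N = 1 + ρ + ‖x‖ + ρ * ‖x‖ := by rw [hN]; ring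
    linarith
  have hxρ2 : ‖x‖ + ρ ≤ (1 + ρ) * N ^ 2 :=
    hxρ.trans (mul_le_mul_of_nonneg_left hNN (by linarith))
  have hN2 : 1 ≤ N ^ 2 := by linarith
  have hxρ0 : 0 ≤ ‖x‖ + ρ := by positivity
  have hg : (‖x‖ + ρ) / (2 * τ) ≤ R * N ^ 2 := by
    calc _ ≤ (1 + ρ) * N ^ 2 / (2 * τ) := by gcongr
      _ = (1 + ρ) / (2 * τ) * N ^ 2 := by ring
      _ ≤ _ := by
        gcongr
        have h1 : 0 ≤ (1 + ρ) ^ 2 / (4 * τ ^ 2) := by positivity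
        have h2 : 0 ≤ 1 / (2 * τ) := by positivity
        have h3 : 0 ≤ ((1 + ρ) / (2 * τ)) ^ 2 := by positivity
        linarith
  have hg2 : ((‖x‖ + ρ) / (2 * τ)) ^ 2 ≤ R * N ^ 2 := by
    calc _ ≤ ((1 + ρ) * N / (2 * τ)) ^ 2 := by gcongr
      _ = ((1 + ρ) / (2 * τ)) ^ 2 * N ^ 2 := by ring
      _ ≤ _ := by
        gcongr
        have h1 : 0 ≤ (1 + ρ) ^ 2 / (4 * τ ^ 2) := by positivity
        have h2 : 0 ≤ 1 / (2 * τ) := by positivity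
        have h3 : 0 ≤ (1 + ρ) / (2 * τ) := by positivity
        linarith
  have hh : (‖x‖ + ρ) ^ 2 / (4 * τ ^ 2) + 1 / (2 * τ) ≤ R * N ^ 2 := by
    calc _ ≤ ((1 + ρ) * N) ^ 2 / (4 * τ ^ 2) + 1 / (2 * τ) * N ^ 2 := by
          have h2 : 0 ≤ 1 / (2 * τ) := by positivity
          gcongr
          exact le_mul_of_one_le_right h2 hN2
      _ = ((1 + ρ) ^ 2 / (4 * τ ^ 2) + 1 / (2 * τ)) * N ^ 2 := by ring
      _ ≤ _ := by
        gcongr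
        have h2 : 0 ≤ ((1 + ρ) / (2 * τ)) ^ 2 := by positivity
        have h3 : 0 ≤ (1 + ρ) / (2 * τ) := by positivity
        linarith
  have hR1 : 1 ≤ R * N ^ 2 := by
    have h1 : 1 ≤ R := by
      have h1 : 0 ≤ (1 + ρ) ^ 2 / (4 * τ ^ 2) := by positivity
      have h2 : 0 ≤ 1 / (2 * τ) := by positivity
      have h3 : 0 ≤ (1 + ρ) / (2 * τ) := by positivity
      have h4 : 0 ≤ ((1 + ρ) / (2 * τ)) ^ 2 := by positivity
      linarith
    exact one_le_mul_of_one_le_of_one_le h1 hN2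
  have hdiv : ∀ {a w c : ℝ}, 0 < w → |a| ≤ c * w → |a / w| ≤ c := by
    intro a w c hw h
    rwa [abs_div, abs_of_pos hw, div_le_iff₀ hw]
  have hfin : ∀ {Z : ℝ}, Z ≤ 2 * (R * N ^ 2) →
      C₀ * (u ^ p + v ^ q) * Z ≤ D * exp (-Y / (16 * S)) := by
    intro Z hZ
    have hup : 0 < u ^ p + v ^ q := by positivity
    calc C₀ * (u ^ p + v ^ q) * Z ≤ C₀ * (u ^ p + v ^ q) * (2 * (R * N ^ 2)) := by gcongr
      _ ≤ C₀ * ((CA ^ p + CB ^ q) * exp (-Y / (8 * S))) *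
          (2 * (R * ((2 + 2 * (16 * S)) * exp (Y / (16 * S))))) := by
          gcongr
          exact one_add_norm_sq_le_exp (by positivity) x
      _ = D * (exp (-Y / (8 * S)) * exp (Y / (16 * S))) := by rw [hD]; ring
      _ = _ := by
          rw [← exp_add]; congr 2; field_simp; ring
  refine ⟨?_, (hDb _ _).trans (hfin ?_), (hDb _ _).trans (hfin ?_), (hHb _ _).trans (hfin ?_)⟩
  · rw [abs_of_nonneg hQ0]
    refine hQ.trans ?_
    rw [← mul_one (C₀ * _)]
    exact hfin (by linarith)
  · linarith [hdiv hu gA, hdiv hv gB]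
  · linarith [hdiv hu hhA, hdiv hv hhB]
  · have h1 := pow_le_pow_left₀ (abs_nonneg _) (hdiv hu gA) 2
    have h2 := pow_le_pow_left₀ (abs_nonneg _) (hdiv hv gB) 2
    rw [sq_abs] at h1 h2
    linarith

lemma measurable_flowQ (hA : BddSupp A ρ M) (hB : BddSupp B ρ M) :
    Measurable (Function.uncurry (flowQ p q K A B)) :=
  measurable_bellQ _ _ _ (measurable_pot measurable_heat hA.meas)
    (measurable_pot measurable_heat hB.meas)

lemma measurable_flowD (hA : BddSupp A ρ M) (hB : BddSupp B ρ M) (i : Fin 3) :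
    Measurable (Function.uncurry (flowD p q K A B i)) :=
  measurable_bellD _ _ _ (measurable_pot measurable_heat hA.meas)
    (measurable_pot measurable_heat hB.meas) (measurable_pot (measurable_heatG i) hA.meas)
    (measurable_pot (measurable_heatG i) hB.meas)

lemma measurable_flowT (hA : BddSupp A ρ M) (hB : BddSupp B ρ M) (i : Fin 3) :
    Measurable (Function.uncurry (flowT p q K A B i)) :=
  measurable_bellD _ _ _ (measurable_pot measurable_heat hA.meas)
    (measurable_pot measurable_heat hB.meas) (measurable_pot (measurable_heatH i i) hA.meas)
    (measurable_pot (measurable_heatH i i) hB.meas)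

lemma measurable_flowH (hA : BddSupp A ρ M) (hB : BddSupp B ρ M) (i : Fin 3) :
    Measurable (Function.uncurry (flowH p q K A B i)) :=
  measurable_bellH _ _ _ (measurable_pot measurable_heat hA.meas)
    (measurable_pot measurable_heat hB.meas) (measurable_pot (measurable_heatG i) hA.meas)
    (measurable_pot (measurable_heatG i) hB.meas)

lemma axis_eq_smul (i : Fin 3) (s : ℝ) : axis i s = s • axis i 1 := by
  ext k; simp [axis, Pi.single_apply]

lemma integral_lineDeriv_eq_zero {f f' : (Fin 3 → ℝ) → ℝ} (i : Fin 3)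
    (hf : Integrable f) (hf' : Integrable f')
    (h : ∀ x, HasDerivAt (fun s => f (x + axis i s)) (f' x) 0) : ∫ x, f' x = 0 := by
  have := integral_bilinear_hasLineDerivAt_right_eq_neg_left_of_integrable
    (μ := (volume : Measure (Fin 3 → ℝ)))
    (f := fun _ => (1 : ℝ)) (f' := fun _ => (0 : ℝ)) (g := f) (g' := f') (v := axis i 1)
    (B := ContinuousLinearMap.mul ℝ ℝ) (by simp) (by simpa using hf') (by simpa using hf)
    (fun x _ => by simpa [HasLineDerivAt] using hasDerivAt_const (0 : ℝ) (1 : ℝ))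
    (fun x _ => by
      unfold HasLineDerivAt
      simpa only [← axis_eq_smul] using h x)
  simpa using this

lemma integral_flowT_add_flowH (hp : 2 ≤ p) (hq : 1 < q) (hK : 0 ≤ K)
    (hA : BddSupp A ρ M) (hB : BddSupp B ρ M) (hρ : 0 ≤ ρ)
    (hA0 : ∀ y, 0 ≤ A y) (hB0 : ∀ y, 0 ≤ B y) (hAp : 0 < ∫ y, A y) (hBp : 0 < ∫ y, B y)
    {t : ℝ} (ht : 0 < t) (i : Fin 3) :
    Integrable (flowT p q K A B i t) ∧ Integrable (flowH p q K A B i t) ∧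
    ∫ x, (flowT p q K A B i t x + flowH p q K A B i t x) = 0 := by
  obtain ⟨C, hC⟩ := flow_dominated (p := p) (q := q) (K := K) hp hq hK hA hB hρ hA0 hB0 hAp hBp
    ht ht
  have hdom := (integrable_exp_neg_sum_sq (b := 16 * t) (by positivity)).const_mul C
  have htt : t ∈ Icc t t := ⟨le_rfl, le_rfl⟩
  have hT : Integrable (flowT p q K A B i t) := hdom.mono'
    ((measurable_flowT hA hB i).comp (measurable_prodMk_left)).aestronglyMeasurable
    (ae_of_all _ fun x => (hC t htt x i).2.2.1)
  have hH : Integrable (flowH p q K A B i t) := hdom.mono'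
    ((measurable_flowH hA hB i).comp (measurable_prodMk_left)).aestronglyMeasurable
    (ae_of_all _ fun x => (hC t htt x i).2.2.2)
  have hD : Integrable (flowD p q K A B i t) := hdom.mono'
    ((measurable_flowD hA hB i).comp (measurable_prodMk_left)).aestronglyMeasurable
    (ae_of_all _ fun x => (hC t htt x i).2.1)
  refine ⟨hT, hH, integral_lineDeriv_eq_zero i hD (hT.add hH) fun x => ?_⟩
  have e0 : ∀ k, x + axis k 0 = x := fun k => by simp [axis]
  have h := hasDerivAt_bellD p q K (by linarith) (s := 0)
    (u := fun s => pot (heat t) A (x + axis i s)) (v := fun s => pot (heat t) B (x + axis i s))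
    (u' := fun s => pot (heatG i t) A (x + axis i s))
    (v' := fun s => pot (heatG i t) B (x + axis i s))
    (pot_heat_pos hA hA0 hAp ht _) (pot_heat_pos hB hB0 hBp ht _)
    (hasDerivAt_pot_heat hA t i x 0) (hasDerivAt_pot_heat hB t i x 0)
    (hasDerivAt_pot_heatG hA ht i x 0) (hasDerivAt_pot_heatG hB ht i x 0)
  simp only [e0] at h
  exact h

lemma hasDerivAt_flowQ (hp : 2 ≤ p) (hA : BddSupp A ρ M) (hB : BddSupp B ρ M)
    (hA0 : ∀ y, 0 ≤ A y) (hB0 : ∀ y, 0 ≤ B y) (hAp : 0 < ∫ y, A y) (hBp : 0 < ∫ y, B y)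
    {t : ℝ} (ht : 0 < t) (x : Fin 3 → ℝ) :
    HasDerivAt (fun t => flowQ p q K A B t x) (∑ i, flowT p q K A B i t x) t := by
  have h := hasDerivAt_bellQ p q K (by linarith) (s := t)
    (u := fun t => pot (heat t) A x) (v := fun t => pot (heat t) B x)
    (pot_heat_pos hA hA0 hAp ht _) (pot_heat_pos hB hB0 hBp ht _)
    (hasDerivAt_pot_time hA ht x) (hasDerivAt_pot_time hB ht x)
  refine h.congr_deriv ?_
  simp only [Fin.sum_univ_three, bellD_add, flowT]

set_option maxHeartbeats 1000000 in
lemma bilinear_heat_of_pos (hp : 2 ≤ p) (hq : 1 < q) (hK : 0 ≤ K)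
    (hH : ∀ u v : ℝ, 0 < u → 0 < v → ∀ a b : ℝ,
      v ^ (2 - q) * a ^ 2 + v ^ (q - 2) * b ^ 2 ≤ bellH p q K u v a b)
    {C₀ : ℝ} (hC₀ : 0 ≤ C₀)
    (hC : ∀ u v : ℝ, 0 < u → 0 < v → 0 ≤ bellQ p q K u v ∧ bellQ p q K u v ≤ C₀ * (u ^ p + v ^ q))
    (hA : BddSupp A ρ M) (hB : BddSupp B ρ M) (hρ : 0 ≤ ρ)
    (hA0 : ∀ y, 0 ≤ A y) (hB0 : ∀ y, 0 ≤ B y) (hAp : 0 < ∫ y, A y) (hBp : 0 < ∫ y, B y)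
    {τ S : ℝ} (hτ : 0 < τ) (hS : τ ≤ S) (i j : Fin 3) :
    ∫⁻ t in Ioc τ S, ∫⁻ x, ENNReal.ofReal |pot (heatG i t) A x * pot (heatG j t) B x| ≤
      ENNReal.ofReal (C₀ * ((∫ y, A y ^ p) + ∫ y, B y ^ q)) := by
  have hS0 : 0 < S := hτ.trans_le hS
  obtain ⟨C, hCd⟩ := flow_dominated (p := p) (q := q) (K := K) hp hq hK hA hB hρ hA0 hB0 hAp hBp
    hτ hS0
  have hdom := (integrable_exp_neg_sum_sq (b := 16 * S) (by positivity)).const_mul C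
  have hdom2 : Integrable (fun z : ℝ × (Fin 3 → ℝ) =>
      1 * (C * exp (-(∑ i, z.2 i ^ 2) / (16 * S)))) ((volume.restrict (Ioc τ S)).prod volume) :=
    Integrable.mul_prod (f := fun _ : ℝ => (1 : ℝ)) (by simp) hdom
  have hae : ∀ P : ℝ × (Fin 3 → ℝ) → Prop, (∀ t ∈ Icc τ S, ∀ x, P (t, x)) →
      ∀ᵐ z ∂((volume.restrict (Ioc τ S)).prod (volume : Measure (Fin 3 → ℝ))), P z := by
    intro P hP
    have h1 : ∀ᵐ t ∂(volume.restrict (Ioc τ S)), t ∈ Icc τ S :=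
      (ae_restrict_iff' measurableSet_Ioc).2 (ae_of_all _ fun t ht => Ioc_subset_Icc_self ht)
    have h2 := (Measure.quasiMeasurePreserving_fst
      (μ := volume.restrict (Ioc τ S)) (ν := (volume : Measure (Fin 3 → ℝ)))).ae h1
    filter_upwards [h2] with z hz using hP z.1 hz z.2
  have hTi : ∀ k, Integrable (Function.uncurry (flowT p q K A B k))
      ((volume.restrict (Ioc τ S)).prod volume) := fun k =>
    hdom2.mono' (measurable_flowT hA hB k).aestronglyMeasurable
      (hae _ fun t ht x => by simpa using (hCd t ht x k).2.2.1)
  have hHi : ∀ k, Integrable (Function.uncurry (flowH p q K A B k))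
      ((volume.restrict (Ioc τ S)).prod volume) := fun k =>
    hdom2.mono' (measurable_flowH hA hB k).aestronglyMeasurable
      (hae _ fun t ht x => by simpa using (hCd t ht x k).2.2.2)
  have hTs : Integrable (Function.uncurry fun t x => ∑ k, flowT p q K A B k t x)
      ((volume.restrict (Ioc τ S)).prod volume) := integrable_finsetSum _ fun k _ => hTi k
  have hHs : Integrable (fun z : ℝ × (Fin 3 → ℝ) => ∑ k, flowH p q K A B k z.1 z.2)
      ((volume.restrict (Ioc τ S)).prod volume) := integrable_finsetSum _ fun k _ => hHi k
  have hQi : ∀ t ∈ Icc τ S, Integrable (flowQ p q K A B t) := fun t ht => hdom.mono'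
    ((measurable_flowQ hA hB).comp (measurable_prodMk_left)).aestronglyMeasurable
    (ae_of_all _ fun x => (hCd t ht x 0).1)
  have hτm : τ ∈ Icc τ S := ⟨le_rfl, hS⟩
  have hSm : S ∈ Icc τ S := ⟨hS, le_rfl⟩
  have hQ0 : ∀ t, 0 < t → ∀ x, 0 ≤ flowQ p q K A B t x := fun t ht x =>
    (hC _ _ (pot_heat_pos hA hA0 hAp ht x) (pot_heat_pos hB hB0 hBp ht x)).1
  have hTint : ∫ t in Ioc τ S, ∫ x, ∑ k, flowT p q K A B k t x =
      ∫ x, (flowQ p q K A B S x - flowQ p q K A B τ x) := by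
    rw [integral_integral_swap hTs]
    congr 1; ext x
    rw [← intervalIntegral.integral_of_le hS]
    refine intervalIntegral.integral_eq_sub_of_hasDerivAt (E := ℝ)
      (f := fun t => flowQ p q K A B t x) (f' := fun t => ∑ k, flowT p q K A B k t x) (fun t ht => ?_) ?_
    · rw [uIcc_of_le hS] at ht
      exact hasDerivAt_flowQ hp hA hB hA0 hB0 hAp hBp (hτ.trans_le ht.1) x
    · rw [intervalIntegrable_iff_integrableOn_Ioc_of_le hS]
      refine Integrable.mono' (g := fun _ => ∑ _k : Fin 3, C * exp (-(∑ i, x i ^ 2) / (16 * S)))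
        (integrable_const _) ?_ ?_
      · have hm : ∀ k, Measurable fun t => flowT p q K A B k t x := fun k =>
          (measurable_flowT hA hB k).of_uncurry_right
        exact (Finset.measurable_fun_sum _ fun k _ => hm k).aestronglyMeasurable
      · refine (ae_restrict_iff' measurableSet_Ioc).2 (ae_of_all _ fun t ht => ?_)
        refine (norm_sum_le _ _).trans (Finset.sum_le_sum fun k _ => ?_)
        exact (hCd t (Ioc_subset_Icc_self ht) x k).2.2.1
  have hHT : ∀ t ∈ Icc τ S, ∫ x, ∑ k, flowH p q K A B k t x =
      - ∫ x, ∑ k, flowT p q K A B k t x := by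
    intro t ht
    have h := fun k => integral_flowT_add_flowH (K := K) hp hq hK hA hB hρ hA0 hB0 hAp hBp
      (hτ.trans_le ht.1) k
    rw [integral_finsetSum _ fun k _ => (h k).2.1, integral_finsetSum _ fun k _ => (h k).1,
      ← Finset.sum_neg_distrib]
    refine Finset.sum_congr rfl fun k _ => ?_
    have h3 := (h k).2.2
    rw [integral_add (h k).1 (h k).2.1] at h3
    linarith
  have hHtot : ∫ z, ∑ k, flowH p q K A B k z.1 z.2
      ∂((volume.restrict (Ioc τ S)).prod volume) ≤ C₀ * ((∫ y, A y ^ p) + ∫ y, B y ^ q) := by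
    rw [integral_prod _ hHs]
    have e : ∫ t in Ioc τ S, ∫ x, ∑ k, flowH p q K A B k t x =
        - ∫ t in Ioc τ S, ∫ x, ∑ k, flowT p q K A B k t x := by
      rw [← integral_neg]
      exact setIntegral_congr_fun measurableSet_Ioc fun t ht => hHT t (Ioc_subset_Icc_self ht)
    rw [e, hTint, integral_sub (hQi S hSm) (hQi τ hτm)]
    have hSnn : 0 ≤ ∫ x, flowQ p q K A B S x := integral_nonneg (hQ0 S hS0)
    have huint : ∀ {A : (Fin 3 → ℝ) → ℝ} {s : ℝ}, 1 < s → BddSupp A ρ M → (∀ y, 0 ≤ A y) →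
        Integrable fun x => pot (heat τ) A x ^ s := by
      intro A s hs hA hA0
      obtain ⟨CA, hCA, hA1⟩ := pot_heat_le_exp hA hA0 (S := τ) hτ
      refine ((integrable_exp_neg_sum_sq (b := 8 * τ) (by positivity)).const_mul (CA ^ s)).mono'
        (((measurable_pot measurable_heat hA.meas).comp
          (measurable_prodMk_left (x := τ))).pow_const s).aestronglyMeasurable
        (ae_of_all _ fun x => ?_)
      have hn := pot_heat_nonneg hA0 hτ x
      rw [norm_eq_abs, abs_of_nonneg (rpow_nonneg hn _)]
      refine (rpow_le_rpow hn (hA1 τ ⟨le_rfl, le_rfl⟩ x) (by linarith)).trans ?_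
      rw [mul_rpow hCA (exp_pos _).le, ← exp_mul]
      have : 0 ≤ (∑ i, x i ^ 2) / (8 * τ) :=
        div_nonneg (Finset.sum_nonneg fun i _ => sq_nonneg _) (by positivity)
      gcongr
      rw [neg_div]; nlinarith
    have iu := huint (by linarith : 1 < p) hA hA0
    have iv := huint hq hB hB0
    have hτle : ∫ x, flowQ p q K A B τ x ≤ C₀ * ((∫ y, A y ^ p) + ∫ y, B y ^ q) := by
      calc _ ≤ ∫ x, C₀ * (pot (heat τ) A x ^ p + pot (heat τ) B x ^ q) :=
            integral_mono (hQi τ hτm) ((iu.add iv).const_mul C₀) fun x =>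
              (hC _ _ (pot_heat_pos hA hA0 hAp hτ x) (pot_heat_pos hB hB0 hBp hτ x)).2
        _ = C₀ * ((∫ x, pot (heat τ) A x ^ p) + ∫ x, pot (heat τ) B x ^ q) := by
            rw [integral_const_mul, integral_add iu iv]
        _ ≤ _ := by
            refine mul_le_mul_of_nonneg_left (add_le_add ?_ ?_) hC₀
            · exact integral_pot_heat_rpow_le hA hA0 (by linarith) hτ iu
            · exact integral_pot_heat_rpow_le hB hB0 hq.le hτ iv
    linarith
  have hHnn : ∀ t ∈ Icc τ S, ∀ x, |pot (heatG i t) A x * pot (heatG j t) B x| ≤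
      ∑ k, flowH p q K A B k t x := by
    intro t ht x
    have hu := pot_heat_pos hA hA0 hAp (hτ.trans_le ht.1) x
    have hv := pot_heat_pos hB hB0 hBp (hτ.trans_le ht.1) x
    set v := pot (heat t) B x with hvd
    have h1 : ∑ k, (v ^ (2 - q) * pot (heatG k t) A x ^ 2 + v ^ (q - 2) * pot (heatG k t) B x ^ 2)
        ≤ ∑ k, flowH p q K A B k t x := Finset.sum_le_sum fun k _ => hH _ _ hu hv _ _
    rw [Finset.sum_add_distrib] at h1
    have h2 : v ^ (2 - q) * pot (heatG i t) A x ^ 2 ≤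
        ∑ k, v ^ (2 - q) * pot (heatG k t) A x ^ 2 :=
      Finset.single_le_sum (f := fun k => v ^ (2 - q) * pot (heatG k t) A x ^ 2)
        (fun k _ => by positivity) (Finset.mem_univ i)
    have h3 : v ^ (q - 2) * pot (heatG j t) B x ^ 2 ≤
        ∑ k, v ^ (q - 2) * pot (heatG k t) B x ^ 2 :=
      Finset.single_le_sum (f := fun k => v ^ (q - 2) * pot (heatG k t) B x ^ 2)
        (fun k _ => by positivity) (Finset.mem_univ j)
    have h4 : v ^ (q - 2) = (v ^ (2 - q))⁻¹ := by rw [← rpow_neg hv.le]; congr 1; ring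
    have hw : 0 < v ^ (2 - q) := by positivity
    rw [h4] at h3 h1
    set w := v ^ (2 - q)
    set a := pot (heatG i t) A x
    set b := pot (heatG j t) B x
    have h5 : |a * b| ≤ w * a ^ 2 + w⁻¹ * b ^ 2 := by
      have e1 : w * w⁻¹ = 1 := mul_inv_cancel₀ hw.ne'
      have hwi : 0 < w⁻¹ := by positivity
      have e2 : w * a ^ 2 + w⁻¹ * b ^ 2 - 2 * (a * b) = w * (a - w⁻¹ * b) ^ 2 := by
        field_simp; ring
      have e3 : w * a ^ 2 + w⁻¹ * b ^ 2 + 2 * (a * b) = w * (a + w⁻¹ * b) ^ 2 := by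
        field_simp; ring
      have e4 : 0 ≤ w * (a - w⁻¹ * b) ^ 2 := by positivity
      have e5 : 0 ≤ w * (a + w⁻¹ * b) ^ 2 := by positivity
      have e6 : 0 ≤ w * a ^ 2 := by positivity
      have e7 : 0 ≤ w⁻¹ * b ^ 2 := by positivity
      rw [abs_le]; constructor <;> linarith
    linarith
  have hmeas : Measurable fun z : ℝ × (Fin 3 → ℝ) =>
      ENNReal.ofReal |pot (heatG i z.1) A z.2 * pot (heatG j z.1) B z.2| := by
    have h1 := measurable_pot (measurable_heatG i) hA.meas
    have h2 := measurable_pot (measurable_heatG j) hB.meas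
    exact ((h1.mul h2).abs).ennreal_ofReal
  rw [← lintegral_prod (fun z : ℝ × (Fin 3 → ℝ) =>
      ENNReal.ofReal |pot (heatG i z.1) A z.2 * pot (heatG j z.1) B z.2|) hmeas.aemeasurable]
  calc _ ≤ ∫⁻ z, ENNReal.ofReal (∑ k, flowH p q K A B k z.1 z.2)
        ∂((volume.restrict (Ioc τ S)).prod volume) :=
        lintegral_mono_ae (hae _ fun t ht x => ENNReal.ofReal_le_ofReal (hHnn t ht x))
    _ = ENNReal.ofReal (∫ z, ∑ k, flowH p q K A B k z.1 z.2
        ∂((volume.restrict (Ioc τ S)).prod volume)) := by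
        rw [ofReal_integral_eq_lintegral_ofReal hHs
          (hae _ fun t ht x => (abs_nonneg _).trans (hHnn t ht x))]
    _ ≤ _ := ENNReal.ofReal_le_ofReal hHtot

lemma pot_eq_zero_of_integral_eq_zero (hA : BddSupp A ρ M) (hA0 : ∀ y, 0 ≤ A y)
    (h : ∫ y, A y = 0) (k : (Fin 3 → ℝ) → ℝ) (x : Fin 3 → ℝ) : pot k A x = 0 := by
  have h0 := (integral_eq_zero_iff_of_nonneg hA0 hA.integrable).1 h
  refine integral_eq_zero_of_ae ?_
  filter_upwards [h0] with y hy
  simp [hy]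

end

/-- The bilinear embedding theorem for the heat flow on `ℝ³`. -/
theorem bilinear_heat {p q : ℝ} (hp : 2 ≤ p) (hpq : p.HolderConjugate q) :
    ∃ C : ℝ, 0 ≤ C ∧ ∀ (ρ M : ℝ) (A B : (Fin 3 → ℝ) → ℝ), 0 ≤ ρ → BddSupp A ρ M → BddSupp B ρ M →
      (∀ y, 0 ≤ A y) → (∀ y, 0 ≤ B y) → ∀ i j,
      ∫⁻ t in Ioi (0 : ℝ), ∫⁻ x, ENNReal.ofReal |pot (heatG i t) A x * pot (heatG j t) B x| ≤
        ENNReal.ofReal (C * ((∫ y, A y ^ p) + ∫ y, B y ^ q)) := by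
  obtain ⟨K, hK, hH⟩ := bellH_lower hp hpq
  have hq : 1 < q := hpq.symm.lt
  obtain ⟨C, hC, hb⟩ := bell_bounds hp hq hK
  refine ⟨C, hC, fun ρ M A B hρ hA hB hA0 hB0 i j => ?_⟩
  by_cases hAz : ∫ y, A y = 0
  · simp [pot_eq_zero_of_integral_eq_zero hA hA0 hAz]
  by_cases hBz : ∫ y, B y = 0
  · simp [pot_eq_zero_of_integral_eq_zero hB hB0 hBz]
  have hAp := lt_of_le_of_ne (integral_nonneg hA0) (Ne.symm hAz)
  have hBp := lt_of_le_of_ne (integral_nonneg hB0) (Ne.symm hBz)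
  have hU : Ioi (0 : ℝ) = ⋃ n : ℕ, Ioc ((n : ℝ) + 1)⁻¹ ((n : ℝ) + 1) := by
    ext t
    simp only [mem_Ioi, mem_iUnion, mem_Ioc]
    constructor
    · intro ht
      obtain ⟨n, hn⟩ := exists_nat_gt (max t t⁻¹)
      refine ⟨n, ?_, ?_⟩
      · have : t⁻¹ < (n : ℝ) + 1 := by linarith [le_max_right t t⁻¹]
        exact inv_lt_of_inv_lt₀ ht this
      · linarith [le_max_left t t⁻¹]
    · rintro ⟨n, hn, -⟩
      exact lt_trans (by positivity) hn
  have hmono : Monotone fun n : ℕ => Ioc ((n : ℝ) + 1)⁻¹ ((n : ℝ) + 1) := by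
    intro a b hab
    have : (a : ℝ) ≤ b := by exact_mod_cast hab
    refine Ioc_subset_Ioc ?_ (by linarith)
    gcongr
  rw [hU, setLIntegral_iUnion_of_directed _ (hmono.directed_le)]
  refine iSup_le fun n => ?_
  have hn : (0 : ℝ) ≤ n := n.cast_nonneg
  refine bilinear_heat_of_pos hp hq hK hH hC (fun u v hu hv => (hb u v hu hv).1) hA hB hρ hA0 hB0
    hAp hBp (by positivity) ?_ i j
  have : ((n : ℝ) + 1)⁻¹ ≤ 1 := inv_le_one_of_one_le₀ (by linarith)
  linarith

lemma lintegral_bilinear_swap_mul {A B : (Fin 3 → ℝ) → ℝ} (i j : Fin 3) :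
    ∫⁻ t in Ioi (0 : ℝ), ∫⁻ x, ENNReal.ofReal |pot (heatG i t) A x * pot (heatG j t) B x| =
    ∫⁻ t in Ioi (0 : ℝ), ∫⁻ x, ENNReal.ofReal |pot (heatG j t) B x * pot (heatG i t) A x| := by
  simp only [mul_comm]

theorem bilinear_heat_conjugate {p q : ℝ} (hpq : p.HolderConjugate q) :
    ∃ C : ℝ, 0 ≤ C ∧ ∀ (ρ M : ℝ) (A B : (Fin 3 → ℝ) → ℝ), 0 ≤ ρ → BddSupp A ρ M → BddSupp B ρ M →
      (∀ y, 0 ≤ A y) → (∀ y, 0 ≤ B y) → ∀ i j,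
      ∫⁻ t in Ioi (0 : ℝ), ∫⁻ x, ENNReal.ofReal |pot (heatG i t) A x * pot (heatG j t) B x| ≤
        ENNReal.ofReal (C * ((∫ y, A y ^ p) + ∫ y, B y ^ q)) := by
  rcases le_or_gt 2 p with hp | hp
  · exact bilinear_heat hp hpq
  · have hq : 2 ≤ q := by
      have h1 := hpq.inv_add_inv_eq_one
      by_contra! h
      have h2 : (2 : ℝ)⁻¹ < p⁻¹ := by gcongr; exact hpq.pos
      have h3 : (2 : ℝ)⁻¹ < q⁻¹ := by gcongr; exact hpq.symm.pos
      linarith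
    obtain ⟨C, hC, h⟩ := bilinear_heat hq hpq.symm
    refine ⟨C, hC, fun ρ M A B hρ hA hB hA0 hB0 i j => ?_⟩
    rw [lintegral_bilinear_swap_mul, add_comm]
    exact h ρ M B A hρ hB hA hB0 hA0 j i

/-- The Hessian of the regularised Newtonian potential `(|w|² + δ)^(-1/2)`. -/
def kap (δ : ℝ) (i j : Fin 3) (w : Fin 3 → ℝ) : ℝ :=
  3 * (w i * w j) * (∑ k, w k ^ 2 + δ) ^ (-(5 / 2) : ℝ)
    - (if i = j then 1 else 0) * (∑ k, w k ^ 2 + δ) ^ (-(3 / 2) : ℝ)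

lemma sum_sq_nonneg (w : Fin 3 → ℝ) : 0 ≤ ∑ k, w k ^ 2 := Finset.sum_nonneg fun _ _ => sq_nonneg _

lemma abs_mul_le_sum_sq (w : Fin 3 → ℝ) (i j : Fin 3) : |w i * w j| ≤ ∑ k, w k ^ 2 := by
  have h : ∀ i, w i ^ 2 ≤ ∑ k, w k ^ 2 := fun i =>
    Finset.single_le_sum (f := fun k => w k ^ 2) (fun _ _ => sq_nonneg _) (Finset.mem_univ i)
  have h1 := h i
  have h2 := h j
  rw [abs_le]
  constructor <;> nlinarith [sq_nonneg (w i - w j), sq_nonneg (w i + w j)]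

lemma continuous_kap {δ : ℝ} (hδ : 0 < δ) (i j : Fin 3) : Continuous (kap δ i j) := by
  have h : ∀ w : Fin 3 → ℝ, ∑ k, w k ^ 2 + δ ≠ 0 := fun w => by
    have := sum_sq_nonneg w
    positivity
  have hc : Continuous fun w : Fin 3 → ℝ => ∑ k, w k ^ 2 + δ := by fun_prop
  unfold kap
  exact ((by fun_prop : Continuous fun w : Fin 3 → ℝ => 3 * (w i * w j)).mul
    (hc.rpow_const fun w => Or.inl (h w))).sub
      (continuous_const.mul (hc.rpow_const fun w => Or.inl (h w)))

lemma abs_kap_le {δ : ℝ} (hδ : 0 < δ) (i j : Fin 3) (w : Fin 3 → ℝ) :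
    |kap δ i j w| ≤ 4 * δ ^ (-(3 / 2) : ℝ) := by
  have h0 := sum_sq_nonneg w
  have h1 := abs_mul_le_sum_sq w i j
  unfold kap
  set Y := ∑ k, w k ^ 2
  have hY : 0 < Y + δ := by positivity
  have h2 : (Y + δ) ^ (-(3 / 2) : ℝ) ≤ δ ^ (-(3 / 2) : ℝ) :=
    rpow_le_rpow_of_nonpos hδ (by linarith) (by norm_num)
  have h3 : (Y + δ) * (Y + δ) ^ (-(5 / 2) : ℝ) = (Y + δ) ^ (-(3 / 2) : ℝ) := by
    rw [← rpow_one_add' hY.le (by norm_num)]; norm_num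
  have h4 : 0 < (Y + δ) ^ (-(5 / 2) : ℝ) := by positivity
  have h5 : 0 < (Y + δ) ^ (-(3 / 2) : ℝ) := by positivity
  have h6 : |3 * (w i * w j) * (Y + δ) ^ (-(5 / 2) : ℝ)| ≤ 3 * (Y + δ) ^ (-(3 / 2) : ℝ) := by
    rw [abs_mul, abs_mul, abs_of_pos h4, abs_of_pos (by norm_num : (0 : ℝ) < 3), ← h3, mul_assoc]
    gcongr
    linarith
  have h7 : |(if i = j then (1 : ℝ) else 0) * (Y + δ) ^ (-(3 / 2) : ℝ)| ≤
      (Y + δ) ^ (-(3 / 2) : ℝ) := by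
    split_ifs
    · rw [one_mul, abs_of_pos h5]
    · simpa using h5.le
  rw [abs_le] at h6 h7 ⊢
  constructor <;> linarith [h6.1, h6.2, h7.1, h7.2]

lemma integral_rpow_mul_exp_div {a Y : ℝ} (ha : 0 < a) (hY : 0 < Y) :
    IntegrableOn (fun s : ℝ => s ^ (-a - 1) * exp (-Y / (8 * s))) (Ioi 0) ∧
    ∫ s in Ioi (0 : ℝ), s ^ (-a - 1) * exp (-Y / (8 * s)) = (8 / Y) ^ a * Gamma a := by
  have hg := integral_rpow_mul_exp_neg_mul_Ioi (a := a) (r := Y / 8) ha (by positivity)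
  have hi : IntegrableOn (fun t : ℝ => t ^ (a - 1) * exp (-(Y / 8 * t))) (Ioi 0) := by
    have h := integrableOn_rpow_mul_exp_neg_mul_rpow (s := a - 1) (p := 1) (b := Y / 8)
      (by linarith) (by norm_num) (by positivity)
    simpa using h
  have e : ∀ s ∈ Ioi (0 : ℝ), (|(-1 : ℝ)| * s ^ ((-1 : ℝ) - 1)) •
      ((s ^ (-1 : ℝ)) ^ (a - 1) * exp (-(Y / 8 * s ^ (-1 : ℝ)))) =
      s ^ (-a - 1) * exp (-Y / (8 * s)) := by
    intro s hs
    have hs : 0 < s := hs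
    rw [← rpow_mul hs.le, smul_eq_mul, abs_neg, abs_one, one_mul, ← mul_assoc, ← rpow_add hs,
      rpow_neg_one]
    congr 2
    · ring
    · field_simp
  have h1 := integral_comp_rpow_Ioi (fun t : ℝ => t ^ (a - 1) * exp (-(Y / 8 * t)))
    (p := -1) (by norm_num)
  have h2 := (integrableOn_Ioi_comp_rpow_iff (fun t : ℝ => t ^ (a - 1) * exp (-(Y / 8 * t)))
    (p := -1) (by norm_num)).2 hi
  refine ⟨h2.congr_fun e measurableSet_Ioi, ?_⟩
  rw [← setIntegral_congr_fun measurableSet_Ioi e, h1, hg]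
  congr 2; field_simp

lemma exp_mul_heatH_eq (δ : ℝ) (i j : Fin 3) (w : Fin 3 → ℝ) {s : ℝ} (hs : 0 < s) :
    exp (-δ / (8 * s)) * heatH i j (2 * s) w = ((√(8 * π))⁻¹) ^ 3 *
      (w i * w j / 16 * (s ^ (-(5 / 2) - 1 : ℝ) * exp (-(∑ k, w k ^ 2 + δ) / (8 * s)))
        - (if i = j then 1 else 0) / 4 *
          (s ^ (-(3 / 2) - 1 : ℝ) * exp (-(∑ k, w k ^ 2 + δ) / (8 * s)))) := by
  unfold heatH
  rw [heat_eq]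
  have e1 : √(4 * π * (2 * s)) = √(8 * π) * √s := by
    rw [← sqrt_mul (by positivity)]; congr 1; ring
  have e2 : exp (-(∑ k, w k ^ 2 + δ) / (8 * s)) =
      exp (-δ / (8 * s)) * exp (-(∑ k, w k ^ 2) / (4 * (2 * s))) := by
    rw [← exp_add]; congr 1; ring
  have e3 : s ^ (-(5 / 2) - 1 : ℝ) = s⁻¹ ^ 2 * (√s)⁻¹ ^ 3 := by
    rw [sqrt_eq_rpow, ← rpow_neg hs.le, ← rpow_neg_one, ← rpow_natCast, ← rpow_natCast,
      ← rpow_mul hs.le, ← rpow_mul hs.le, ← rpow_add hs]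
    norm_num
  have e4 : s ^ (-(3 / 2) - 1 : ℝ) = s⁻¹ * (√s)⁻¹ ^ 3 := by
    rw [sqrt_eq_rpow, ← rpow_neg hs.le, ← rpow_neg_one, ← rpow_natCast,
      ← rpow_mul hs.le, ← rpow_add hs]
    norm_num
  rw [e1, e2, e3, e4, mul_inv, mul_pow]
  field_simp
  ring

lemma kap_eq_integral_heatH : ∃ c : ℝ, 0 < c ∧ ∀ δ : ℝ, 0 < δ → ∀ i j w,
    kap δ i j w = c * ∫ s in Ioi (0 : ℝ), exp (-δ / (8 * s)) * heatH i j (2 * s) w := by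
  have hG := Gamma_pos_of_pos (by norm_num : (0 : ℝ) < 3 / 2)
  have hG2 : Gamma (5 / 2) = 3 / 2 * Gamma (3 / 2) := by
    rw [← Gamma_add_one (by norm_num)]; norm_num
  set k := ((√(8 * π))⁻¹) ^ 3 * ((8 : ℝ) ^ (3 / 2 : ℝ) * Gamma (3 / 2) / 4) with hk
  have hk0 : 0 < k := by positivity
  refine ⟨k⁻¹, by positivity, fun δ hδ i j w => ?_⟩
  have hY : 0 < ∑ k, w k ^ 2 + δ := by have := sum_sq_nonneg w; positivity
  rw [setIntegral_congr_fun measurableSet_Ioi fun s hs => exp_mul_heatH_eq δ i j w hs]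
  obtain ⟨i5, h5⟩ := integral_rpow_mul_exp_div (a := 5 / 2) (by norm_num) hY
  obtain ⟨i3, h3⟩ := integral_rpow_mul_exp_div (a := 3 / 2) (by norm_num) hY
  rw [integral_const_mul, integral_sub (i5.const_mul _) (i3.const_mul _), integral_const_mul,
    integral_const_mul, h5, h3, hG2]
  unfold kap
  set Y := ∑ k, w k ^ 2 + δ
  have e8 : (8 : ℝ) ^ (5 / 2 : ℝ) = 8 * 8 ^ (3 / 2 : ℝ) := by
    rw [← rpow_one_add' (by norm_num) (by norm_num)]; norm_num
  have e5 : (8 / Y) ^ (5 / 2 : ℝ) = 8 * 8 ^ (3 / 2 : ℝ) * Y ^ (-(5 / 2) : ℝ) := by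
    rw [div_rpow (by norm_num) hY.le, rpow_neg hY.le, e8, div_eq_mul_inv]
  have e3 : (8 / Y) ^ (3 / 2 : ℝ) = 8 ^ (3 / 2 : ℝ) * Y ^ (-(3 / 2) : ℝ) := by
    rw [div_rpow (by norm_num) hY.le, rpow_neg hY.le, div_eq_mul_inv]
  rw [e5, e3, eq_inv_mul_iff_mul_eq₀ hk0.ne', hk]
  ring

section
variable {A B : (Fin 3 → ℝ) → ℝ} {ρ M : ℝ}

lemma exists_abs_heatG_le_exp {s : ℝ} (hs : 0 < s) (i : Fin 3) : ∃ C : ℝ, 0 ≤ C ∧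
    ∀ x, |heatG i s x| ≤ C * exp (-(∑ k, x k ^ 2) / (8 * s)) := by
  refine ⟨(1 + 8 * s) / (2 * s) * ((√(4 * π * s))⁻¹) ^ 3, by positivity, fun x => ?_⟩
  have h1 := abs_mul_le_sum_sq x i i
  have hY := sum_sq_nonneg x
  unfold heatG
  rw [heat_eq]
  set Y := ∑ k, x k ^ 2
  have h2 := add_one_le_exp (Y / (8 * s))
  have h3 : |x i| ≤ 1 + Y := by
    rw [abs_mul] at h1
    nlinarith [sq_nonneg (|x i| - 1), abs_nonneg (x i)]
  have h4 : 1 + Y ≤ (1 + 8 * s) * (Y / (8 * s) + 1) := by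
    have e : (1 + 8 * s) * (Y / (8 * s) + 1) = Y / (8 * s) + 1 + Y + 8 * s := by field_simp; ring
    have : 0 ≤ Y / (8 * s) := by positivity
    linarith
  have h5 : |x i| ≤ (1 + 8 * s) * exp (Y / (8 * s)) := by
    refine (h3.trans h4).trans ?_
    gcongr
  rw [abs_mul, abs_div, abs_neg, abs_of_pos (by positivity : 0 < 2 * s),
    abs_of_pos (by positivity : 0 < ((√(4 * π * s))⁻¹) ^ 3 * exp (-Y / (4 * s)))]
  calc _ ≤ (1 + 8 * s) * exp (Y / (8 * s)) / (2 * s) *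
        (((√(4 * π * s))⁻¹) ^ 3 * exp (-Y / (4 * s))) := by gcongr
    _ = (1 + 8 * s) / (2 * s) * ((√(4 * π * s))⁻¹) ^ 3 *
        (exp (Y / (8 * s)) * exp (-Y / (4 * s))) := by ring
    _ = _ := by rw [← exp_add]; congr 2; field_simp; ring

lemma integrable_heatG {s : ℝ} (hs : 0 < s) (i : Fin 3) : Integrable (heatG i s) := by
  obtain ⟨C, -, h⟩ := exists_abs_heatG_le_exp hs i
  exact ((integrable_exp_neg_sum_sq (b := 8 * s) (by positivity)).const_mul C).mono'
    (continuous_heatG i s).aestronglyMeasurable (ae_of_all _ h)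

lemma exists_abs_heatG_le {s : ℝ} (hs : 0 < s) (i : Fin 3) : ∃ C : ℝ, ∀ x, |heatG i s x| ≤ C := by
  obtain ⟨C, hC, h⟩ := exists_abs_heatG_le_exp hs i
  refine ⟨C, fun x => (h x).trans (mul_le_of_le_one_right hC (exp_le_one_iff.2 ?_))⟩
  rw [neg_div]
  have := sum_sq_nonneg x
  exact neg_nonpos.2 (by positivity)

lemma heatG_neg (i : Fin 3) (s : ℝ) (x : Fin 3 → ℝ) : heatG i s (-x) = -heatG i s x := by
  unfold heatG heat heat1
  simp only [Pi.neg_apply, neg_sq]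
  ring

lemma BddSupp.nonneg_bound (hA : BddSupp A ρ M) : 0 ≤ M := (abs_nonneg _).trans (hA.bdd 0)

lemma measurable_pot_const {k : (Fin 3 → ℝ) → ℝ} (hk : Measurable k) (hA : Measurable A) :
    Measurable (pot k A) :=
  (measurable_pot (k := fun _ => k) (hk.comp measurable_snd) hA).comp
    (measurable_prodMk_left (x := (0 : ℝ)))

lemma integral_mul_pot_swap {k u : (Fin 3 → ℝ) → ℝ} (hk : Integrable k)
    (hA : BddSupp A ρ M) (hu : Measurable u) {D : ℝ} (hD : ∀ x, |u x| ≤ D) :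
    ∫ x, u x * pot k A x = ∫ y, (∫ x, u x * k (x - y)) * A y := by
  have h1 := hA.integrable.convolution_integrand (ContinuousLinearMap.mul ℝ ℝ) hk
  have h2 : Integrable (Function.uncurry fun x y => u x * (k (x - y) * A y))
      ((volume : Measure (Fin 3 → ℝ)).prod volume) := by
    refine (h1.bdd_mul (c := D) (f := fun z => u z.1)
      (hu.comp measurable_fst).aestronglyMeasurable (ae_of_all _ fun z => hD z.1)).congr
      (ae_of_all _ fun z => ?_)
    simp [Function.uncurry, mul_comm]
  unfold pot
  simp only [← integral_const_mul, ← integral_mul_const]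
  rw [integral_integral_swap h2]
  simp only [mul_assoc]

lemma abs_pot_le_of_bdd {k : (Fin 3 → ℝ) → ℝ} (hA : BddSupp A ρ M)
    {D : ℝ} (hD : ∀ x, |k x| ≤ D) (x : Fin 3 → ℝ) : |pot k A x| ≤ D * ∫ y, |A y| := by
  unfold pot
  rw [← integral_const_mul, ← norm_eq_abs]
  refine norm_integral_le_of_norm_le (hA.integrable.abs.const_mul D) (ae_of_all _ fun y => ?_)
  rw [norm_eq_abs, abs_mul]
  gcongr
  exact hD _

lemma integral_pot_heatH_mul (hA : BddSupp A ρ M) (hB : BddSupp B ρ M) {s : ℝ} (hs : 0 < s)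
    (i j : Fin 3) :
    ∫ x, pot (heatH i j (2 * s)) A x * B x = - ∫ w, pot (heatG i s) B w * pot (heatG j s) A w := by
  obtain ⟨Ci, hCi⟩ := exists_abs_heatG_le hs i
  obtain ⟨Cj, hCj⟩ := exists_abs_heatG_le hs j
  have mi := (continuous_heatG i s).measurable
  have mj := (continuous_heatG j s).measurable
  have h1 : ∀ x, pot (heatH i j (2 * s)) A x = ∫ w, heatG i s (x - w) * pot (heatG j s) A w := by
    intro x
    rw [integral_mul_pot_swap (u := fun w => heatG i s (x - w)) (integrable_heatG hs j) hA
      (mi.comp (measurable_const.sub measurable_id)) fun w => hCi _]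
    unfold pot
    simp only [(integrable_heatG_mul_heatG hs i j x _).2]
  have h2 := integral_mul_pot_swap (u := pot (heatG j s) A) (integrable_heatG hs i) hB
    (measurable_pot_const mj hA.meas) (abs_pot_le_of_bdd hA hCj)
  rw [show (∫ w, pot (heatG i s) B w * pot (heatG j s) A w) =
    ∫ w, pot (heatG j s) A w * pot (heatG i s) B w by simp only [mul_comm], h2, ← integral_neg]
  congr 1; ext x
  rw [h1, ← neg_mul, ← integral_neg]
  congr 2; ext w
  rw [show x - w = -(w - x) by abel, heatG_neg]
  ring

lemma abs_exp_mul_heatH_le (δ : ℝ) (i j : Fin 3) {w : Fin 3 → ℝ} {R : ℝ}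
    (hw : ‖w‖ ≤ R) {s : ℝ} (hs : 0 < s) :
    |exp (-δ / (8 * s)) * heatH i j (2 * s) w| ≤ ((√(8 * π))⁻¹) ^ 3 *
      (R ^ 2 * (s ^ (-(5 / 2) - 1 : ℝ) * exp (-δ / (8 * s)))
        + s ^ (-(3 / 2) - 1 : ℝ) * exp (-δ / (8 * s))) := by
  rw [exp_mul_heatH_eq δ i j w hs, abs_mul, abs_of_pos (by positivity : 0 < ((√(8 * π))⁻¹) ^ 3)]
  have hij : |w i * w j| ≤ R ^ 2 := by
    rw [abs_mul, sq]
    have h1 := (norm_le_pi_norm w i).trans hw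
    have h2 := (norm_le_pi_norm w j).trans hw
    rw [norm_eq_abs] at h1 h2
    gcongr
    exact (abs_nonneg _).trans h1
  have he : exp (-(∑ k, w k ^ 2 + δ) / (8 * s)) ≤ exp (-δ / (8 * s)) := by
    have := sum_sq_nonneg w
    gcongr
    linarith
  set E := exp (-δ / (8 * s))
  set E' := exp (-(∑ k, w k ^ 2 + δ) / (8 * s))
  have hE' : 0 < E' := exp_pos _
  have p5 : 0 < s ^ (-(5 / 2) - 1 : ℝ) := by positivity
  have p3 : 0 < s ^ (-(3 / 2) - 1 : ℝ) := by positivity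
  have h1 : |w i * w j / 16 * (s ^ (-(5 / 2) - 1 : ℝ) * E')| ≤ R ^ 2 * (s ^ (-(5 / 2) - 1 : ℝ) * E) := by
    rw [abs_mul, abs_of_pos (by positivity : 0 < s ^ (-(5 / 2) - 1 : ℝ) * E'), abs_div]
    gcongr
    rw [abs_of_pos (by norm_num : (0 : ℝ) < 16)]
    have := abs_nonneg (w i * w j)
    linarith
  have h2 : |(if i = j then (1 : ℝ) else 0) / 4 * (s ^ (-(3 / 2) - 1 : ℝ) * E')| ≤
      s ^ (-(3 / 2) - 1 : ℝ) * E := by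
    rw [abs_mul, abs_of_pos (by positivity : 0 < s ^ (-(3 / 2) - 1 : ℝ) * E')]
    calc _ ≤ 1 * (s ^ (-(3 / 2) - 1 : ℝ) * E') := by
          gcongr
          split_ifs <;> norm_num
      _ ≤ _ := by rw [one_mul]; gcongr
  gcongr
  rw [abs_le] at h1 h2 ⊢
  constructor <;> linarith [h1.1, h1.2, h2.1, h2.2]

lemma measurable_exp_mul_heatH (δ : ℝ) (i j : Fin 3) :
    Measurable fun z : ℝ × (Fin 3 → ℝ) => exp (-δ / (8 * z.1)) * heatH i j (2 * z.1) z.2 := by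
  have h := (measurable_heatH i j).comp (f := fun z : ℝ × (Fin 3 → ℝ) => (2 * z.1, z.2))
    (by fun_prop)
  exact (by fun_prop : Measurable fun z : ℝ × (Fin 3 → ℝ) => exp (-δ / (8 * z.1))).mul h

lemma pot_kap_eq {c δ : ℝ} (hδ : 0 < δ) (i j : Fin 3)
    (hc : ∀ w, kap δ i j w = c * ∫ s in Ioi (0 : ℝ), exp (-δ / (8 * s)) * heatH i j (2 * s) w)
    (hA : BddSupp A ρ M) (hB : BddSupp B ρ M) :
    ∫ x, pot (kap δ i j) A x * B x = c * ∫ s in Ioi (0 : ℝ), exp (-δ / (8 * s)) *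
      ∫ x, pot (heatH i j (2 * s)) A x * B x := by
  set g : ℝ → ℝ := fun s => ((√(8 * π))⁻¹) ^ 3 *
      ((ρ + ρ) ^ 2 * (s ^ (-(5 / 2) - 1 : ℝ) * exp (-δ / (8 * s)))
        + s ^ (-(3 / 2) - 1 : ℝ) * exp (-δ / (8 * s))) with hg
  have hgi : IntegrableOn g (Ioi 0) := by
    have i5 := (integral_rpow_mul_exp_div (a := 5 / 2) (by norm_num) hδ).1
    have i3 := (integral_rpow_mul_exp_div (a := 3 / 2) (by norm_num) hδ).1
    exact ((i5.const_mul _).add i3).const_mul _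
  have hae : ∀ P : (Fin 3 → ℝ) × ℝ → Prop, (∀ s, 0 < s → ∀ x, P (x, s)) →
      ∀ᵐ z ∂((volume : Measure (Fin 3 → ℝ)).prod (volume.restrict (Ioi (0 : ℝ)))), P z := by
    intro P hP
    have h1 : ∀ᵐ t ∂(volume.restrict (Ioi (0 : ℝ))), 0 < t :=
      (ae_restrict_iff' measurableSet_Ioi).2 (ae_of_all _ fun t ht => ht)
    have h2 := (Measure.quasiMeasurePreserving_snd
      (μ := (volume : Measure (Fin 3 → ℝ))) (ν := volume.restrict (Ioi (0 : ℝ)))).ae h1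
    filter_upwards [h2] with z hz using hP z.2 hz z.1
  have key : ∀ x, ‖x‖ ≤ ρ → ∀ y s, 0 < s →
      |exp (-δ / (8 * s)) * heatH i j (2 * s) (x - y) * A y| ≤ |A y| * g s := by
    intro x hx y s hs
    by_cases hy : ρ < ‖y‖
    · simp [hA.supp y hy]
    · rw [abs_mul, mul_comm]
      gcongr
      exact abs_exp_mul_heatH_le δ i j ((norm_sub_le _ _).trans (by linarith)) hs
  have h1 : ∀ x, ‖x‖ ≤ ρ → Integrable (Function.uncurry fun y s =>
      exp (-δ / (8 * s)) * heatH i j (2 * s) (x - y) * A y)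
      ((volume : Measure (Fin 3 → ℝ)).prod (volume.restrict (Ioi (0 : ℝ)))) := by
    intro x hx
    refine (hA.integrable.abs.mul_prod hgi).mono' ?_ (hae _ fun s hs y => key x hx y s hs)
    exact (((measurable_exp_mul_heatH δ i j).comp (f := fun z : (Fin 3 → ℝ) × ℝ => (z.2, x - z.1))
      (by fun_prop)).mul (hA.meas.comp measurable_fst)).aestronglyMeasurable
  have h2 : ∀ x, ‖x‖ ≤ ρ → pot (kap δ i j) A x =
      c * ∫ s in Ioi (0 : ℝ), exp (-δ / (8 * s)) * pot (heatH i j (2 * s)) A x := by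
    intro x hx
    unfold pot
    simp only [hc, mul_assoc c, integral_const_mul, ← integral_mul_const]
    rw [integral_integral_swap (h1 x hx)]
    simp only [mul_assoc, integral_const_mul]
  have h3 : ∀ x, pot (kap δ i j) A x * B x =
      c * ∫ s in Ioi (0 : ℝ), exp (-δ / (8 * s)) * pot (heatH i j (2 * s)) A x * B x := by
    intro x
    by_cases hx : ρ < ‖x‖
    · simp [hB.supp x hx]
    · rw [h2 x (not_lt.1 hx), mul_assoc, ← integral_mul_const]
  have h4 : Integrable (Function.uncurry fun x s =>
      exp (-δ / (8 * s)) * pot (heatH i j (2 * s)) A x * B x)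
      ((volume : Measure (Fin 3 → ℝ)).prod (volume.restrict (Ioi (0 : ℝ)))) := by
    refine ((hB.integrable.abs.const_mul (∫ y, |A y|)).mul_prod hgi).mono' ?_
      (hae _ fun s hs x => ?_)
    · have hm := (measurable_pot (measurable_heatH i j) hA.meas).comp
        (f := fun z : (Fin 3 → ℝ) × ℝ => (2 * z.2, z.1)) (by fun_prop)
      exact (((by fun_prop : Measurable fun z : (Fin 3 → ℝ) × ℝ => exp (-δ / (8 * z.2))).mul
        hm).mul (hB.meas.comp measurable_fst)).aestronglyMeasurable
    · by_cases hx : ρ < ‖x‖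
      · simp [Function.uncurry, hB.supp x hx]
      · simp only [Function.uncurry]
        rw [norm_eq_abs, abs_mul, mul_right_comm]
        gcongr
        unfold pot
        rw [← integral_const_mul, ← integral_mul_const, ← norm_eq_abs]
        refine norm_integral_le_of_norm_le (hA.integrable.abs.mul_const _)
          (ae_of_all _ fun y => ?_)
        rw [← mul_assoc]
        exact key x (not_lt.1 hx) y s hs
  simp only [h3, integral_const_mul]
  rw [integral_integral_swap h4]
  simp only [mul_assoc, integral_const_mul]

lemma BddSupp.posPart (hA : BddSupp A ρ M) : BddSupp (fun y => max (A y) 0) ρ M where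
  meas := hA.meas.max measurable_const
  bdd y := by
    rw [abs_of_nonneg (le_max_right _ _)]
    exact max_le ((le_abs_self _).trans (hA.bdd y)) hA.nonneg_bound
  supp y hy := by simp [hA.supp y hy]

lemma BddSupp.neg (hA : BddSupp A ρ M) : BddSupp (fun y => -A y) ρ M where
  meas := hA.meas.neg
  bdd y := by rw [abs_neg]; exact hA.bdd y
  supp y hy := by simp [hA.supp y hy]

lemma BddSupp.abs (hA : BddSupp A ρ M) : BddSupp (fun y => |A y|) ρ M where
  meas := by have := hA.meas; fun_prop
  bdd y := by rw [abs_abs]; exact hA.bdd y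
  supp y hy := by simp [hA.supp y hy]

lemma integrable_pot_kap_mul {δ : ℝ} (hδ : 0 < δ) (i j : Fin 3) (hA : BddSupp A ρ M)
    (hB : BddSupp B ρ M) : Integrable fun x => pot (kap δ i j) A x * B x :=
  hB.integrable.bdd_mul (measurable_pot_const (continuous_kap hδ i j).measurable
    hA.meas).aestronglyMeasurable (ae_of_all _ (abs_pot_le_of_bdd hA (abs_kap_le hδ i j)))

end

/-- The Hessian of the regularised Newtonian potential is bounded on `L^p(ℝ³)`, uniformly in the
regularisation. -/
theorem abs_integral_pot_kap_mul_le {p q : ℝ} (hpq : p.HolderConjugate q) :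
    ∃ C : ℝ, 0 ≤ C ∧ ∀ (δ ρ M : ℝ) (A B : (Fin 3 → ℝ) → ℝ), 0 < δ → 0 ≤ ρ → BddSupp A ρ M →
      BddSupp B ρ M → ∀ i j,
      |∫ x, pot (kap δ i j) A x * B x| ≤ C * ((∫ y, |A y| ^ p) + ∫ y, |B y| ^ q) := by
  obtain ⟨c, hc, hk⟩ := kap_eq_integral_heatH
  obtain ⟨C, hC, hb⟩ := bilinear_heat_conjugate hpq
  have hpos : ∀ (δ ρ M : ℝ) (A B : (Fin 3 → ℝ) → ℝ), 0 < δ → 0 ≤ ρ → BddSupp A ρ M →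
      BddSupp B ρ M → (∀ y, 0 ≤ A y) → (∀ y, 0 ≤ B y) → ∀ i j,
      |∫ x, pot (kap δ i j) A x * B x| ≤ c * C * ((∫ y, A y ^ p) + ∫ y, B y ^ q) := by
    intro δ ρ M A B hδ hρ hA hB hA0 hB0 i j
    rw [pot_kap_eq hδ i j (hk δ hδ i j) hA hB, abs_mul, abs_of_pos hc, mul_assoc]
    gcongr
    have hnn : 0 ≤ C * ((∫ y, A y ^ p) + ∫ y, B y ^ q) :=
      mul_nonneg hC (add_nonneg (integral_nonneg fun y => rpow_nonneg (hA0 y) _)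
        (integral_nonneg fun y => rpow_nonneg (hB0 y) _))
    rw [← ENNReal.ofReal_le_ofReal_iff hnn, ← norm_eq_abs, ofReal_norm]
    refine (enorm_integral_le_lintegral_enorm _).trans ((setLIntegral_mono' measurableSet_Ioi
      fun s hs => ?_).trans (hb ρ M A B hρ hA hB hA0 hB0 j i))
    have hs : 0 < s := hs
    rw [integral_pot_heatH_mul hA hB hs, enorm_mul, enorm_neg]
    have h1 : ‖exp (-δ / (8 * s))‖ₑ ≤ 1 := by
      rw [← ofReal_norm, norm_eq_abs, abs_of_pos (exp_pos _)]
      refine ENNReal.ofReal_le_one.2 (exp_le_one_iff.2 ?_)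
      rw [neg_div]
      exact neg_nonpos.2 (by positivity)
    refine (mul_le_of_le_one_left' h1).trans ((enorm_integral_le_lintegral_enorm _).trans ?_)
    refine lintegral_mono fun w => ?_
    rw [← ofReal_norm, norm_eq_abs, mul_comm]
  refine ⟨4 * (c * C), by positivity, fun δ ρ M A B hδ hρ hA hB i j => ?_⟩
  have hp0 := hpq.pos
  have hq0 := hpq.symm.pos
  have iA : Integrable fun y => |A y| ^ p := (hA.abs.rpow (fun y => abs_nonneg _) hp0).integrable
  have iB : Integrable fun y => |B y| ^ q := (hB.abs.rpow (fun y => abs_nonneg _) hq0).integrable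
  have hmaxle : ∀ {A : (Fin 3 → ℝ) → ℝ} {r : ℝ}, 0 < r → BddSupp A ρ M →
      Integrable (fun y => |A y| ^ r) → ∫ y, (max (A y) 0) ^ r ≤ ∫ y, |A y| ^ r := by
    intro A r hr hA hi
    refine integral_mono (hA.posPart.rpow (fun y => le_max_right _ _) hr).integrable hi fun y => ?_
    exact rpow_le_rpow (le_max_right _ _) (max_le (le_abs_self _) (abs_nonneg _)) hr.le
  have hs : ∀ A' B' : (Fin 3 → ℝ) → ℝ, BddSupp A' ρ M → BddSupp B' ρ M →
      (∀ y, |A' y| = |A y|) → (∀ y, |B' y| = |B y|) →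
      |∫ x, pot (kap δ i j) (fun y => max (A' y) 0) x * max (B' x) 0| ≤
        c * C * ((∫ y, |A y| ^ p) + ∫ y, |B y| ^ q) := by
    intro A' B' hA' hB' eA eB
    refine (hpos δ ρ M _ _ hδ hρ hA'.posPart hB'.posPart (fun _ => le_max_right _ _)
      (fun _ => le_max_right _ _) i j).trans ?_
    have h1 := hmaxle hp0 hA' (by simpa only [eA] using iA)
    have h2 := hmaxle hq0 hB' (by simpa only [eB] using iB)
    simp only [eA] at h1
    simp only [eB] at h2
    refine mul_le_mul_of_nonneg_left (add_le_add h1 h2) (by positivity)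
  have s1 := hs A B hA hB (fun _ => rfl) (fun _ => rfl)
  have s2 := hs A (fun y => -B y) hA hB.neg (fun _ => rfl) (fun _ => abs_neg _)
  have s3 := hs (fun y => -A y) B hA.neg hB (fun _ => abs_neg _) (fun _ => rfl)
  have s4 := hs (fun y => -A y) (fun y => -B y) hA.neg hB.neg (fun _ => abs_neg _)
    (fun _ => abs_neg _)
  have hsplit : ∀ a : ℝ, a = max a 0 - max (-a) 0 := fun a => by
    rcases le_total 0 a with h | h <;> simp [h]
  have e1 : ∀ x, pot (kap δ i j) A x * B x =
      (pot (kap δ i j) (fun y => max (A y) 0) x * max (B x) 0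
        - pot (kap δ i j) (fun y => max (A y) 0) x * max (-B x) 0)
      - (pot (kap δ i j) (fun y => max (-A y) 0) x * max (B x) 0
        - pot (kap δ i j) (fun y => max (-A y) 0) x * max (-B x) 0) := by
    intro x
    have hcx : Continuous fun y => kap δ i j (x - y) :=
      (continuous_kap hδ i j).comp (by fun_prop)
    have e2 : pot (kap δ i j) A x = pot (kap δ i j) (fun y => max (A y) 0) x
        - pot (kap δ i j) (fun y => max (-A y) 0) x := by
      unfold pot
      rw [← integral_sub (hA.posPart.integrable_mul hcx) (hA.neg.posPart.integrable_mul hcx)]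
      congr 1; ext y
      rw [← mul_sub, ← hsplit]
    rw [e2]
    conv_lhs => rw [hsplit (B x)]
    ring
  simp only [e1]
  have ii : ∀ {A B : (Fin 3 → ℝ) → ℝ}, BddSupp A ρ M → BddSupp B ρ M →
      Integrable fun x => pot (kap δ i j) A x * B x := integrable_pot_kap_mul hδ i j
  have hsub : ∀ {a b c d : (Fin 3 → ℝ) → ℝ}, Integrable a → Integrable b → Integrable c →
      Integrable d → ∫ x, ((a x - b x) - (c x - d x)) =
        ((∫ x, a x) - ∫ x, b x) - ((∫ x, c x) - ∫ x, d x) := by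
    intro a b c d ha hb hc hd
    rw [← integral_sub ha hb, ← integral_sub hc hd]
    exact integral_sub (ha.sub hb) (hc.sub hd)
  rw [hsub (ii hA.posPart hB.posPart) (ii hA.posPart hB.neg.posPart)
    (ii hA.neg.posPart hB.posPart) (ii hA.neg.posPart hB.neg.posPart)]
  rw [abs_le] at s1 s2 s3 s4 ⊢
  constructor <;> linarith [s1.1, s1.2, s2.1, s2.2, s3.1, s3.2, s4.1, s4.2]

theorem lintegral_pot_kap_rpow_le {p q : ℝ} (hpq : p.HolderConjugate q) :
    ∃ C : ℝ, 0 ≤ C ∧ ∀ (δ ρ M : ℝ) (A : (Fin 3 → ℝ) → ℝ), 0 < δ → 0 ≤ ρ → BddSupp A ρ M →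
      ∀ i j, ∫⁻ x, ENNReal.ofReal (|pot (kap δ i j) A x| ^ p) ≤
        ENNReal.ofReal (C * ∫ y, |A y| ^ p) := by
  obtain ⟨C, hC, hb⟩ := abs_integral_pot_kap_mul_le hpq
  have hp := hpq.pos
  have hq1 : 0 < q - 1 := by linarith [hpq.symm.lt]
  set η := (2 * C + 1) ^ (-(1 / (q - 1))) with hη
  have hη0 : 0 < η := by positivity
  have hηq : C * η ^ q ≤ η / 2 := by
    have e : η ^ q = η * (2 * C + 1)⁻¹ := by
      have : η ^ (q - 1) = (2 * C + 1)⁻¹ := by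
        rw [hη, ← rpow_mul (by positivity), ← rpow_neg_one]
        congr 1; field_simp
      rw [← this, ← rpow_one_add' hη0.le (by linarith)]; congr 1; ring
    rw [e]
    have h1 : C * (2 * C + 1)⁻¹ ≤ 1 / 2 := by
      rw [← div_eq_mul_inv, div_le_div_iff₀ (by positivity) (by norm_num)]; linarith
    nlinarith
  refine ⟨2 * C / η, by positivity, fun δ ρ M A hδ hρ hA i j => ?_⟩
  set U := pot (kap δ i j) A with hU
  have hUm : Measurable U := measurable_pot_const (continuous_kap hδ i j).measurable hA.meas
  have hUb : ∀ x, |U x| ≤ 4 * δ ^ (-(3 / 2) : ℝ) * ∫ y, |A y| :=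
    abs_pot_le_of_bdd hA (abs_kap_le hδ i j)
  set L := 4 * δ ^ (-(3 / 2) : ℝ) * ∫ y, |A y|
  have hL : 0 ≤ L := (abs_nonneg _).trans (hUb 0)
  have hUp : ∀ u : ℝ, |u * |u| ^ (p - 2)| = |u| ^ (p - 1) := by
    intro u
    rcases eq_or_ne u 0 with rfl | hu
    · simp [zero_rpow (by linarith [hpq.lt] : p - 1 ≠ 0)]
    · rw [abs_mul, abs_of_nonneg (rpow_nonneg (abs_nonneg u) _)]
      rw [← rpow_one_add' (abs_nonneg u) (by linarith [hpq.lt])]; congr 1; ring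
  have hUU : ∀ u : ℝ, u * (u * |u| ^ (p - 2)) = |u| ^ p := by
    intro u
    rcases eq_or_ne u 0 with rfl | hu
    · simp [zero_rpow hp.ne']
    · rw [← mul_assoc, ← abs_mul_abs_self, ← sq, ← rpow_natCast, ← rpow_add (abs_pos.2 hu)]
      congr 1; push_cast; ring
  have hball : ∀ N : ℕ, ∫⁻ x in Metric.closedBall (0 : Fin 3 → ℝ) N, ENNReal.ofReal (|U x| ^ p) ≤
        ENNReal.ofReal (2 * C / η * ∫ y, |A y| ^ p) := by
    intro N
    set S := Metric.closedBall (0 : Fin 3 → ℝ) N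
    have hS : MeasurableSet S := measurableSet_closedBall
    set H : (Fin 3 → ℝ) → ℝ := S.indicator fun x => η * (U x * |U x| ^ (p - 2)) with hH
    have hHb : BddSupp H (max ρ N) (max M (η * L ^ (p - 1))) := by
      refine ⟨Measurable.indicator (by fun_prop) hS, fun y => ?_, fun y hy => ?_⟩
      · by_cases hy : y ∈ S
        · rw [hH, indicator_of_mem hy, abs_mul, abs_of_pos hη0, hUp]
          refine le_max_of_le_right ?_
          gcongr
          · linarith [hpq.lt]
          · exact hUb y
        · rw [hH, indicator_of_notMem hy, abs_zero]
          exact le_max_of_le_right (by positivity)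
      · rw [hH, indicator_of_notMem]
        intro h
        rw [mem_closedBall_zero_iff] at h
        exact absurd ((le_max_right ρ N).trans_lt hy) (not_lt.2 h)
    have hAb : BddSupp A (max ρ N) (max M (η * L ^ (p - 1))) :=
      ⟨hA.meas, fun y => (hA.bdd y).trans (le_max_left _ _),
        fun y hy => hA.supp y ((le_max_left _ _).trans_lt hy)⟩
    have h1 := hb δ _ _ A H hδ (hρ.trans (le_max_left _ _)) hAb hHb i j
    have hXi : IntegrableOn (fun x => |U x| ^ p) S := by
      refine Measure.integrableOn_of_bounded (M := L ^ p)
        (measure_closedBall_lt_top).ne (hUm.abs.pow_const p).aestronglyMeasurable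
        (ae_of_all _ fun x => ?_)
      rw [norm_eq_abs, abs_of_nonneg (rpow_nonneg (abs_nonneg _) _)]
      exact rpow_le_rpow (abs_nonneg _) (hUb x) hp.le
    have e1 : ∫ x, U x * H x = η * ∫ x in S, |U x| ^ p := by
      rw [← integral_const_mul, ← integral_indicator hS]
      congr 1; ext x
      by_cases hx : x ∈ S
      · rw [hH, indicator_of_mem hx, indicator_of_mem hx, ← hUU]; ring
      · rw [hH, indicator_of_notMem hx, indicator_of_notMem hx, mul_zero]
    have e2 : ∫ x, |H x| ^ q = η ^ q * ∫ x in S, |U x| ^ p := by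
      rw [← integral_const_mul, ← integral_indicator hS]
      congr 1; ext x
      by_cases hx : x ∈ S
      · rw [hH, indicator_of_mem hx, indicator_of_mem hx, abs_mul, abs_of_pos hη0, hUp,
          mul_rpow hη0.le (by positivity), ← rpow_mul (abs_nonneg _), hpq.sub_one_mul_conj]
      · rw [hH, indicator_of_notMem hx, indicator_of_notMem hx, abs_zero,
          zero_rpow hpq.symm.pos.ne']
    set X := ∫ x in S, |U x| ^ p with hX
    have hX0 : 0 ≤ X := integral_nonneg fun x => by positivity
    rw [e1, e2, abs_of_nonneg (by positivity)] at h1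
    rw [← ofReal_integral_eq_lintegral_ofReal hXi (ae_of_all _ fun x => by positivity)]
    refine ENNReal.ofReal_le_ofReal ?_
    rw [div_mul_eq_mul_div, le_div_iff₀ hη0]
    have h2 := mul_le_mul_of_nonneg_right hηq hX0
    nlinarith
  have hmono : Monotone fun N : ℕ => Metric.closedBall (0 : Fin 3 → ℝ) N := fun a b h =>
    Metric.closedBall_subset_closedBall (by exact_mod_cast h)
  have hun : ⋃ N : ℕ, Metric.closedBall (0 : Fin 3 → ℝ) N = univ := Metric.iUnion_closedBall_nat 0
  rw [← setLIntegral_univ, ← hun, setLIntegral_iUnion_of_directed _ (hmono.directed_le)]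
  exact iSup_le hball

/-- Cylindrical coordinates on `ℝ³`. -/
def cyl (w : (ℝ × ℝ) × ℝ) : Fin 3 → ℝ := ![w.1.1 * cos w.2, w.1.1 * sin w.2, w.1.2]

/-- The measure `r dr dz` on the half plane `r > 0`. -/
def halfPlane : Measure (ℝ × ℝ) :=
  ((volume.restrict (Ioi (0 : ℝ))).withDensity fun r => ENNReal.ofReal r).prod volume

/-- The angular measure. -/
def angle : Measure ℝ := volume.restrict (Ioo (-π) π)

lemma measurable_cyl : Measurable cyl := by
  refine measurable_pi_iff.2 fun i => ?_
  fin_cases i <;> simp [cyl] <;> fun_prop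

instance : SFinite halfPlane := by unfold halfPlane; infer_instance
instance : IsFiniteMeasure angle := by
  unfold angle; exact ⟨by simp⟩

lemma lintegral_halfPlane {F : ℝ × ℝ → ENNReal} (hF : Measurable F) :
    ∫⁻ w, F w ∂halfPlane = ∫⁻ r in Ioi (0 : ℝ), ∫⁻ z, ENNReal.ofReal r * F (r, z) := by
  unfold halfPlane
  rw [lintegral_prod _ hF.aemeasurable, lintegral_withDensity_eq_lintegral_mul _ (by fun_prop)
    (by fun_prop)]
  refine lintegral_congr fun r => ?_
  rw [Pi.mul_apply, lintegral_const_mul _ (by fun_prop)]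

lemma lintegral_cyl {F : (Fin 3 → ℝ) → ENNReal} (hF : Measurable F) :
    ∫⁻ x, F x = ∫⁻ w, F (cyl w) ∂(halfPlane.prod angle) := by
  have hG : Measurable fun w : (ℝ × ℝ) × ℝ => F (cyl w) := hF.comp measurable_cyl
  have e1 := (volume_preserving_piFinSuccAbove (fun _ : Fin 3 => ℝ) 2).symm
  have e2 := (volume_preserving_finTwoArrow ℝ).symm
  have hm1 : Measurable fun y : ℝ × (Fin 2 → ℝ) =>
      F ((MeasurableEquiv.piFinSuccAbove (fun _ : Fin 3 => ℝ) 2).symm y) := hF.comp e1.measurable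
  have h0 : ∫⁻ x, F x = ∫⁻ y : ℝ × (Fin 2 → ℝ),
      F ((MeasurableEquiv.piFinSuccAbove (fun _ : Fin 3 => ℝ) 2).symm y) :=
    (e1.lintegral_comp hF).symm
  have h2 : ∀ z, ∫⁻ y, F ((MeasurableEquiv.piFinSuccAbove (fun _ : Fin 3 => ℝ) 2).symm (z, y)) =
      ∫⁻ r in Ioi (0 : ℝ), ENNReal.ofReal r * ∫⁻ θ, F (cyl ((r, z), θ)) ∂angle := by
    intro z
    have hm : Measurable fun y =>
        F ((MeasurableEquiv.piFinSuccAbove (fun _ : Fin 3 => ℝ) 2).symm (z, y)) :=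
      hm1.comp measurable_prodMk_left
    rw [← e2.lintegral_comp hm, ← lintegral_comp_polarCoord_symm, polarCoord_target,
      Measure.volume_eq_prod, ← Measure.prod_restrict]
    have hh : ∀ w : ℝ × ℝ, F ((MeasurableEquiv.piFinSuccAbove (fun _ : Fin 3 => ℝ) 2).symm
        (z, (MeasurableEquiv.finTwoArrow).symm (polarCoord.symm w))) = F (cyl ((w.1, z), w.2)) := by
      intro w
      congr 1
      ext i
      fin_cases i <;> simp [cyl, polarCoord, MeasurableEquiv.piFinSuccAbove,
        MeasurableEquiv.finTwoArrow, Fin.insertNthEquiv, Fin.insertNth, Fin.succAboveCases]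
    simp_rw [hh]
    have hm3 : Measurable fun w : ℝ × ℝ => F (cyl ((w.1, z), w.2)) :=
      hF.comp (measurable_cyl.comp (by fun_prop))
    have hm4 : Measurable fun w : ℝ × ℝ => ENNReal.ofReal w.1 • F (cyl ((w.1, z), w.2)) :=
      (ENNReal.measurable_ofReal.comp measurable_fst).mul hm3
    rw [lintegral_prod _ hm4.aemeasurable]
    refine lintegral_congr fun r => ?_
    simp only [smul_eq_mul]
    have hm5 : Measurable fun θ : ℝ => F (cyl ((r, z), θ)) := hm3.comp measurable_prodMk_left
    rw [lintegral_const_mul _ hm5, angle]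
  have hJ : Measurable fun w : ℝ × ℝ => ∫⁻ θ, F (cyl (w, θ)) ∂angle := hG.lintegral_prod_right'
  rw [h0, Measure.volume_eq_prod, lintegral_prod _ hm1.aemeasurable, lintegral_congr h2,
    lintegral_lintegral_swap, lintegral_prod _ hG.aemeasurable, lintegral_halfPlane hJ]
  have hJ' : Measurable fun w : ℝ × ℝ => ∫⁻ θ, F (cyl ((w.2, w.1), θ)) ∂angle :=
    hJ.comp measurable_swap
  exact ((ENNReal.measurable_ofReal.comp measurable_snd).mul hJ').aemeasurable

lemma measurePreserving_cyl : MeasurePreserving cyl (halfPlane.prod angle) volume := by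
  refine ⟨measurable_cyl, ?_⟩
  ext s hs
  rw [Measure.map_apply measurable_cyl hs, ← lintegral_indicator_one hs,
    ← lintegral_indicator_one (measurable_cyl hs), lintegral_cyl (by exact measurable_one.indicator hs)]
  rfl

lemma ae_halfPlane : ∀ᵐ w ∂halfPlane, 0 < w.1 := by
  refine Measure.quasiMeasurePreserving_fst.ae ?_
  refine (withDensity_absolutelyContinuous _ _).ae_le ?_
  exact ae_restrict_mem measurableSet_Ioi

lemma ae_halfPlane_prod_angle :
    ∀ᵐ w ∂(halfPlane.prod angle), 0 < w.1.1 ∧ w.2 ∈ Ioo (-π) π :=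
  (Measure.quasiMeasurePreserving_fst.ae ae_halfPlane).and
    (Measure.quasiMeasurePreserving_snd.ae (ae_restrict_mem measurableSet_Ioo))

/-- The inverse of `cyl`. -/
def cylInv (x : Fin 3 → ℝ) : (ℝ × ℝ) × ℝ :=
  (((polarCoord (x 0, x 1)).1, x 2), (polarCoord (x 0, x 1)).2)

lemma cylInv_cyl {w : (ℝ × ℝ) × ℝ} (h : 0 < w.1.1 ∧ w.2 ∈ Ioo (-π) π) : cylInv (cyl w) = w := by
  have := polarCoord.right_inv (x := (w.1.1, w.2)) ⟨h.1, h.2⟩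
  have h3 : (cyl w 0, cyl w 1) = polarCoord.symm (w.1.1, w.2) := by
    simp [cyl, polarCoord]
  unfold cylInv
  rw [h3, this]
  simp [cyl]

lemma measurable_cylInv : Measurable cylInv := by
  unfold cylInv
  have h : Measurable fun x : Fin 3 → ℝ => polarCoord (x 0, x 1) := by
    simp only [polarCoord, OpenPartialHomeomorph.coe_mk]
    refine Measurable.prodMk (by fun_prop) ?_
    refine Complex.measurable_arg.comp ?_
    exact Complex.measurableEquivRealProd.symm.measurable.comp (by fun_prop)
  exact ((measurable_fst.comp h).prodMk (measurable_pi_apply 2)).prodMk (measurable_snd.comp h)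

/-- The squared distance `r² + r'² - 2 r r' cos θ + ζ²`, regularised by `δ`. -/
def dsq (δ r r' ζ θ : ℝ) : ℝ := r ^ 2 + r' ^ 2 + ζ ^ 2 - 2 * r * r' * cos θ + δ

/-- Half of the gradient of `dsq` with respect to `(r', ζ)`. -/
def dvec (r r' ζ θ : ℝ) : Fin 2 → ℝ := ![r' - r * cos θ, ζ]

/-- The second derivatives of `dsq ^ (-1/2)` in orthonormal directions. -/
def kern (δ : ℝ) (i j : Fin 2) (r r' ζ θ : ℝ) : ℝ :=
  3 * (dvec r r' ζ θ i * dvec r r' ζ θ j) * dsq δ r r' ζ θ ^ (-(5 / 2) : ℝ) -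
    (if i = j then 1 else 0) * dsq δ r r' ζ θ ^ (-(3 / 2) : ℝ)

lemma le_dsq (δ r r' ζ θ : ℝ) : δ ≤ dsq δ r r' ζ θ := by
  unfold dsq
  nlinarith [sq_nonneg (r - r' * cos θ), sq_nonneg ζ, sin_sq_add_cos_sq θ,
    mul_nonneg (sq_nonneg r') (sq_nonneg (sin θ))]

/-- The directions of increasing `r` and `z`. -/
def dir (i : Fin 2) (θ : ℝ) : Fin 3 → ℝ := if i = 0 then ![cos θ, sin θ, 0] else ![0, 0, 1]

lemma abs_dir_le (i : Fin 2) (θ : ℝ) (k : Fin 3) : |dir i θ k| ≤ 1 := by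
  fin_cases i <;> fin_cases k <;> simp [dir, abs_cos_le_one, abs_sin_le_one]

lemma measurable_dir (i : Fin 2) (k : Fin 3) : Measurable fun θ => dir i θ k := by
  fin_cases i <;> fin_cases k <;> simp [dir] <;> fun_prop

lemma sum_kap_dir (δ : ℝ) (i j : Fin 2) (r z α r' z' β : ℝ) :
    ∑ k, ∑ l, kap δ k l (cyl ((r, z), α) - cyl ((r', z'), β)) * (dir i β k * dir j β l) =
      kern δ i j r r' (z' - z) (β - α) := by
  have e : ∑ k, (cyl ((r, z), α) - cyl ((r', z'), β)) k ^ 2 + δ = dsq δ r r' (z' - z) (β - α) := by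
    simp only [Fin.sum_univ_three, cyl, dsq, cos_sub, Pi.sub_apply, Matrix.cons_val]
    linear_combination r ^ 2 * sin_sq_add_cos_sq α + r' ^ 2 * sin_sq_add_cos_sq β
  simp only [kap, e]
  unfold kern
  generalize dsq δ r r' (z' - z) (β - α) ^ (-(5 / 2) : ℝ) = P
  generalize dsq δ r r' (z' - z) (β - α) ^ (-(3 / 2) : ℝ) = Q
  have s2 := sin_sq_add_cos_sq β
  have hs : sin β ^ 2 = 1 - cos β ^ 2 := by linarith
  have hs3 : sin β ^ 3 = sin β * (1 - cos β ^ 2) := by rw [← hs]; ring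
  have hs4 : sin β ^ 4 = (1 - cos β ^ 2) ^ 2 := by rw [← hs]; ring
  fin_cases i <;> fin_cases j <;>
    simp [Fin.sum_univ_three, dir, cyl, dvec, cos_sub] <;> ring_nf <;>
    try simp only [hs, hs3, hs4] <;> ring
  simp

lemma continuous_kern {δ : ℝ} (hδ : 0 < δ) (i j : Fin 2) :
    Continuous fun x : ((ℝ × ℝ) × ℝ) × ℝ => kern δ i j x.1.1.1 x.1.1.2 x.1.2 x.2 := by
  have h1 : Continuous fun x : ((ℝ × ℝ) × ℝ) × ℝ => dsq δ x.1.1.1 x.1.1.2 x.1.2 x.2 := by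
    unfold dsq; fun_prop
  have h0 : ∀ x : ((ℝ × ℝ) × ℝ) × ℝ, dsq δ x.1.1.1 x.1.1.2 x.1.2 x.2 ≠ 0 := fun x =>
    (hδ.trans_le (le_dsq _ _ _ _ _)).ne'
  have h2 : ∀ i, Continuous fun x : ((ℝ × ℝ) × ℝ) × ℝ => dvec x.1.1.1 x.1.1.2 x.1.2 x.2 i := by
    intro i
    fin_cases i <;> simp [dvec] <;> fun_prop
  unfold kern
  exact ((continuous_const.mul ((h2 i).mul (h2 j))).mul
    (h1.rpow_const fun x => Or.inl (h0 x))).sub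
    (continuous_const.mul (h1.rpow_const fun x => Or.inl (h0 x)))

lemma dsq_neg (δ r r' ζ θ : ℝ) : dsq δ r r' ζ (-θ) = dsq δ r r' ζ θ := by simp [dsq]
lemma dvec_neg (r r' ζ θ : ℝ) : dvec r r' ζ (-θ) = dvec r r' ζ θ := by simp [dvec]
lemma kern_neg (δ : ℝ) (i j : Fin 2) (r r' ζ θ : ℝ) :
    kern δ i j r r' ζ (-θ) = kern δ i j r r' ζ θ := by simp [kern, dsq_neg, dvec_neg]
lemma kern_periodic (δ : ℝ) (i j : Fin 2) (r r' ζ : ℝ) :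
    Function.Periodic (kern δ i j r r' ζ) (2 * π) := fun θ => by simp [kern, dsq, dvec]

lemma integral_angle (h : ℝ → ℝ) : ∫ θ, h θ ∂angle = ∫ θ in (-π)..π, h θ := by
  rw [angle, intervalIntegral.integral_of_le (by linarith [pi_pos]), integral_Ioc_eq_integral_Ioo]

lemma integral_shift_cos {h : ℝ → ℝ} (hc : Continuous h) (hp : Function.Periodic h (2 * π))
    (he : ∀ θ, h (-θ) = h θ) (m : ℕ) (α : ℝ) :
    ∫ β, h (β - α) * cos (m * β) ∂angle = cos (m * α) * ∫ θ, h θ * cos (m * θ) ∂angle := by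
  rw [integral_angle, integral_angle]
  have hG : Function.Periodic (fun θ => h θ * cos (m * (θ + α))) (2 * π) := by
    intro θ
    simp only [hp θ]
    rw [show (m : ℝ) * (θ + 2 * π + α) = m * (θ + α) + m * (2 * π) by ring, cos_add_nat_mul_two_pi]
  have h1 : ∫ β in (-π)..π, h (β - α) * cos (m * β) =
      ∫ θ in (-π - α)..(π - α), h θ * cos (m * (θ + α)) := by
    rw [← intervalIntegral.integral_comp_sub_right (fun θ => h θ * cos (m * (θ + α))) α]
    simp
  have h2 := hG.intervalIntegral_add_eq (-π - α) (-π)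
  rw [show -π - α + 2 * π = π - α by ring, show -π + 2 * π = π by ring] at h2
  have h3 : ∫ θ in (-π)..π, h θ * sin (m * θ) = 0 := by
    have := intervalIntegral.integral_comp_neg (a := -π) (b := π) (fun θ => h θ * sin (m * θ))
    simp only [he, mul_neg, sin_neg, neg_neg, intervalIntegral.integral_neg] at this
    linarith
  rw [h1, h2]
  have h4 : ∀ θ, h θ * cos (m * (θ + α)) =
      cos (m * α) * (h θ * cos (m * θ)) - sin (m * α) * (h θ * sin (m * θ)) := by
    intro θ; rw [mul_add, cos_add]; ring
  simp_rw [h4]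
  rw [intervalIntegral.integral_sub, intervalIntegral.integral_const_mul,
    intervalIntegral.integral_const_mul, h3]
  · ring
  all_goals exact Continuous.intervalIntegrable (by fun_prop) _ _

lemma le_integral_abs_cos_rpow {p : ℝ} (hp : 0 < p) {m : ℕ} (hm : 1 ≤ m) :
    (4 : ℝ) ^ (-(p / 2)) * (π / 2) ≤ ∫ α, |cos (m * α)| ^ p ∂angle := by
  have h1 : ∀ c : ℝ, (4 : ℝ) ^ (-(p / 2)) * (cos c ^ 2 - 1 / 4) ≤ |cos c| ^ p := by
    intro c
    rcases le_total (cos c ^ 2) (1 / 4) with h | h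
    · exact (mul_nonpos_of_nonneg_of_nonpos (by positivity) (by linarith)).trans (by positivity)
    · have e : |cos c| ^ p = (cos c ^ 2) ^ (p / 2) := by
        rw [← sq_abs, ← rpow_natCast, ← rpow_mul (abs_nonneg _)]; congr 1; push_cast; ring
      have e2 : (4 : ℝ) ^ (-(p / 2)) = (1 / 4 : ℝ) ^ (p / 2) := by
        rw [rpow_neg (by norm_num), ← inv_rpow (by norm_num)]; norm_num
      rw [e, e2]
      have h3 := cos_sq_le_one c
      calc (1 / 4 : ℝ) ^ (p / 2) * (cos c ^ 2 - 1 / 4) ≤ (1 / 4 : ℝ) ^ (p / 2) * 1 := by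
            refine mul_le_mul_of_nonneg_left (by linarith) (by positivity)
        _ ≤ _ := by rw [mul_one]; exact rpow_le_rpow (by norm_num) h (by positivity)
  rw [integral_angle]
  have hm0 : (m : ℝ) ≠ 0 := by positivity
  have h2 : ∫ α in (-π)..π, (4 : ℝ) ^ (-(p / 2)) * (cos (m * α) ^ 2 - 1 / 4) =
      (4 : ℝ) ^ (-(p / 2)) * (π / 2) := by
    rw [intervalIntegral.integral_const_mul]
    congr 1
    have e : ∀ α : ℝ, cos (m * α) ^ 2 - 1 / 4 = 1 / 4 + 1 / 2 * cos (2 * m * α) := by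
      intro α; rw [cos_sq]; ring_nf
    simp_rw [e]
    rw [intervalIntegral.integral_add (by simp) (Continuous.intervalIntegrable (by fun_prop) _ _),
      intervalIntegral.integral_const_mul, intervalIntegral.integral_comp_mul_left _ (by positivity),
      integral_cos]
    rw [show 2 * (m : ℝ) * -π = -((2 * m : ℕ) * π) by push_cast; ring,
      show 2 * (m : ℝ) * π = ((2 * m : ℕ) * π) by push_cast; ring, sin_neg, sin_nat_mul_pi]
    simp; ring
  rw [← h2]
  refine intervalIntegral.integral_mono_on (by linarith [pi_pos])
    (Continuous.intervalIntegrable (by fun_prop) _ _)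
    (Continuous.intervalIntegrable ?_ _ _) fun α _ => h1 _
  exact Continuous.rpow_const (by fun_prop) fun _ => Or.inr hp.le


/-- A bounded measurable compactly supported density on the half plane. -/
structure HalfSupp (g : ℝ × ℝ → ℝ) (ρ M : ℝ) : Prop where
  meas : Measurable g
  bdd : ∀ w, |g w| ≤ M
  supp_fst : ∀ w, ρ < |w.1| → g w = 0
  supp_snd : ∀ w, ρ < |w.2| → g w = 0

/-- The regularised singular integral operator in the `m`-th angular mode. -/
def singOp (δ : ℝ) (m : ℕ) (i j : Fin 2) (g : ℝ × ℝ → ℝ) (w : ℝ × ℝ) : ℝ :=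
  ∫ v, g v * ∫ θ, kern δ i j w.1 v.1 (v.2 - w.2) θ * cos (m * θ) ∂angle ∂halfPlane

/-- The components of the Cartesian tensor field with angular mode `m`. -/
def lift (m : ℕ) (i j : Fin 2) (g : ℝ × ℝ → ℝ) (k l : Fin 3) (x : Fin 3 → ℝ) : ℝ :=
  g (cylInv x).1 * (dir i (cylInv x).2 k * dir j (cylInv x).2 l) * cos (m * (cylInv x).2)

lemma abs_lift_le (m : ℕ) (i j : Fin 2) (g : ℝ × ℝ → ℝ) (k l : Fin 3) (x : Fin 3 → ℝ) :
    |lift m i j g k l x| ≤ |g (cylInv x).1| := by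
  unfold lift
  rw [abs_mul, abs_mul, abs_mul]
  have h1 := abs_dir_le i (cylInv x).2 k
  have h2 := abs_dir_le j (cylInv x).2 l
  have h3 := abs_cos_le_one (m * (cylInv x).2)
  have h4 := mul_le_one₀ h1 (abs_nonneg _) h2
  have h5 := mul_le_one₀ h4 (abs_nonneg _) h3
  calc _ = |g (cylInv x).1| * (|dir i (cylInv x).2 k| * |dir j (cylInv x).2 l| *
        |cos (m * (cylInv x).2)|) := by ring
    _ ≤ |g (cylInv x).1| * 1 := by exact mul_le_mul_of_nonneg_left h5 (abs_nonneg _)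
    _ = _ := mul_one _

lemma abs_le_abs_polarCoord_fst (x : ℝ × ℝ) :
    |x.1| ≤ |(polarCoord x).1| ∧ |x.2| ≤ |(polarCoord x).1| := by
  have : (polarCoord x).1 = √(x.1 ^ 2 + x.2 ^ 2) := rfl
  rw [this, abs_of_nonneg (sqrt_nonneg _)]
  exact ⟨abs_le_sqrt (by nlinarith [sq_nonneg x.2]), abs_le_sqrt (by nlinarith [sq_nonneg x.1])⟩

lemma HalfSupp.lift {g : ℝ × ℝ → ℝ} {ρ M : ℝ} (hg : HalfSupp g ρ M) (hρ : 0 ≤ ρ) (m : ℕ)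
    (i j : Fin 2) (k l : Fin 3) : BddSupp (lift m i j g k l) ρ M where
  meas := by
    have h1 := measurable_cylInv.fst
    have h2 := measurable_cylInv.snd
    unfold _root_.lift
    exact ((hg.meas.comp h1).mul (((measurable_dir i k).comp h2).mul
      ((measurable_dir j l).comp h2))).mul (measurable_cos.comp (h2.const_mul _))
  bdd y := (abs_lift_le _ _ _ _ _ _ _).trans (hg.bdd _)
  supp y hy := by
    have h0 : g (cylInv y).1 = 0 := by
      by_contra hne
      have a1 : |(cylInv y).1.1| ≤ ρ := not_lt.1 fun h => hne (hg.supp_fst _ h)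
      have a2 : |(cylInv y).1.2| ≤ ρ := not_lt.1 fun h => hne (hg.supp_snd _ h)
      have b := abs_le_abs_polarCoord_fst (y 0, y 1)
      refine absurd hy (not_lt.2 ((pi_norm_le_iff_of_nonneg hρ).2 fun i => ?_))
      rw [norm_eq_abs]
      fin_cases i
      · exact b.1.trans a1
      · exact b.2.trans a1
      · exact a2
    simp [_root_.lift, h0]

lemma lift_cyl {w : (ℝ × ℝ) × ℝ} (h : 0 < w.1.1 ∧ w.2 ∈ Ioo (-π) π) (m : ℕ) (i j : Fin 2)
    (g : ℝ × ℝ → ℝ) (k l : Fin 3) :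
    lift m i j g k l (cyl w) = g w.1 * (dir i w.2 k * dir j w.2 l) * cos (m * w.2) := by
  rw [lift, cylInv_cyl h]

lemma integral_cyl {F : (Fin 3 → ℝ) → ℝ} (hF : Measurable F) :
    ∫ x, F x = ∫ w, F (cyl w) ∂(halfPlane.prod angle) := by
  rw [← measurePreserving_cyl.map_eq]
  exact integral_map measurable_cyl.aemeasurable hF.aestronglyMeasurable

lemma integrable_cyl {F : (Fin 3 → ℝ) → ℝ} (hF : Integrable F) :
    Integrable (fun w => F (cyl w)) (halfPlane.prod angle) :=
  measurePreserving_cyl.integrable_comp_of_integrable hF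

lemma sum_pot_lift {g : ℝ × ℝ → ℝ} {ρ M : ℝ} (hg : HalfSupp g ρ M) (hρ : 0 ≤ ρ) {δ : ℝ}
    (hδ : 0 < δ) (m : ℕ) (i j : Fin 2) (w : ℝ × ℝ) (α : ℝ) :
    ∑ k, ∑ l, pot (kap δ k l) (lift m i j g k l) (cyl (w, α)) =
      cos (m * α) * singOp δ m i j g w := by
  have hm : ∀ k l, Measurable fun y => kap δ k l (cyl (w, α) - y) * lift m i j g k l y := by
    intro k l
    exact ((continuous_kap hδ k l).measurable.comp (by fun_prop)).mul (hg.lift hρ m i j k l).meas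
  have hi : ∀ k l, Integrable fun y => kap δ k l (cyl (w, α) - y) * lift m i j g k l y := by
    intro k l
    exact (hg.lift hρ m i j k l).integrable_mul ((continuous_kap hδ k l).comp (by fun_prop))
  have hic := fun k l => integrable_cyl (hi k l)
  set G : (ℝ × ℝ) × ℝ → ℝ := fun v =>
    g v.1 * (kern δ i j w.1 v.1.1 (v.1.2 - w.2) (v.2 - α) * cos (m * v.2)) with hG
  have hae : (fun v => ∑ k, ∑ l, kap δ k l (cyl (w, α) - cyl v) * lift m i j g k l (cyl v))
      =ᵐ[halfPlane.prod angle] G := by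
    filter_upwards [ae_halfPlane_prod_angle] with v hv
    have := sum_kap_dir δ i j w.1 w.2 α v.1.1 v.1.2 v.2
    rw [hG]
    simp only [lift_cyl hv, ← this, Finset.sum_mul, Finset.mul_sum]
    refine Finset.sum_congr rfl fun k _ => Finset.sum_congr rfl fun l _ => ?_
    ring
  have hGi : Integrable G (halfPlane.prod angle) := by
    refine Integrable.congr ?_ hae
    exact integrable_finsetSum _ fun k _ => integrable_finsetSum _ fun l _ => hic k l
  have e : ∑ k, ∑ l, pot (kap δ k l) (lift m i j g k l) (cyl (w, α)) =
      ∫ v, G v ∂(halfPlane.prod angle) := by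
    rw [← integral_congr_ae hae, integral_finsetSum _ fun k _ =>
      integrable_finsetSum _ fun l _ => hic k l]
    refine Finset.sum_congr rfl fun k _ => ?_
    rw [integral_finsetSum _ fun l _ => hic k l]
    refine Finset.sum_congr rfl fun l _ => ?_
    rw [pot, integral_cyl (hm k l)]
  rw [e, integral_prod _ hGi, singOp, ← integral_const_mul]
  refine integral_congr_ae (ae_of_all _ fun v => ?_)
  simp only [hG]
  rw [integral_const_mul, integral_shift_cos (h := kern δ i j w.1 v.1 (v.2 - w.2)) ?_
    (kern_periodic _ _ _ _ _ _) (kern_neg _ _ _ _ _ _)]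
  · ring
  · exact (continuous_kern hδ i j).comp (f := fun θ => (((w.1, v.1), v.2 - w.2), θ)) (by fun_prop)

lemma measurable_singOp {g : ℝ × ℝ → ℝ} (hg : Measurable g) {δ : ℝ} (hδ : 0 < δ) (m : ℕ)
    (i j : Fin 2) : Measurable (singOp δ m i j g) := by
  have h1 : Continuous fun x : ((ℝ × ℝ) × (ℝ × ℝ)) × ℝ =>
      kern δ i j x.1.1.1 x.1.2.1 (x.1.2.2 - x.1.1.2) x.2 * cos (m * x.2) :=
    ((continuous_kern hδ i j).comp (f := fun x : ((ℝ × ℝ) × (ℝ × ℝ)) × ℝ =>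
      (((x.1.1.1, x.1.2.1), x.1.2.2 - x.1.1.2), x.2)) (by fun_prop)).mul (by fun_prop)
  have h2 : StronglyMeasurable fun x : (ℝ × ℝ) × (ℝ × ℝ) =>
      ∫ θ, kern δ i j x.1.1 x.2.1 (x.2.2 - x.1.2) θ * cos (m * θ) ∂angle :=
    StronglyMeasurable.integral_prod_right'
      (f := fun x : ((ℝ × ℝ) × (ℝ × ℝ)) × ℝ =>
        kern δ i j x.1.1.1 x.1.2.1 (x.1.2.2 - x.1.1.2) x.2 * cos (m * x.2))
      h1.measurable.stronglyMeasurable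
  exact (StronglyMeasurable.integral_prod_right'
    (f := fun x : (ℝ × ℝ) × (ℝ × ℝ) =>
      g x.2 * ∫ θ, kern δ i j x.1.1 x.2.1 (x.2.2 - x.1.2) θ * cos (m * θ) ∂angle)
    ((hg.comp measurable_snd).mul h2.measurable).stronglyMeasurable).measurable

lemma HalfSupp.integral_abs_lift_rpow_le {g : ℝ × ℝ → ℝ} {ρ M : ℝ} (hg : HalfSupp g ρ M)
    (hρ : 0 ≤ ρ) {p : ℝ} (hp : 0 < p) (m : ℕ) (i j : Fin 2) (k l : Fin 3) :
    ENNReal.ofReal (∫ x, |_root_.lift m i j g k l x| ^ p) ≤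
      ENNReal.ofReal (2 * π) * ∫⁻ w, ENNReal.ofReal (|g w| ^ p) ∂halfPlane := by
  have hL := hg.lift hρ m i j k l
  have hLm : Measurable fun x => |_root_.lift m i j g k l x| ^ p := hL.meas.abs.pow_const p
  have hgm : Measurable fun w => ENNReal.ofReal (|g w| ^ p) := (hg.meas.abs.pow_const p).ennreal_ofReal
  rw [integral_eq_lintegral_of_nonneg_ae (ae_of_all _ fun x => by positivity)
    hLm.aestronglyMeasurable]
  refine ENNReal.ofReal_toReal_le.trans ?_
  rw [lintegral_cyl hLm.ennreal_ofReal]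
  have h1 : ∫⁻ w, ENNReal.ofReal (|_root_.lift m i j g k l (cyl w)| ^ p) ∂(halfPlane.prod angle) ≤
      ∫⁻ w, ENNReal.ofReal (|g w.1| ^ p) ∂(halfPlane.prod angle) := by
    refine lintegral_mono_ae ?_
    filter_upwards [ae_halfPlane_prod_angle] with w hw
    refine ENNReal.ofReal_le_ofReal (rpow_le_rpow (abs_nonneg _) ?_ hp.le)
    refine (abs_lift_le _ _ _ _ _ _ _).trans_eq ?_
    rw [cylInv_cyl hw]
  refine h1.trans_eq ?_
  have hgm' : Measurable fun w : (ℝ × ℝ) × ℝ => ENNReal.ofReal (|g w.1| ^ p) :=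
    hgm.comp measurable_fst
  rw [lintegral_prod _ hgm'.aemeasurable]
  simp only [lintegral_const]
  rw [lintegral_mul_const _ hgm, mul_comm]
  congr 1
  simp only [angle, MeasurableSet.univ, Measure.restrict_apply, univ_inter, volume_Ioo]
  congr 1; ring

/-- The regularised singular integrals are bounded on `L^p(r dr dz)`, uniformly in the angular mode
and in the regularisation. -/
theorem lintegral_singOp_rpow_le {p : ℝ} (hp : 1 < p) :
    ∃ C : ℝ, 0 ≤ C ∧ ∀ (δ ρ M : ℝ) (m : ℕ) (g : ℝ × ℝ → ℝ), 0 < δ → 0 ≤ ρ → 1 ≤ m →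
      HalfSupp g ρ M → ∀ i j, ∫⁻ w, ENNReal.ofReal (|singOp δ m i j g w| ^ p) ∂halfPlane ≤
        ENNReal.ofReal C * ∫⁻ w, ENNReal.ofReal (|g w| ^ p) ∂halfPlane := by
  obtain ⟨C, hC, hb⟩ := lintegral_pot_kap_rpow_le (HolderConjugate.conjExponent hp)
  have hp0 : 0 < p := by linarith
  set c := (4 : ℝ) ^ (-(p / 2)) * (π / 2) with hc
  have hc0 : 0 < c := by positivity
  refine ⟨9 ^ p * C * (2 * π) / c, by positivity, fun δ ρ M m g hδ hρ hm hg i j => ?_⟩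
  set N := ∫⁻ w, ENNReal.ofReal (|g w| ^ p) ∂halfPlane
  set S := ∫⁻ w, ENNReal.ofReal (|singOp δ m i j g w| ^ p) ∂halfPlane
  have hP : ∀ k l, Measurable (pot (kap δ k l) (lift m i j g k l)) := fun k l =>
    measurable_pot_const (continuous_kap hδ k l).measurable (hg.lift hρ m i j k l).meas
  set P : (Fin 3 → ℝ) → ℝ := fun x =>
    ∑ k, ∑ l, pot (kap δ k l) (lift m i j g k l) x with hPdef
  have hPm : Measurable P := by
    refine Finset.measurable_fun_sum _ fun k _ => Finset.measurable_fun_sum _ fun l _ => hP k l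
  have h1 : ∫⁻ x, ENNReal.ofReal (|P x| ^ p) ≤ ENNReal.ofReal (9 ^ p * C * (2 * π)) * N := by
    have a1 : ∀ x, ENNReal.ofReal (|P x| ^ p) ≤ ENNReal.ofReal (9 ^ (p - 1)) *
        ∑ k, ∑ l, ENNReal.ofReal (|pot (kap δ k l) (lift m i j g k l) x| ^ p) := by
      intro x
      have := Real.rpow_sum_le_const_mul_sum_rpow (s := (Finset.univ : Finset (Fin 3 × Fin 3)))
        (fun kl => pot (kap δ kl.1 kl.2) (lift m i j g kl.1 kl.2) x) hp.le
      rw [Fintype.sum_prod_type, Fintype.sum_prod_type] at this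
      simp only [Finset.card_univ, Fintype.card_prod, Fintype.card_fin] at this
      norm_num at this
      have e : ∑ k, ∑ l, ENNReal.ofReal (|pot (kap δ k l) (lift m i j g k l) x| ^ p) =
          ENNReal.ofReal (∑ k, ∑ l, |pot (kap δ k l) (lift m i j g k l) x| ^ p) := by
        rw [ENNReal.ofReal_sum_of_nonneg fun _ _ => Finset.sum_nonneg fun _ _ => by positivity]
        refine Finset.sum_congr rfl fun k _ => ?_
        rw [ENNReal.ofReal_sum_of_nonneg fun _ _ => by positivity]
      rw [e, ← ENNReal.ofReal_mul (by positivity)]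
      refine ENNReal.ofReal_le_ofReal ((rpow_le_rpow (abs_nonneg _) ?_ hp0.le).trans this)
      refine (Finset.abs_sum_le_sum_abs _ _).trans (Finset.sum_le_sum fun k _ => ?_)
      exact Finset.abs_sum_le_sum_abs _ _
    have a2 : ∀ k l, ∫⁻ x, ENNReal.ofReal (|pot (kap δ k l) (lift m i j g k l) x| ^ p) ≤
        ENNReal.ofReal (C * (2 * π)) * N := by
      intro k l
      refine (hb δ ρ M _ hδ hρ (hg.lift hρ m i j k l) k l).trans ?_
      rw [ENNReal.ofReal_mul hC, ENNReal.ofReal_mul hC, mul_assoc]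
      exact mul_le_mul_right (hg.integral_abs_lift_rpow_le hρ hp0 m i j k l) _
    refine (lintegral_mono a1).trans ?_
    have hPm' : ∀ k l, Measurable fun x =>
        ENNReal.ofReal (|pot (kap δ k l) (lift m i j g k l) x| ^ p) := fun k l =>
      ((hP k l).abs.pow_const p).ennreal_ofReal
    rw [lintegral_const_mul _ (Finset.measurable_fun_sum _ fun k _ =>
      Finset.measurable_fun_sum _ fun l _ => hPm' k l),
      lintegral_finsetSum _ fun k _ => Finset.measurable_fun_sum _ fun l _ => hPm' k l]
    have a3 : ∑ k, ∫⁻ x, ∑ l, ENNReal.ofReal (|pot (kap δ k l) (lift m i j g k l) x| ^ p) ≤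
        ENNReal.ofReal 9 * (ENNReal.ofReal (C * (2 * π)) * N) := by
      calc _ ≤ ∑ _k : Fin 3, ∑ _l : Fin 3, ENNReal.ofReal (C * (2 * π)) * N := by
            refine Finset.sum_le_sum fun k _ => ?_
            rw [lintegral_finsetSum _ fun l _ => hPm' k l]
            exact Finset.sum_le_sum fun l _ => a2 k l
        _ = _ := by
            simp only [Finset.sum_const, Finset.card_univ, Fintype.card_fin, smul_smul]
            rw [nsmul_eq_mul]; norm_num
    refine (mul_le_mul_right a3 _).trans_eq ?_
    rw [← mul_assoc, ← mul_assoc, ← ENNReal.ofReal_mul (by positivity),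
      ← ENNReal.ofReal_mul (by positivity)]
    congr 2
    rw [rpow_sub_one (by norm_num)]; ring
  have h2 : ∫⁻ x, ENNReal.ofReal (|P x| ^ p) =
      S * ENNReal.ofReal (∫ α, |cos (m * α)| ^ p ∂angle) := by
    have hcm : Continuous fun α : ℝ => |cos (m * α)| ^ p :=
      Continuous.rpow_const (by fun_prop) fun _ => Or.inr hp0.le
    have hci : Integrable (fun α : ℝ => |cos (m * α)| ^ p) angle :=
      (hcm.integrableOn_Icc (a := -π) (b := π)).mono_set Ioo_subset_Icc_self
    rw [lintegral_cyl (hPm.abs.pow_const p).ennreal_ofReal, ofReal_integral_eq_lintegral_ofReal hci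
      (ae_of_all _ fun x => by positivity)]
    have hsm := measurable_singOp hg.meas hδ m i j
    rw [← lintegral_prod_mul ((hsm.abs.pow_const p).ennreal_ofReal).aemeasurable
      hcm.measurable.ennreal_ofReal.aemeasurable]
    refine lintegral_congr fun w => ?_
    rw [← ENNReal.ofReal_mul (by positivity), ← mul_rpow (abs_nonneg _) (abs_nonneg _), ← abs_mul,
      mul_comm (singOp _ _ _ _ _ _), ← sum_pot_lift hg hρ hδ]
  have h3 : S * ENNReal.ofReal c ≤ ENNReal.ofReal (9 ^ p * C * (2 * π)) * N := by
    rw [h2] at h1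
    exact (mul_le_mul_right (ENNReal.ofReal_le_ofReal (le_integral_abs_cos_rpow hp0 hm)) _).trans h1
  have hc1 : ENNReal.ofReal c ≠ 0 := by simpa using hc0
  rw [ENNReal.ofReal_div_of_pos hc0, ENNReal.mul_div_right_comm.symm]
  rwa [ENNReal.le_div_iff_mul_le (Or.inl hc1) (Or.inl ENNReal.ofReal_ne_top)]

/-- Angular Fourier coefficients of `cos θ ^ l * (A - B cos θ) ^ (-s)`. -/
def angInt (A B s : ℝ) (l m : ℕ) : ℝ :=
  ∫ θ in (-π)..π, cos θ ^ l * cos (m * θ) * (A - B * cos θ) ^ (-s)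

section
variable {A₀ A B : ℝ}

lemma half_le_sub_mul_cos (hA₀ : A₀ ≤ A) (hB0 : 0 ≤ B) (hB : B ≤ A₀ / 2) (θ : ℝ) :
    A₀ / 2 ≤ A - B * cos θ := by
  nlinarith [cos_le_one θ]

lemma continuous_sub_mul_cos_rpow (h : ∀ θ, 0 < A - B * cos θ) (s : ℝ) :
    Continuous fun θ => (A - B * cos θ) ^ (-s) :=
  Continuous.rpow_const (by fun_prop) fun θ => Or.inl (h θ).ne'

lemma angInt_succ_succ (h : ∀ θ, 0 < A - B * cos θ) (s : ℝ) (l m : ℕ) :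
    angInt A B s (l + 1) (m + 1) = (angInt A B s l m + angInt A B s l (m + 2)) / 2 := by
  have hc := continuous_sub_mul_cos_rpow h s
  unfold angInt
  rw [← intervalIntegral.integral_add (Continuous.intervalIntegrable (by fun_prop) _ _)
    (Continuous.intervalIntegrable (by fun_prop) _ _), ← intervalIntegral.integral_div]
  congr 1; ext θ
  have h1 : cos (m * θ) = cos ((m + 1 : ℝ) * θ) * cos θ + sin ((m + 1 : ℝ) * θ) * sin θ := by
    rw [← cos_sub]; ring_nf
  have h2 : cos ((m + 2 : ℝ) * θ) = cos ((m + 1 : ℝ) * θ) * cos θ - sin ((m + 1 : ℝ) * θ) * sin θ := by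
    rw [← cos_add]; ring_nf
  push_cast
  rw [h1, h2]; ring

lemma angInt_zero_succ (h : ∀ θ, 0 < A - B * cos θ) (s : ℝ) (m : ℕ) :
    angInt A B s 0 (m + 1) =
      s * B / (2 * (m + 1)) * (angInt A B (s + 1) 0 m - angInt A B (s + 1) 0 (m + 2)) := by
  have hc := continuous_sub_mul_cos_rpow h (s + 1)
  have hm : (m + 1 : ℝ) ≠ 0 := by positivity
  have hu : ∀ θ, HasDerivAt (fun θ => (A - B * cos θ) ^ (-s))
      (-s * (A - B * cos θ) ^ (-(s + 1)) * (B * sin θ)) θ := by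
    intro θ
    have h1 : HasDerivAt (fun θ => A - B * cos θ) (B * sin θ) θ :=
      (((hasDerivAt_cos θ).const_mul B).const_sub A).congr_deriv (by ring)
    refine (h1.rpow_const (Or.inl (h θ).ne')).congr_deriv ?_
    rw [show -(s + 1) = -s - 1 by ring]; ring
  have hv : ∀ θ, HasDerivAt (fun θ => sin ((m + 1 : ℝ) * θ) / (m + 1)) (cos ((m + 1 : ℝ) * θ)) θ := by
    intro θ
    refine (((hasDerivAt_id θ).const_mul (m + 1 : ℝ)).sin.div_const (m + 1 : ℝ)).congr_deriv ?_
    simp; field_simp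
  have key := intervalIntegral.integral_mul_deriv_eq_deriv_mul (a := -π) (b := π)
    (fun θ _ => hu θ) (fun θ _ => hv θ) (Continuous.intervalIntegrable (by fun_prop) _ _)
    (Continuous.intervalIntegrable (by fun_prop) _ _)
  have s1 : sin ((m + 1 : ℝ) * π) = 0 := by exact_mod_cast sin_nat_mul_pi (m + 1)
  rw [show (m + 1 : ℝ) * -π = -((m + 1 : ℝ) * π) by ring, sin_neg, s1] at key
  simp only [neg_zero, zero_div, mul_zero, sub_zero, zero_sub] at key
  have e0 : angInt A B s 0 (m + 1) = ∫ θ in (-π)..π, (A - B * cos θ) ^ (-s) * cos ((m + 1 : ℝ) * θ) := by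
    unfold angInt; congr 1; ext θ; push_cast; ring
  rw [e0, key]
  unfold angInt
  rw [← intervalIntegral.integral_neg, ← intervalIntegral.integral_sub
    (Continuous.intervalIntegrable (by fun_prop) _ _)
    (Continuous.intervalIntegrable (by fun_prop) _ _), ← intervalIntegral.integral_const_mul]
  congr 1; ext θ
  have h1 : cos (m * θ) = cos ((m + 1 : ℝ) * θ) * cos θ + sin ((m + 1 : ℝ) * θ) * sin θ := by
    rw [← cos_sub]; ring_nf
  have h2 : cos ((m + 2 : ℝ) * θ) = cos ((m + 1 : ℝ) * θ) * cos θ - sin ((m + 1 : ℝ) * θ) * sin θ := by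
    rw [← cos_add]; ring_nf
  push_cast
  rw [h1, h2]; field_simp; ring

lemma abs_angInt_zero_le (j : ℕ) (s : ℝ) (hs : 0 ≤ s) : ∃ C : ℝ, 0 ≤ C ∧ ∀ A₀ A B : ℝ, 0 < A₀ →
    A₀ ≤ A → 0 ≤ B → B ≤ A₀ / 2 → ∀ m : ℕ, j ≤ m →
      |angInt A B s 0 m| ≤ C * B ^ j * A₀ ^ (-(s + j)) := by
  induction j generalizing s with
  | zero =>
    refine ⟨2 ^ s * (2 * π), by positivity, fun A₀ A B h0 hA hB0 hB m _ => ?_⟩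
    have h1 : ∀ θ ∈ Set.uIoc (-π) π, ‖cos θ ^ 0 * cos (m * θ) * (A - B * cos θ) ^ (-s)‖ ≤ 2 ^ s * A₀ ^ (-s) := by
      intro θ _
      have h2 := half_le_sub_mul_cos hA hB0 hB θ
      have h3 : (A - B * cos θ) ^ (-s) ≤ (A₀ / 2) ^ (-s) :=
        rpow_le_rpow_of_nonpos (by positivity) h2 (by linarith)
      have h4 : (A₀ / 2) ^ (-s) = 2 ^ s * A₀ ^ (-s) := by
        rw [div_rpow h0.le (by norm_num), rpow_neg (by norm_num : (0:ℝ) ≤ 2), div_inv_eq_mul, mul_comm]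
      have h5 : 0 ≤ (A - B * cos θ) ^ (-s) := rpow_nonneg (by linarith) _
      rw [pow_zero, one_mul, norm_mul, norm_eq_abs, norm_eq_abs, abs_of_nonneg h5, ← h4]
      calc _ ≤ 1 * (A - B * cos θ) ^ (-s) :=
            mul_le_mul_of_nonneg_right (abs_cos_le_one _) h5
        _ ≤ _ := by rw [one_mul]; exact h3
    have := intervalIntegral.norm_integral_le_of_norm_le_const h1
    rw [norm_eq_abs, show π - -π = 2 * π by ring, abs_of_pos two_pi_pos] at this
    refine this.trans_eq ?_
    simp; ring
  | succ j ih =>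
    obtain ⟨C, hC, hb⟩ := ih (s + 1) (by linarith)
    refine ⟨s * C, by positivity, fun A₀ A B h0 hA hB0 hB m hm => ?_⟩
    obtain ⟨m, rfl⟩ : ∃ k, m = k + 1 := ⟨m - 1, by omega⟩
    have hpos : ∀ θ, 0 < A - B * cos θ := fun θ =>
      (by positivity : 0 < A₀ / 2).trans_le (half_le_sub_mul_cos hA hB0 hB θ)
    rw [angInt_zero_succ hpos]
    have b1 := hb A₀ A B h0 hA hB0 hB m (by omega)
    have b2 := hb A₀ A B h0 hA hB0 hB (m + 2) (by omega)
    have e : s + 1 + (j : ℝ) = s + ((j + 1 : ℕ) : ℝ) := by push_cast; ring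
    rw [e] at b1 b2
    set K := C * B ^ j * A₀ ^ (-(s + ((j + 1 : ℕ) : ℝ)))
    have hK : 0 ≤ K := (abs_nonneg _).trans b1
    have b3 : |angInt A B (s + 1) 0 m - angInt A B (s + 1) 0 (m + 2)| ≤ 2 * K := by
      rw [abs_le] at *; constructor <;> linarith
    rw [abs_mul, abs_of_nonneg (by positivity : 0 ≤ s * B / (2 * (m + 1)))]
    have b4 : s * B / (2 * (m + 1)) ≤ s * B / 2 := by
      refine div_le_div_of_nonneg_left (by positivity) (by norm_num) ?_
      nlinarith [(Nat.cast_nonneg m : (0 : ℝ) ≤ m)]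
    calc _ ≤ s * B / 2 * (2 * K) := mul_le_mul b4 b3 (abs_nonneg _) (by positivity)
      _ = _ := by simp only [K, pow_succ]; ring

lemma abs_angInt_le (j l : ℕ) (s : ℝ) (hs : 0 ≤ s) : ∃ C : ℝ, 0 ≤ C ∧ ∀ A₀ A B : ℝ, 0 < A₀ →
    A₀ ≤ A → 0 ≤ B → B ≤ A₀ / 2 → ∀ m : ℕ, j + l ≤ m →
      |angInt A B s l m| ≤ C * B ^ j * A₀ ^ (-(s + j)) := by
  obtain ⟨C, hC, hb⟩ := abs_angInt_zero_le j s hs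
  refine ⟨C, hC, fun A₀ A B h0 hA hB0 hB => ?_⟩
  have hpos : ∀ θ, 0 < A - B * cos θ := fun θ =>
    (by positivity : 0 < A₀ / 2).trans_le (half_le_sub_mul_cos hA hB0 hB θ)
  induction l with
  | zero => exact fun m hm => hb A₀ A B h0 hA hB0 hB m hm
  | succ l ih =>
    intro m hm
    obtain ⟨m, rfl⟩ : ∃ k, m = k + 1 := ⟨m - 1, by omega⟩
    rw [angInt_succ_succ hpos]
    have b1 := ih m (by omega)
    have b2 := ih (m + 2) (by omega)
    rw [abs_le] at *; constructor <;> linarith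

end

/-- The first derivatives of `dsq ^ (-1/2)`, up to sign. -/
def kernGrad (δ : ℝ) (i : Fin 2) (r r' ζ θ : ℝ) : ℝ :=
  dvec r r' ζ θ i * dsq δ r r' ζ θ ^ (-(3 / 2) : ℝ)

/-- The `m`-th cosine coefficient. -/
def hat (m : ℕ) (h : ℝ → ℝ) : ℝ := ∫ θ, h θ * cos (m * θ) ∂angle

section
variable {δ r r' ζ : ℝ}

lemma dvec_sq_add_le (hδ : 0 ≤ δ) (θ : ℝ) :
    dvec r r' ζ θ 0 ^ 2 + dvec r r' ζ θ 1 ^ 2 ≤ dsq δ r r' ζ θ := by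
  simp only [dvec, dsq, Matrix.cons_val_zero, Matrix.cons_val_one]
  nlinarith [sin_sq_add_cos_sq θ, mul_nonneg (sq_nonneg r) (sq_nonneg (sin θ))]

lemma abs_dvec_mul_le (hδ : 0 ≤ δ) (i j : Fin 2) (θ : ℝ) :
    |dvec r r' ζ θ i * dvec r r' ζ θ j| ≤ dsq δ r r' ζ θ := by
  have h := dvec_sq_add_le (r := r) (r' := r') (ζ := ζ) hδ θ
  rw [abs_le]
  fin_cases i <;> fin_cases j <;> simp only [Fin.zero_eta, Fin.mk_one, Fin.isValue] <;>
    constructor <;> nlinarith [sq_nonneg (dvec r r' ζ θ 0 + dvec r r' ζ θ 1),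
      sq_nonneg (dvec r r' ζ θ 0 - dvec r r' ζ θ 1), sq_nonneg (dvec r r' ζ θ 0),
      sq_nonneg (dvec r r' ζ θ 1)]

lemma dsq_pos (hδ : 0 < δ) (θ : ℝ) : 0 < dsq δ r r' ζ θ := hδ.trans_le (le_dsq _ _ _ _ _)

lemma abs_kern_le (hδ : 0 < δ) (i j : Fin 2) (θ : ℝ) :
    |kern δ i j r r' ζ θ| ≤ 4 * dsq δ r r' ζ θ ^ (-(3 / 2) : ℝ) := by
  have h := abs_dvec_mul_le (r := r) (r' := r') (ζ := ζ) hδ.le i j θ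
  have ha := dsq_pos (r := r) (r' := r') (ζ := ζ) hδ θ
  set a := dsq δ r r' ζ θ
  have e : a * a ^ (-(5 / 2) : ℝ) = a ^ (-(3 / 2) : ℝ) := by
    rw [← rpow_one_add' ha.le (by norm_num)]; norm_num
  have h5 : 0 ≤ a ^ (-(5 / 2) : ℝ) := by positivity
  have h3 : 0 ≤ a ^ (-(3 / 2) : ℝ) := by positivity
  have h1 := mul_le_mul_of_nonneg_right h h5
  rw [e] at h1
  rw [← abs_of_nonneg h5, ← abs_mul] at h1
  unfold kern
  rw [mul_assoc 3]
  set X := dvec r r' ζ θ i * dvec r r' ζ θ j * a ^ (-(5 / 2) : ℝ)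
  rw [abs_le] at *
  split_ifs <;> constructor <;> linarith

lemma abs_kernGrad_le (hδ : 0 < δ) (i : Fin 2) (θ : ℝ) :
    |kernGrad δ i r r' ζ θ| ≤ (dsq δ r r' ζ θ)⁻¹ := by
  have h := abs_dvec_mul_le (r := r) (r' := r') (ζ := ζ) hδ.le i i θ
  have ha := dsq_pos (r := r) (r' := r') (ζ := ζ) hδ θ
  set a := dsq δ r r' ζ θ
  have h1 : |dvec r r' ζ θ i| ≤ a ^ (1 / 2 : ℝ) := by
    rw [← sqrt_eq_rpow]; refine abs_le_sqrt ?_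
    rw [sq]; exact (le_abs_self _).trans h
  rw [kernGrad, abs_mul, abs_of_nonneg (by positivity : 0 ≤ a ^ (-(3 / 2) : ℝ))]
  calc _ ≤ a ^ (1 / 2 : ℝ) * a ^ (-(3 / 2) : ℝ) :=
        mul_le_mul_of_nonneg_right h1 (by positivity)
    _ = _ := by rw [← rpow_add ha, ← rpow_neg_one]; norm_num

lemma continuous_dsq : Continuous fun θ => dsq δ r r' ζ θ := by unfold dsq; fun_prop

lemma continuous_dvec (i : Fin 2) : Continuous fun θ => dvec r r' ζ θ i := by
  fin_cases i <;> simp [dvec] <;> fun_prop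

lemma continuous_dsq_rpow (hδ : 0 < δ) (s : ℝ) : Continuous fun θ => dsq δ r r' ζ θ ^ s :=
  continuous_dsq.rpow_const fun θ => Or.inl (dsq_pos hδ θ).ne'

lemma continuous_kern_angle (hδ : 0 < δ) (i j : Fin 2) : Continuous fun θ => kern δ i j r r' ζ θ :=
  (continuous_kern hδ i j).comp (f := fun θ => (((r, r'), ζ), θ)) (by fun_prop)

lemma continuous_kernGrad_angle (hδ : 0 < δ) (i : Fin 2) :
    Continuous fun θ => kernGrad δ i r r' ζ θ :=
  (continuous_dvec i).mul (continuous_dsq_rpow hδ _)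

lemma abs_hat_le {h b : ℝ → ℝ} (m : ℕ) (hb : Continuous b) (hle : ∀ θ, |h θ| ≤ b θ) :
    |hat m h| ≤ ∫ θ in (-π)..π, b θ := by
  rw [hat, integral_angle, ← norm_eq_abs]
  refine intervalIntegral.norm_integral_le_of_norm_le (a := -π) (b := π) (μ := volume) (by linarith [pi_pos])
    (ae_of_all _ fun θ _ => ?_) (hb.intervalIntegrable (-π) π)
  rw [norm_mul, norm_eq_abs, norm_eq_abs]
  calc _ ≤ |h θ| * 1 := mul_le_mul_of_nonneg_left (abs_cos_le_one _) (abs_nonneg _)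
    _ ≤ _ := by rw [mul_one]; exact hle θ

lemma integral_inv_dsq_le (hδ : 0 < δ) {d σ : ℝ} (hd : 0 < d) (hd2 : d ^ 2 = (r - r') ^ 2 + ζ ^ 2)
    (hσ : 0 < σ) (hσ2 : σ ^ 2 ≤ 4 * (r * r')) :
    ∫ θ in (-π)..π, (dsq δ r r' ζ θ)⁻¹ ≤ π ^ 2 / (d * σ) := by
  have hπ := pi_pos
  have hder : ∀ θ : ℝ, HasDerivAt (fun θ => π / (d * σ) * arctan (σ / (π * d) * θ))
      ((d ^ 2 + (σ * θ / π) ^ 2)⁻¹) θ := by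
    intro θ
    refine (((hasDerivAt_id θ).const_mul (σ / (π * d))).arctan.const_mul (π / (d * σ))).congr_deriv ?_
    have : 0 < d ^ 2 + (σ * θ / π) ^ 2 := by positivity
    have h2 : 0 < π ^ 2 * d ^ 2 + σ ^ 2 * θ ^ 2 := by positivity
    simp only [id, mul_one]
    field_simp
  have hcont : Continuous fun θ : ℝ => (d ^ 2 + (σ * θ / π) ^ 2)⁻¹ :=
    Continuous.inv₀ (by fun_prop) fun θ => by positivity
  have h1 : ∫ θ in (-π)..π, (dsq δ r r' ζ θ)⁻¹ ≤ ∫ θ in (-π)..π, (d ^ 2 + (σ * θ / π) ^ 2)⁻¹ := by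
    refine intervalIntegral.integral_mono_on (by linarith)
      ((continuous_dsq.inv₀ fun θ => (dsq_pos hδ θ).ne').intervalIntegrable _ _)
      (hcont.intervalIntegrable _ _) fun θ hθ => ?_
    refine inv_anti₀ (by positivity) ?_
    have hc := cos_le_one_sub_mul_cos_sq (abs_le.2 hθ)
    have hrr : 0 ≤ 2 * (r * r') := by nlinarith
    have h3 := mul_le_mul_of_nonneg_left hc hrr
    have h4 : (σ * θ / π) ^ 2 ≤ 4 * (r * r') * (θ / π) ^ 2 := by
      rw [mul_div_assoc, mul_pow]
      exact mul_le_mul_of_nonneg_right hσ2 (sq_nonneg _)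
    have h5 : 2 * (r * r') * (1 - 2 / π ^ 2 * θ ^ 2) = 2 * (r * r') - 4 * (r * r') * (θ / π) ^ 2 := by
      field_simp; ring
    unfold dsq
    nlinarith
  refine h1.trans ?_
  rw [intervalIntegral.integral_eq_sub_of_hasDerivAt (fun θ _ => hder θ)
    (hcont.intervalIntegrable _ _)]
  have a1 := arctan_lt_pi_div_two (σ / (π * d) * π)
  have a2 := neg_pi_div_two_lt_arctan (σ / (π * d) * -π)
  rw [← mul_sub]
  calc _ ≤ π / (d * σ) * π := mul_le_mul_of_nonneg_left (by linarith) (by positivity)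
    _ = _ := by ring

lemma near_bounds (hδ : 0 < δ) (hr : 0 < r) (hr' : 0 < r') {d σ : ℝ} (hd : 0 < d)
    (hd2 : d ^ 2 = (r - r') ^ 2 + ζ ^ 2)
    (hσ : 0 < σ) (hσd : σ ^ 2 = r ^ 2 + r' ^ 2 + ζ ^ 2) (hσ2 : σ ^ 2 ≤ 4 * (r * r')) (m : ℕ) :
    (∀ i j, |hat m (kern δ i j r r' ζ)| ≤ 4 * π ^ 2 * 64 * (r ^ 3 * r') / (σ ^ 5 * d ^ 2)) ∧
    (∀ i, |hat m (kernGrad δ i r r' ζ)| ≤ 16 * π ^ 2 * (r * r' ^ 2) / (σ ^ 4 * d)) := by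
  have hI := integral_inv_dsq_le hδ hd hd2 hσ hσ2
  have hci : Continuous fun θ => (dsq δ r r' ζ θ)⁻¹ := continuous_dsq.inv₀ fun θ => (dsq_pos hδ θ).ne'
  have hrσ : r ≤ σ := by nlinarith [sq_nonneg r', sq_nonneg ζ]
  have hrσ' : r' ≤ σ := by nlinarith [sq_nonneg r, sq_nonneg ζ]
  have hr4 : σ ≤ 4 * r := by nlinarith
  have hr4' : σ ≤ 4 * r' := by nlinarith
  constructor
  · intro i j
    have hd3 : ∀ θ, |kern δ i j r r' ζ θ| ≤ 4 / d * (dsq δ r r' ζ θ)⁻¹ := by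
      intro θ
      refine (abs_kern_le hδ i j θ).trans ?_
      have ha := dsq_pos (r := r) (r' := r') (ζ := ζ) hδ θ
      have hda : d ^ 2 ≤ dsq δ r r' ζ θ := by
        unfold dsq
        nlinarith [cos_le_one θ, mul_pos hr hr']
      set a := dsq δ r r' ζ θ
      have e : a ^ (-(3 / 2) : ℝ) = (√a)⁻¹ * a⁻¹ := by
        rw [sqrt_eq_rpow, ← rpow_neg ha.le, ← rpow_neg_one a, ← rpow_add ha]; norm_num
      have h1 : (√a)⁻¹ ≤ d⁻¹ := inv_anti₀ hd (le_sqrt_of_sq_le hda)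
      rw [e, div_eq_mul_inv, mul_assoc]
      exact mul_le_mul_of_nonneg_left (mul_le_mul_of_nonneg_right h1 (by positivity)) (by norm_num)
    have hci4 : Continuous fun θ => 4 / d * (dsq δ r r' ζ θ)⁻¹ := by fun_prop
    refine (abs_hat_le m hci4 hd3).trans ?_
    rw [intervalIntegral.integral_const_mul]
    calc _ ≤ 4 / d * (π ^ 2 / (d * σ)) := mul_le_mul_of_nonneg_left hI (by positivity)
      _ = 4 * π ^ 2 * σ ^ 4 / (σ ^ 5 * d ^ 2) := by field_simp
      _ ≤ _ := by
        refine div_le_div_of_nonneg_right ?_ (by positivity)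
        rw [mul_assoc (4 * π ^ 2)]
        refine mul_le_mul_of_nonneg_left ?_ (by positivity)
        have : σ ^ 2 ≤ 16 * r ^ 2 := by nlinarith
        calc σ ^ 4 = σ ^ 2 * σ ^ 2 := by ring
          _ ≤ (16 * r ^ 2) * (4 * (r * r')) := mul_le_mul this hσ2 (by positivity) (by positivity)
          _ = _ := by ring
  · intro i
    refine (abs_hat_le m hci (abs_kernGrad_le hδ i)).trans (hI.trans ?_)
    calc π ^ 2 / (d * σ) = π ^ 2 * σ ^ 3 / (σ ^ 4 * d) := by field_simp
      _ ≤ _ := by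
        refine div_le_div_of_nonneg_right ?_ (by positivity)
        have : σ ^ 3 ≤ 16 * (r * r' ^ 2) := by
          calc σ ^ 3 = σ ^ 2 * σ := by ring
            _ ≤ (4 * (r * r')) * (4 * r') := mul_le_mul hσ2 hr4' (by positivity) (by positivity)
            _ = _ := by ring
        nlinarith [mul_le_mul_of_nonneg_left this (sq_nonneg π)]

lemma dsq_eq_sub_mul_cos (θ : ℝ) :
    dsq δ r r' ζ θ = (r ^ 2 + r' ^ 2 + ζ ^ 2 + δ) - (2 * r * r') * cos θ := by unfold dsq; ring

lemma hat_kern_eq (hδ : 0 < δ) (i j : Fin 2) (m : ℕ) {A B : ℝ} (hA : A = r ^ 2 + r' ^ 2 + ζ ^ 2 + δ)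
    (hB : B = 2 * r * r') :
    hat m (kern δ i j r r' ζ) =
      if i = 0 then
        if j = 0 then
          3 * r' ^ 2 * angInt A B (5 / 2) 0 m - 6 * r * r' * angInt A B (5 / 2) 1 m +
            3 * r ^ 2 * angInt A B (5 / 2) 2 m - angInt A B (3 / 2) 0 m
        else 3 * ζ * r' * angInt A B (5 / 2) 0 m - 3 * ζ * r * angInt A B (5 / 2) 1 m
      else
        if j = 0 then 3 * ζ * r' * angInt A B (5 / 2) 0 m - 3 * ζ * r * angInt A B (5 / 2) 1 m
        else 3 * ζ ^ 2 * angInt A B (5 / 2) 0 m - angInt A B (3 / 2) 0 m := by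
  have hc := fun s => continuous_dsq_rpow (r := r) (r' := r') (ζ := ζ) hδ (-s)
  have hA' : ∀ θ, dsq δ r r' ζ θ = A - B * cos θ := fun θ => by rw [dsq_eq_sub_mul_cos, hA, hB]
  simp only [hA'] at hc
  have hi : ∀ (c s : ℝ) (l : ℕ), IntervalIntegrable (fun θ => c * (cos θ ^ l * cos (m * θ) *
      (A - B * cos θ) ^ (-s))) volume (-π) π := fun c s l => by
    have := hc s
    exact Continuous.intervalIntegrable (by fun_prop) _ _
  have hi' : ∀ (s : ℝ) (l : ℕ), IntervalIntegrable (fun θ => (cos θ ^ l * cos (m * θ) *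
      (A - B * cos θ) ^ (-s))) volume (-π) π := fun s l => by
    have := hc s
    exact Continuous.intervalIntegrable (by fun_prop) _ _
  unfold hat
  rw [integral_angle]
  unfold angInt
  fin_cases i <;> fin_cases j <;> simp only [Fin.zero_eta, Fin.mk_one, Fin.isValue, if_true,
    one_ne_zero, if_false] <;> simp only [← intervalIntegral.integral_const_mul]
  · rw [← intervalIntegral.integral_sub (hi _ _ _) (hi _ _ _), ← intervalIntegral.integral_add
      ((hi _ _ _).sub (hi _ _ _)) (hi _ _ _), ← intervalIntegral.integral_sub
      (((hi _ _ _).sub (hi _ _ _)).add (hi _ _ _)) (hi' _ _)]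
    congr 1; ext θ
    simp [kern, hA', dvec]; ring
  · rw [← intervalIntegral.integral_sub (hi _ _ _) (hi _ _ _)]
    congr 1; ext θ
    simp [kern, hA', dvec]; ring
  · rw [← intervalIntegral.integral_sub (hi _ _ _) (hi _ _ _)]
    congr 1; ext θ
    simp [kern, hA', dvec]; ring
  · rw [← intervalIntegral.integral_sub (hi _ _ _) (hi' _ _)]
    congr 1; ext θ
    simp [kern, hA', dvec]; ring

lemma hat_kernGrad_eq (hδ : 0 < δ) (i : Fin 2) (m : ℕ) {A B : ℝ}
    (hA : A = r ^ 2 + r' ^ 2 + ζ ^ 2 + δ) (hB : B = 2 * r * r') :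
    hat m (kernGrad δ i r r' ζ) =
      if i = 0 then r' * angInt A B (3 / 2) 0 m - r * angInt A B (3 / 2) 1 m
      else ζ * angInt A B (3 / 2) 0 m := by
  have hc := fun s => continuous_dsq_rpow (r := r) (r' := r') (ζ := ζ) hδ (-s)
  have hA' : ∀ θ, dsq δ r r' ζ θ = A - B * cos θ := fun θ => by rw [dsq_eq_sub_mul_cos, hA, hB]
  simp only [hA'] at hc
  have hi : ∀ (c s : ℝ) (l : ℕ), IntervalIntegrable (fun θ => c * (cos θ ^ l * cos (m * θ) *
      (A - B * cos θ) ^ (-s))) volume (-π) π := fun c s l => by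
    have := hc s
    exact Continuous.intervalIntegrable (by fun_prop) _ _
  unfold hat
  rw [integral_angle]
  unfold angInt
  fin_cases i <;> simp only [Fin.zero_eta, Fin.mk_one, Fin.isValue, if_true,
    one_ne_zero, if_false] <;> simp only [← intervalIntegral.integral_const_mul]
  · rw [← intervalIntegral.integral_sub (hi _ _ _) (hi _ _ _)]
    congr 1; ext θ
    simp [kernGrad, hA', dvec]; ring
  · congr 1; ext θ
    simp [kernGrad, hA', dvec]; ring

end

lemma rpow_neg_half_eq {σ : ℝ} (hσ : 0 < σ) (n : ℕ) {s : ℝ} (hs : 2 * s = n) :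
    (σ ^ 2) ^ (-s) = (σ ^ n)⁻¹ := by
  rw [← rpow_natCast σ 2, ← rpow_mul hσ.le, ← rpow_natCast σ n, ← rpow_neg hσ.le]
  congr 1; push_cast; linarith

lemma far_bounds : ∃ C : ℝ, 0 ≤ C ∧ ∀ (δ r r' ζ σ : ℝ) (m : ℕ), 0 < δ → 0 < r → 0 < r' → 3 ≤ m →
    0 < σ → σ ^ 2 = r ^ 2 + r' ^ 2 + ζ ^ 2 → 4 * (r * r') ≤ σ ^ 2 →
    (∀ i j, |hat m (kern δ i j r r' ζ)| ≤ C * (r ^ 3 * r') / σ ^ 7) ∧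
    (∀ i, |hat m (kernGrad δ i r r' ζ)| ≤ C * (r * r' ^ 2) / σ ^ 5) := by
  obtain ⟨C1, hC1, b1⟩ := abs_angInt_le 3 0 (5 / 2) (by norm_num)
  obtain ⟨C2, hC2, b2⟩ := abs_angInt_le 2 1 (5 / 2) (by norm_num)
  obtain ⟨C3, hC3, b3⟩ := abs_angInt_le 1 2 (5 / 2) (by norm_num)
  obtain ⟨C4, hC4, b4⟩ := abs_angInt_le 3 0 (3 / 2) (by norm_num)
  obtain ⟨C5, hC5, b5⟩ := abs_angInt_le 2 0 (3 / 2) (by norm_num)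
  obtain ⟨C6, hC6, b6⟩ := abs_angInt_le 2 1 (3 / 2) (by norm_num)
  refine ⟨24 * C1 + 24 * C2 + 6 * C3 + 8 * C4 + 4 * C5 + 4 * C6, by positivity,
    fun δ r r' ζ σ m hδ hr hr' hm hσ hσ2 hfar => ?_⟩
  have hA : σ ^ 2 ≤ r ^ 2 + r' ^ 2 + ζ ^ 2 + δ := by linarith
  have hB0 : 0 ≤ 2 * r * r' := by positivity
  have hB : 2 * r * r' ≤ σ ^ 2 / 2 := by linarith
  have hσp : 0 < σ ^ 2 := by positivity
  replace b1 := b1 _ _ _ hσp hA hB0 hB m (by omega)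
  replace b2 := b2 _ _ _ hσp hA hB0 hB m (by omega)
  replace b3 := b3 _ _ _ hσp hA hB0 hB m (by omega)
  replace b4 := b4 _ _ _ hσp hA hB0 hB m (by omega)
  replace b5 := b5 _ _ _ hσp hA hB0 hB m (by omega)
  replace b6 := b6 _ _ _ hσp hA hB0 hB m (by omega)
  rw [rpow_neg_half_eq hσ 11 (by norm_num)] at b1
  rw [rpow_neg_half_eq hσ 9 (by norm_num)] at b2 b4
  rw [rpow_neg_half_eq hσ 7 (by norm_num)] at b3 b5 b6
  rw [show (2 * r * r') ^ 3 = 8 * r ^ 3 * r' ^ 3 by ring] at b1 b4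
  rw [show (2 * r * r') ^ 2 = 4 * r ^ 2 * r' ^ 2 by ring] at b2 b5 b6
  have hrσ : r ≤ σ := by nlinarith [sq_nonneg r', sq_nonneg ζ]
  have hrσ' : r' ≤ σ := by nlinarith [sq_nonneg r, sq_nonneg ζ]
  have hζσ : |ζ| ≤ σ := abs_le_of_sq_le_sq (by nlinarith [sq_nonneg r, sq_nonneg r']) hσ.le
  have hζ0 := abs_nonneg ζ
  have hm4 : ∀ a b c d : ℝ, 0 ≤ a → a ≤ σ → 0 ≤ b → b ≤ σ → 0 ≤ c → c ≤ σ → 0 ≤ d → d ≤ σ →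
      a * b ≤ σ ^ 2 ∧ a * b * c * d ≤ σ ^ 4 := by
    intro a b c d ha ha' hb hb' hc hc' hd hd'
    have h1 : a * b ≤ σ ^ 2 := by rw [sq]; exact mul_le_mul ha' hb' hb hσ.le
    have h2 : c * d ≤ σ ^ 2 := by rw [sq]; exact mul_le_mul hc' hd' hd hσ.le
    refine ⟨h1, ?_⟩
    calc a * b * c * d = (a * b) * (c * d) := by ring
      _ ≤ σ ^ 2 * σ ^ 2 := mul_le_mul h1 h2 (by positivity) (by positivity)
      _ = _ := by ring
  set K := r ^ 3 * r' / σ ^ 7 with hK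
  have hK0 : 0 ≤ K := by positivity
  set L := r * r' ^ 2 / σ ^ 5 with hL
  have hL0 : 0 ≤ L := by positivity
  have mul_bd : ∀ {c J b T : ℝ}, |J| ≤ b → |c| * b ≤ T → |c * J| ≤ T := by
    intro c J b T h1 h2
    rw [abs_mul]; exact (mul_le_mul_of_nonneg_left h1 (abs_nonneg _)).trans h2
  have q1 : ∀ X Y : ℝ, 0 ≤ X → 0 ≤ Y → X ≤ σ → Y ≤ σ →
      X * Y * (C1 * (8 * r ^ 3 * r' ^ 3) * (σ ^ 11)⁻¹) ≤ 8 * C1 * K := by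
    intro X Y hX hY hX' hY'
    have := (hm4 X Y r' r' hX hX' hY hY' hr'.le hrσ' hr'.le hrσ').2
    calc _ = 8 * C1 * (r ^ 3 * r') * (X * Y * r' * r') / σ ^ 11 := by field_simp
      _ ≤ 8 * C1 * (r ^ 3 * r') * σ ^ 4 / σ ^ 11 :=
        div_le_div_of_nonneg_right (mul_le_mul_of_nonneg_left this (by positivity)) (by positivity)
      _ = _ := by rw [hK]; field_simp
  have q2 : ∀ X : ℝ, 0 ≤ X → X ≤ σ →
      X * r * (C2 * (4 * r ^ 2 * r' ^ 2) * (σ ^ 9)⁻¹) ≤ 4 * C2 * K := by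
    intro X hX hX'
    have := (hm4 X r' r' r' hX hX' hr'.le hrσ' hr'.le hrσ' hr'.le hrσ').1
    calc _ = 4 * C2 * (r ^ 3 * r') * (X * r') / σ ^ 9 := by field_simp
      _ ≤ 4 * C2 * (r ^ 3 * r') * σ ^ 2 / σ ^ 9 :=
        div_le_div_of_nonneg_right (mul_le_mul_of_nonneg_left this (by positivity)) (by positivity)
      _ = _ := by rw [hK]; field_simp
  have q3 : r ^ 2 * (C3 * (2 * r * r') ^ 1 * (σ ^ 7)⁻¹) ≤ 2 * C3 * K := by
    rw [hK]; apply le_of_eq; field_simp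
  have q4 : C4 * (8 * r ^ 3 * r' ^ 3) * (σ ^ 9)⁻¹ ≤ 8 * C4 * K := by
    have := (hm4 r' r' r' r' hr'.le hrσ' hr'.le hrσ' hr'.le hrσ' hr'.le hrσ').1
    calc _ = 8 * C4 * (r ^ 3 * r') * (r' * r') / σ ^ 9 := by field_simp
      _ ≤ 8 * C4 * (r ^ 3 * r') * σ ^ 2 / σ ^ 9 :=
        div_le_div_of_nonneg_right (mul_le_mul_of_nonneg_left this (by positivity)) (by positivity)
      _ = _ := by rw [hK]; field_simp
  have q5 : ∀ (c X : ℝ), 0 ≤ c → 0 ≤ X → X ≤ σ →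
      X * (c * (4 * r ^ 2 * r' ^ 2) * (σ ^ 7)⁻¹) ≤ 4 * c * L := by
    intro c X hc hX hX'
    have := (hm4 X r r' r' hX hX' hr.le hrσ hr'.le hrσ' hr'.le hrσ').1
    calc _ = 4 * c * (r * r' ^ 2) * (X * r) / σ ^ 7 := by field_simp
      _ ≤ 4 * c * (r * r' ^ 2) * σ ^ 2 / σ ^ 7 :=
        div_le_div_of_nonneg_right (mul_le_mul_of_nonneg_left this (by positivity)) (by positivity)
      _ = _ := by rw [hL]; field_simp
  have t1 := mul_bd (c := 3 * r' ^ 2) (T := 24 * C1 * K) b1 (by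
    rw [abs_of_nonneg (by positivity)]; linarith [q1 r' r' hr'.le hr'.le hrσ' hrσ'])
  have t2 := mul_bd (c := 6 * r * r') (T := 24 * C2 * K) b2 (by
    rw [abs_of_nonneg (by positivity)]; linarith [q2 r' hr'.le hrσ'])
  have t3 := mul_bd (c := 3 * r ^ 2) (T := 6 * C3 * K) b3 (by
    rw [abs_of_nonneg (by positivity)]; linarith)
  have t4 := b4.trans q4
  have t5 := mul_bd (c := 3 * ζ * r') (T := 24 * C1 * K) b1 (by
    rw [abs_mul, abs_mul, abs_of_pos hr', abs_of_pos (by norm_num : (0:ℝ) < 3)]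
    linarith [q1 |ζ| r' hζ0 hr'.le hζσ hrσ'])
  have t6 := mul_bd (c := 3 * ζ * r) (T := 24 * C2 * K) b2 (by
    rw [abs_mul, abs_mul, abs_of_pos hr, abs_of_pos (by norm_num : (0:ℝ) < 3)]
    linarith [q2 |ζ| hζ0 hζσ, mul_nonneg hC2 hK0])
  have t7 := mul_bd (c := 3 * ζ ^ 2) (T := 24 * C1 * K) b1 (by
    rw [abs_mul, abs_pow, abs_of_pos (by norm_num : (0:ℝ) < 3)]
    linarith [q1 |ζ| |ζ| hζ0 hζ0 hζσ hζσ])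
  have s1 := mul_bd (c := r') (T := 4 * C5 * L) b5 (by
    rw [abs_of_pos hr']; exact q5 C5 r' hC5 hr'.le hrσ')
  have s2 := mul_bd (c := r) (T := 4 * C6 * L) b6 (by
    rw [abs_of_pos hr]; exact q5 C6 r hC6 hr.le hrσ)
  have s3 := mul_bd (c := ζ) (T := 4 * C5 * L) b5 (q5 C5 |ζ| hC5 hζ0 hζσ)
  have p1 := mul_nonneg hC1 hK0
  have p2 := mul_nonneg hC2 hK0
  have p3 := mul_nonneg hC3 hK0
  have p4 := mul_nonneg hC4 hK0
  have p5 := mul_nonneg hC5 hK0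
  have p6 := mul_nonneg hC6 hK0
  have o1 := mul_nonneg hC1 hL0
  have o2 := mul_nonneg hC2 hL0
  have o3 := mul_nonneg hC3 hL0
  have o4 := mul_nonneg hC4 hL0
  have o5 := mul_nonneg hC5 hL0
  have o6 := mul_nonneg hC6 hL0
  constructor
  · intro i j
    rw [mul_div_assoc, ← hK, hat_kern_eq hδ i j m rfl rfl]
    clear b1 b2 b3 b4 b5 b6 q1 q2 q3 q4 q5 s1 s2 s3 mul_bd hm4
    rw [abs_le] at *
    split_ifs <;> constructor <;> linarith
  · intro i
    rw [mul_div_assoc, ← hL, hat_kernGrad_eq hδ i m rfl rfl]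
    clear b1 b2 b3 b4 b5 b6 q1 q2 q3 q4 q5 t1 t2 t3 t4 t5 t6 t7 mul_bd hm4
    rw [abs_le] at *
    split_ifs <;> constructor <;> linarith

/-- Bounds on the angular Fourier coefficients of the kernels, uniform in the mode and in the
regularisation. -/
theorem exists_hat_bounds : ∃ C : ℝ, 0 ≤ C ∧ ∀ (δ r r' ζ d σ : ℝ) (m : ℕ), 0 < δ → 0 < r →
    0 < r' → 3 ≤ m → 0 < d → d ^ 2 = (r - r') ^ 2 + ζ ^ 2 → 0 < σ →
    σ ^ 2 = r ^ 2 + r' ^ 2 + ζ ^ 2 →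
    (∀ i j, |hat m (kern δ i j r r' ζ)| ≤ C * (r ^ 3 * r') / (σ ^ 5 * d ^ 2)) ∧
    (∀ i, |hat m (kernGrad δ i r r' ζ)| ≤ C * (r * r' ^ 2) / (σ ^ 4 * d)) := by
  obtain ⟨C, hC, hb⟩ := far_bounds
  refine ⟨C + 4 * π ^ 2 * 64, by positivity, fun δ r r' ζ d σ m hδ hr hr' hm hd hd2 hσ hσ2 => ?_⟩
  have hdσ : d ≤ σ := by
    refine le_of_sq_le_sq ?_ hσ.le
    nlinarith [mul_pos hr hr']
  rcases le_total (4 * (r * r')) (σ ^ 2) with h | h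
  · obtain ⟨h1, h2⟩ := hb δ r r' ζ σ m hδ hr hr' hm hσ hσ2 h
    constructor
    · intro i j
      refine (h1 i j).trans ?_
      refine div_le_div₀ (by positivity) ?_ (by positivity) ?_
      · exact mul_le_mul_of_nonneg_right (by nlinarith [sq_nonneg π]) (by positivity)
      · calc σ ^ 5 * d ^ 2 ≤ σ ^ 5 * σ ^ 2 := by gcongr
          _ = _ := by ring
    · intro i
      refine (h2 i).trans ?_
      refine div_le_div₀ (by positivity) ?_ (by positivity) ?_
      · exact mul_le_mul_of_nonneg_right (by nlinarith [sq_nonneg π]) (by positivity)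
      · calc σ ^ 4 * d ≤ σ ^ 4 * σ := by gcongr
          _ = _ := by ring
  · obtain ⟨h1, h2⟩ := near_bounds hδ hr hr' hd hd2 hσ hσ2 h m
    constructor
    · intro i j
      refine (h1 i j).trans (div_le_div_of_nonneg_right ?_ (by positivity))
      exact mul_le_mul_of_nonneg_right (by linarith) (by positivity)
    · intro i
      refine (h2 i).trans (div_le_div_of_nonneg_right ?_ (by positivity))
      exact mul_le_mul_of_nonneg_right (by nlinarith [sq_nonneg π]) (by positivity)

lemma lintegral_comp_mul_left {a : ℝ} (ha : 0 < a) {H : ℝ → ENNReal} (hH : Measurable H) :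
    ∫⁻ x, H x = ENNReal.ofReal a * ∫⁻ t, H (a * t) := by
  conv_lhs => rw [← Real.smul_map_volume_mul_left ha.ne']
  rw [lintegral_smul_measure, lintegral_map hH (measurable_const_mul a), abs_of_pos ha,
    smul_eq_mul]

lemma setLIntegral_Ioi_comp_mul_left {a : ℝ} (ha : 0 < a) {H : ℝ → ENNReal} (hH : Measurable H) :
    ∫⁻ x in Ioi 0, H x = ENNReal.ofReal a * ∫⁻ t in Ioi 0, H (a * t) := by
  rw [← lintegral_indicator measurableSet_Ioi, ← lintegral_indicator measurableSet_Ioi,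
    lintegral_comp_mul_left ha (hH.indicator measurableSet_Ioi)]
  congr 1
  refine lintegral_congr fun t => ?_
  by_cases ht : 0 < t
  · rw [indicator_of_mem (by exact mul_pos ha ht), indicator_of_mem (by exact ht)]
  · rw [indicator_of_notMem, indicator_of_notMem]
    · simpa using ht
    · simpa using mul_nonpos_of_nonneg_of_nonpos ha.le (not_lt.1 ht)

/-- A kernel dominating the commutator of `r ^ γ` with the singular operators. -/
def errKer (γ r r' ζ : ℝ) : ℝ :=
  (r / r') ^ γ * (r * r') / ((r ^ 2 + r' ^ 2 + ζ ^ 2) ^ 2 * √((r - r') ^ 2 + ζ ^ 2))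

/-- The profile of the homogeneous kernel `errKer`. -/
def errProf (γ t η : ℝ) : ℝ :=
  t ^ (2 - γ) / ((1 + t ^ 2 + η ^ 2) ^ 2 * √((1 - t) ^ 2 + η ^ 2))

lemma measurable_errKer (γ : ℝ) :
    Measurable fun x : ℝ × ℝ × ℝ => errKer γ x.1 x.2.1 x.2.2 := by
  unfold errKer; fun_prop

lemma measurable_errProf (γ : ℝ) : Measurable fun x : ℝ × ℝ => errProf γ x.1 x.2 := by
  unfold errProf; fun_prop

lemma errKer_scale (γ : ℝ) {r t : ℝ} (hr : 0 < r) (ht : 0 < t) (η : ℝ) :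
    r * (r * ((r * t) * errKer γ r (r * t) (r * η))) = errProf γ t η := by
  unfold errKer errProf
  have h1 : (r / (r * t)) ^ γ = t ^ (-γ) := by
    rw [show r / (r * t) = t⁻¹ by field_simp, inv_rpow ht.le, rpow_neg ht.le]
  have h2 : √((r - r * t) ^ 2 + (r * η) ^ 2) = r * √((1 - t) ^ 2 + η ^ 2) := by
    rw [show (r - r * t) ^ 2 + (r * η) ^ 2 = r ^ 2 * ((1 - t) ^ 2 + η ^ 2) by ring,
      sqrt_mul (by positivity), sqrt_sq hr.le]
  rw [h1, h2, show r ^ 2 + (r * t) ^ 2 + (r * η) ^ 2 = r ^ 2 * (1 + t ^ 2 + η ^ 2) by ring,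
    show 2 - γ = -γ + 2 by ring, rpow_add ht, rpow_two]
  have : 0 < 1 + t ^ 2 + η ^ 2 := by positivity
  by_cases h : √((1 - t) ^ 2 + η ^ 2) = 0
  · simp [h]
  · field_simp

lemma lintegral_errKer (γ : ℝ) {G : ℝ × ℝ → ENNReal} (hG : Measurable G) {r : ℝ} (hr : 0 < r)
    (z : ℝ) :
    ∫⁻ v, ENNReal.ofReal (errKer γ r v.1 (v.2 - z)) * G v ∂halfPlane
      = ∫⁻ x, ENNReal.ofReal (errProf γ x.1 x.2) * G (r * x.1, z + r * x.2)
          ∂((volume.restrict (Ioi 0)).prod volume) := by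
  have hk := measurable_errKer γ
  have hK : Measurable fun v : ℝ × ℝ => ENNReal.ofReal (errKer γ r v.1 (v.2 - z)) * G v :=
    (ENNReal.measurable_ofReal.comp (hk.comp (by fun_prop :
      Measurable fun v : ℝ × ℝ => (r, v.1, v.2 - z)))).mul hG
  have hP : Measurable fun x : ℝ × ℝ =>
      ENNReal.ofReal (errProf γ x.1 x.2) * G (r * x.1, z + r * x.2) :=
    (ENNReal.measurable_ofReal.comp (measurable_errProf γ)).mul (hG.comp (by fun_prop))
  have hK2 : Measurable fun x : ℝ × ℝ => ENNReal.ofReal x.1 *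
      (ENNReal.ofReal (errKer γ r x.1 (x.2 - z)) * G (x.1, x.2)) :=
    (ENNReal.measurable_ofReal.comp measurable_fst).mul hK
  rw [lintegral_halfPlane hK, lintegral_prod _ hP.aemeasurable,
    setLIntegral_Ioi_comp_mul_left hr (Measurable.lintegral_prod_right hK2),
    ← lintegral_const_mul' _ _ ENNReal.ofReal_ne_top]
  refine setLIntegral_congr_fun measurableSet_Ioi fun t ht => ?_
  have ht' : 0 < t := ht
  have hK3 : Measurable fun y : ℝ => ENNReal.ofReal (r * t) *
      (ENNReal.ofReal (errKer γ r (r * t) (y - z)) * G (r * t, y)) :=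
    hK2.comp (by fun_prop : Measurable fun y : ℝ => (r * t, y))
  dsimp only
  have hK4 : Measurable fun y : ℝ => ENNReal.ofReal (r * t) *
      (ENNReal.ofReal (errKer γ r (r * t) (z + y - z)) * G (r * t, z + y)) :=
    hK3.comp (measurable_const_add z)
  rw [← lintegral_add_left_eq_self _ z, lintegral_comp_mul_left hr hK4, ← lintegral_const_mul' _ _ ENNReal.ofReal_ne_top,
    ← lintegral_const_mul' _ _ ENNReal.ofReal_ne_top]
  refine lintegral_congr fun η => ?_
  rw [← errKer_scale γ hr ht' η, add_sub_cancel_left,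
    ENNReal.ofReal_mul (q := r * (r * t * errKer γ r (r * t) (r * η))) hr.le,
    ENNReal.ofReal_mul (q := r * t * errKer γ r (r * t) (r * η)) hr.le,
    ENNReal.ofReal_mul (q := errKer γ r (r * t) (r * η)) (mul_nonneg hr.le ht'.le)]
  ring

lemma lintegral_halfPlane_dilate {G : ℝ × ℝ → ENNReal} (hG : Measurable G) {t : ℝ} (ht : 0 < t)
    (η : ℝ) :
    ENNReal.ofReal t ^ 2 * ∫⁻ w, G (w.1 * t, w.2 + w.1 * η) ∂halfPlane
      = ∫⁻ w, G w ∂halfPlane := by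
  have h1 : Measurable fun w : ℝ × ℝ => G (w.1 * t, w.2 + w.1 * η) := hG.comp (by fun_prop)
  have h2 : Measurable fun w : ℝ × ℝ => ENNReal.ofReal w.1 * G (w.1, w.2) := by fun_prop
  have h3 : Measurable fun r : ℝ => ∫⁻ z, ENNReal.ofReal r * G (r, z) :=
    Measurable.lintegral_prod_right h2
  rw [lintegral_halfPlane h1, lintegral_halfPlane hG, setLIntegral_Ioi_comp_mul_left ht h3, sq, mul_assoc,
    ← lintegral_const_mul' _ _ ENNReal.ofReal_ne_top]
  congr 1
  refine setLIntegral_congr_fun measurableSet_Ioi fun r hr => ?_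
  dsimp only
  rw [lintegral_add_right_eq_self (fun y => ENNReal.ofReal r * G (r * t, y)) (r * η),
    ← lintegral_const_mul' _ _ ENNReal.ofReal_ne_top]
  refine lintegral_congr fun z => ?_
  rw [ENNReal.ofReal_mul ht.le, mul_comm r t, mul_assoc]

lemma lintegral_errKer_rpow_le (γ : ℝ) {p : ℝ} (hp : 1 < p) {G : ℝ × ℝ → ENNReal}
    (hG : Measurable G) :
    ∫⁻ w, (∫⁻ v, ENNReal.ofReal (errKer γ w.1 v.1 (v.2 - w.2)) * G v ∂halfPlane) ^ p ∂halfPlane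
      ≤ (∫⁻ x, ENNReal.ofReal (errProf γ x.1 x.2 * x.1 ^ (-(2 / p)))
          ∂((volume.restrict (Ioi 0)).prod volume)) ^ p * ∫⁻ w, G w ^ p ∂halfPlane := by
  set ν : Measure (ℝ × ℝ) := (volume.restrict (Ioi 0)).prod volume with hν
  have hp0 : 0 < p := by linarith
  have hpq : p.HolderConjugate (p / (p - 1)) := Real.HolderConjugate.conjExponent hp
  have hk : Measurable fun x : ℝ × ℝ => ENNReal.ofReal (errProf γ x.1 x.2 * x.1 ^ (-(2 / p))) :=
    ENNReal.measurable_ofReal.comp ((measurable_errProf γ).mul (by fun_prop))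
  set k := fun x : ℝ × ℝ => ENNReal.ofReal (errProf γ x.1 x.2 * x.1 ^ (-(2 / p))) with hkd
  set N := ∫⁻ x, k x ∂ν with hN
  have hpos : ∀ᵐ x ∂ν, 0 < x.1 := by
    have : ∀ᵐ t ∂(volume.restrict (Ioi (0 : ℝ))), 0 < t := ae_restrict_mem measurableSet_Ioi
    exact Measure.quasiMeasurePreserving_fst.ae this
  have hGp : Measurable fun x : ℝ × ℝ => G x ^ p := hG.pow_const p
  have hbig : Measurable fun y : (ℝ × ℝ) × (ℝ × ℝ) => k y.2 * (ENNReal.ofReal y.2.1 ^ 2 *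
      G (y.1.1 * y.2.1, y.1.2 + y.1.1 * y.2.2) ^ p) :=
    (hk.comp measurable_snd).mul ((by fun_prop : Measurable fun y : (ℝ × ℝ) × (ℝ × ℝ) =>
      ENNReal.ofReal y.2.1 ^ 2).mul (hGp.comp (by fun_prop)))
  have hpt : ∀ᵐ w ∂halfPlane,
      (∫⁻ v, ENNReal.ofReal (errKer γ w.1 v.1 (v.2 - w.2)) * G v ∂halfPlane) ^ p
      ≤ N ^ (p - 1) * ∫⁻ x, k x * (ENNReal.ofReal x.1 ^ 2 *
        G (w.1 * x.1, w.2 + w.1 * x.2) ^ p) ∂ν := by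
    filter_upwards [ae_halfPlane] with w hw
    rw [lintegral_errKer γ hG hw]
    have hh : Measurable fun x : ℝ × ℝ => ENNReal.ofReal (x.1 ^ (2 / p)) *
        G (w.1 * x.1, w.2 + w.1 * x.2) :=
      (by fun_prop : Measurable fun x : ℝ × ℝ => ENNReal.ofReal (x.1 ^ (2 / p))).mul
        (hG.comp (by fun_prop))
    have e1 : ∫⁻ x, ENNReal.ofReal (errProf γ x.1 x.2) * G (w.1 * x.1, w.2 + w.1 * x.2) ∂ν
        = ∫⁻ x, ENNReal.ofReal (x.1 ^ (2 / p)) * G (w.1 * x.1, w.2 + w.1 * x.2)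
          ∂(ν.withDensity k) := by
      rw [lintegral_withDensity_eq_lintegral_mul _ hk hh]
      refine lintegral_congr_ae ?_
      filter_upwards [hpos] with x hx
      simp only [Pi.mul_apply, hkd]
      rw [← mul_assoc, ← ENNReal.ofReal_mul' (rpow_nonneg hx.le _), mul_assoc, ← rpow_add hx]
      simp
    have e2 : ∫⁻ x, k x * (ENNReal.ofReal x.1 ^ 2 * G (w.1 * x.1, w.2 + w.1 * x.2) ^ p) ∂ν
        = ∫⁻ x, (ENNReal.ofReal (x.1 ^ (2 / p)) * G (w.1 * x.1, w.2 + w.1 * x.2)) ^ p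
          ∂(ν.withDensity k) := by
      rw [lintegral_withDensity_eq_lintegral_mul _ hk (hh.pow_const p)]
      refine lintegral_congr_ae ?_
      filter_upwards [hpos] with x hx
      simp only [Pi.mul_apply]
      rw [ENNReal.mul_rpow_of_nonneg _ _ hp0.le, ENNReal.ofReal_rpow_of_pos (rpow_pos_of_pos hx _),
        ← rpow_mul hx.le, div_mul_cancel₀ _ hp0.ne', rpow_two, ENNReal.ofReal_pow hx.le]
    rw [e1, e2]
    have hol := ENNReal.lintegral_mul_le_Lp_mul_Lq (ν.withDensity k) hpq hh.aemeasurable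
      (aemeasurable_const (b := (1 : ENNReal)))
    simp only [Pi.mul_apply, mul_one, ENNReal.one_rpow, lintegral_const, one_mul] at hol
    have hNu : (ν.withDensity k) univ = N := by
      rw [withDensity_apply _ MeasurableSet.univ, Measure.restrict_univ]
    rw [hNu] at hol
    refine (ENNReal.rpow_le_rpow hol hp0.le).trans (le_of_eq ?_)
    rw [ENNReal.mul_rpow_of_nonneg _ _ hp0.le, ← ENNReal.rpow_mul, ← ENNReal.rpow_mul,
      one_div_mul_cancel hp0.ne', ENNReal.rpow_one, mul_comm]
    congr 2
    have : p - 1 ≠ 0 := by linarith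
    field_simp
  refine (lintegral_mono_ae hpt).trans ?_
  have hin : Measurable fun w : ℝ × ℝ => ∫⁻ x, k x * (ENNReal.ofReal x.1 ^ 2 *
        G (w.1 * x.1, w.2 + w.1 * x.2) ^ p) ∂ν := Measurable.lintegral_prod_right hbig
  rw [lintegral_const_mul _ hin, lintegral_lintegral_swap hbig.aemeasurable]
  have e3 : ∫⁻ x, ∫⁻ w, k x * (ENNReal.ofReal x.1 ^ 2 *
        G (w.1 * x.1, w.2 + w.1 * x.2) ^ p) ∂halfPlane ∂ν
      = ∫⁻ x, k x * (∫⁻ w, G w ^ p ∂halfPlane) ∂ν := by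
    refine lintegral_congr_ae ?_
    filter_upwards [hpos] with x hx
    have hm : Measurable fun w : ℝ × ℝ => G (w.1 * x.1, w.2 + w.1 * x.2) ^ p :=
      hGp.comp (by fun_prop)
    rw [lintegral_const_mul _ (by fun_prop), lintegral_const_mul _ hm,
      lintegral_halfPlane_dilate hGp hx x.2]
  rw [e3, lintegral_mul_const _ hk, ← mul_assoc]
  refine le_of_eq ?_
  congr 1
  calc N ^ (p - 1) * N = N ^ (p - 1) * N ^ (1 : ℝ) := by rw [ENNReal.rpow_one]
    _ = N ^ (p - 1 + 1) := (ENNReal.rpow_add_of_nonneg _ _ (by linarith) zero_le_one).symm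
    _ = N ^ p := by rw [sub_add_cancel]

lemma intervalIntegrable_abs_rpow_neg_half (a b c : ℝ) :
    IntervalIntegrable (fun x => |x - c| ^ (-(1 / 2) : ℝ)) volume a b := by
  have h0 : ∀ a b, IntervalIntegrable (fun x : ℝ => |x| ^ (-(1 / 2) : ℝ)) volume a b := by
    intro a b
    have h1 : ∀ a b : ℝ, IntervalIntegrable (fun x : ℝ => x ^ (-(1 / 2) : ℝ)) volume a b :=
      fun a b => intervalIntegral.intervalIntegrable_rpow' (by norm_num)
    have h2 : IntervalIntegrable (fun x : ℝ => (-x) ^ (-(1 / 2) : ℝ)) volume a b := by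
      have := (IntervalIntegrable.iff_comp_neg (f := fun x : ℝ => x ^ (-(1 / 2) : ℝ))
        (a := -a) (b := -b)).1 (h1 _ _)
      simpa using this
    have hneg : ∀ x : ℝ, x < 0 → x ^ (-(1 / 2) : ℝ) = 0 := by
      intro x hx
      rw [rpow_def_of_neg hx, show (-(1 / 2) : ℝ) * π = -(π / 2) by ring, cos_neg, cos_pi_div_two,
        mul_zero]
    refine ((h1 a b).add h2).congr fun x _ => ?_
    rcases lt_trichotomy x 0 with hx | hx | hx
    · simp only [hneg x hx, abs_of_neg hx, zero_add]
    · subst hx; norm_num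
    · simp only [hneg (-x) (by linarith), abs_of_pos hx, add_zero]
  simpa using (h0 (a - c) (b - c)).comp_sub_right c

lemma inv_sqrt_add_sq_le {x y : ℝ} (hx : x ≠ 0) (hy : y ≠ 0) :
    (√(x ^ 2 + y ^ 2))⁻¹ ≤ |x| ^ (-(1 / 2) : ℝ) * |y| ^ (-(1 / 2) : ℝ) := by
  have hx' := abs_pos.2 hx
  have hy' := abs_pos.2 hy
  rw [← mul_rpow hx'.le hy'.le, rpow_neg (by positivity), ← sqrt_eq_rpow]
  refine inv_anti₀ (sqrt_pos.2 (by positivity)) (sqrt_le_sqrt ?_)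
  nlinarith [sq_nonneg (|x| - |y|), sq_abs x, sq_abs y]

lemma integrable_errProf_fiber :
    Integrable fun η : ℝ => (1 + η ^ 2) ^ (-(3 / 4) : ℝ) * |η| ^ (-(1 / 2) : ℝ) := by
  have h1 : Integrable fun η : ℝ => (1 + η ^ 2) ^ (-(3 / 4) : ℝ) := by
    have := integrable_rpow_neg_one_add_norm_sq (E := ℝ) (μ := volume) (r := 3 / 2) (by norm_num)
    refine this.congr (Filter.Eventually.of_forall fun η => ?_)
    simp only [norm_eq_abs, sq_abs]; norm_num
  have h2 : Integrable ((Icc (-1 : ℝ) 1).indicator fun η : ℝ => |η| ^ (-(1 / 2) : ℝ)) := by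
    rw [integrable_indicator_iff measurableSet_Icc]
    have := intervalIntegrable_abs_rpow_neg_half (-1) 1 0
    rw [intervalIntegrable_iff_integrableOn_Icc_of_le (by norm_num)] at this
    simpa using this
  refine (h1.add h2).mono' (by fun_prop) (Filter.Eventually.of_forall fun η => ?_)
  have p1 : 0 ≤ (1 + η ^ 2) ^ (-(3 / 4) : ℝ) := by positivity
  have p2 : 0 ≤ |η| ^ (-(1 / 2) : ℝ) := by positivity
  rw [norm_of_nonneg (by positivity), Pi.add_apply]
  by_cases h : η ∈ Icc (-1 : ℝ) 1
  · rw [indicator_of_mem h]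
    have : (1 + η ^ 2) ^ (-(3 / 4) : ℝ) ≤ 1 :=
      rpow_le_one_of_one_le_of_nonpos (by nlinarith) (by norm_num)
    nlinarith
  · rw [indicator_of_notMem h, add_zero]
    have h3 : 1 ≤ |η| := by
      by_contra h4
      exact h (abs_le.1 (not_le.1 h4).le)
    have : |η| ^ (-(1 / 2) : ℝ) ≤ 1 := rpow_le_one_of_one_le_of_nonpos h3 (by norm_num)
    nlinarith

lemma integrableOn_errProf_base {a : ℝ} (ha : -1 < a) (ha' : a < 2) :
    IntegrableOn (fun t : ℝ => t ^ a * (1 + t ^ 2) ^ (-(5 / 4) : ℝ) * |t - 1| ^ (-(1 / 2) : ℝ))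
      (Ioi 0) := by
  have hmeas : ∀ s : Set ℝ, AEStronglyMeasurable
      (fun t : ℝ => t ^ a * (1 + t ^ 2) ^ (-(5 / 4) : ℝ) * |t - 1| ^ (-(1 / 2) : ℝ))
      (volume.restrict s) := fun s => by fun_prop
  have q1 : ∀ t : ℝ, (1 + t ^ 2) ^ (-(5 / 4) : ℝ) ≤ 1 := fun t =>
    rpow_le_one_of_one_le_of_nonpos (by nlinarith) (by norm_num)
  have e : (Ioi 0 : Set ℝ) = (Ioc 0 (1 / 2) ∪ Ioc (1 / 2) 2) ∪ Ioi 2 := by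
    rw [Ioc_union_Ioc_eq_Ioc (by norm_num) (by norm_num), Ioc_union_Ioi_eq_Ioi (by norm_num)]
  rw [e]
  refine IntegrableOn.union (IntegrableOn.union ?_ ?_) ?_
  · have := intervalIntegral.intervalIntegrable_rpow' (a := 0) (b := 1 / 2) ha
    rw [intervalIntegrable_iff_integrableOn_Ioc_of_le (by norm_num)] at this
    refine (this.const_mul 2).mono' (hmeas _) ((ae_restrict_mem measurableSet_Ioc).mono
      fun t ht => ?_)
    have h0 : 0 < t := ht.1
    have p1 : 0 ≤ (1 + t ^ 2) ^ (-(5 / 4) : ℝ) := by positivity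
    have p2 : 0 ≤ |t - 1| ^ (-(1 / 2) : ℝ) := by positivity
    have p3 : 0 ≤ t ^ a := by positivity
    rw [norm_of_nonneg (by positivity)]
    have q2 : |t - 1| ^ (-(1 / 2) : ℝ) ≤ 2 := by
      have h1 : (1 / 4 : ℝ) ≤ |t - 1| := by
        rw [abs_of_nonpos (by linarith [ht.2])]; linarith [ht.2]
      refine (rpow_le_rpow_of_nonpos (by norm_num) h1 (by norm_num)).trans (le_of_eq ?_)
      rw [rpow_neg (by norm_num), ← sqrt_eq_rpow, show (1 / 4 : ℝ) = (1 / 2) ^ 2 by norm_num,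
        sqrt_sq (by norm_num)]
      norm_num
    calc _ ≤ t ^ a * 1 * 2 := by gcongr; exact q1 t
      _ = 2 * t ^ a := by ring
  · have := intervalIntegrable_abs_rpow_neg_half (1 / 2) 2 1
    rw [intervalIntegrable_iff_integrableOn_Ioc_of_le (by norm_num)] at this
    refine (this.const_mul 4).mono' (hmeas _) ((ae_restrict_mem measurableSet_Ioc).mono
      fun t ht => ?_)
    have h0 : 0 < t := by linarith [ht.1]
    have p1 : 0 ≤ (1 + t ^ 2) ^ (-(5 / 4) : ℝ) := by positivity
    have p2 : 0 ≤ |t - 1| ^ (-(1 / 2) : ℝ) := by positivity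
    have p3 : 0 ≤ t ^ a := by positivity
    rw [norm_of_nonneg (by positivity)]
    have q2 : t ^ a ≤ 4 := by
      rcases le_total t 1 with h | h
      · refine (rpow_le_rpow_of_exponent_ge h0 h ha.le).trans ?_
        rw [rpow_neg_one]
        refine (inv_anti₀ (by norm_num) ht.1.le).trans (by norm_num)
      · refine (rpow_le_rpow_of_exponent_le h ha'.le).trans ?_
        rw [rpow_two]; nlinarith [ht.2]
    calc _ ≤ 4 * 1 * |t - 1| ^ (-(1 / 2) : ℝ) := by gcongr; exact q1 t
      _ = 4 * |t - 1| ^ (-(1 / 2) : ℝ) := by ring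
  · have := integrableOn_Ioi_rpow_of_lt (show a - 3 < -1 by linarith) (show (0 : ℝ) < 2 by norm_num)
    refine (this.const_mul 2).mono' (hmeas _) ((ae_restrict_mem measurableSet_Ioi).mono
      fun t ht => ?_)
    have h2 : 2 < t := ht
    have h0 : 0 < t := by linarith
    have p1 : 0 ≤ (1 + t ^ 2) ^ (-(5 / 4) : ℝ) := by positivity
    have p2 : 0 ≤ |t - 1| ^ (-(1 / 2) : ℝ) := by positivity
    have p3 : 0 ≤ t ^ a := by positivity
    rw [norm_of_nonneg (by positivity)]
    have q2 : |t - 1| ^ (-(1 / 2) : ℝ) ≤ 2 * t ^ (-(1 / 2) : ℝ) := by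
      have h1 : 1 / 4 * t ≤ |t - 1| := by rw [abs_of_pos (by linarith)]; linarith
      refine (rpow_le_rpow_of_nonpos (by positivity) h1 (by norm_num)).trans (le_of_eq ?_)
      rw [mul_rpow (by norm_num) h0.le]
      congr 1
      rw [rpow_neg (by norm_num), ← sqrt_eq_rpow, show (1 / 4 : ℝ) = (1 / 2) ^ 2 by norm_num,
        sqrt_sq (by norm_num)]
      norm_num
    have q3 : (1 + t ^ 2) ^ (-(5 / 4) : ℝ) ≤ t ^ (-(5 / 2) : ℝ) := by
      refine (rpow_le_rpow_of_nonpos (by positivity) (show t ^ 2 ≤ 1 + t ^ 2 by linarith)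
        (by norm_num)).trans (le_of_eq ?_)
      rw [← rpow_natCast, ← rpow_mul h0.le]; norm_num
    calc _ ≤ t ^ a * t ^ (-(5 / 2) : ℝ) * (2 * t ^ (-(1 / 2) : ℝ)) := by gcongr
      _ = 2 * t ^ (a - 3) := by
        rw [show a - 3 = a + -(5 / 2) + -(1 / 2) by ring, rpow_add h0, rpow_add h0]; ring

lemma lintegral_errProf_lt_top {γ p : ℝ} (h1 : -1 < 2 - γ - 2 / p) (h2 : 2 - γ - 2 / p < 2) :
    ∫⁻ x, ENNReal.ofReal (errProf γ x.1 x.2 * x.1 ^ (-(2 / p)))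
      ∂((volume.restrict (Ioi 0)).prod volume) < ⊤ := by
  have hI := (integrableOn_errProf_base h1 h2).integrable.mul_prod integrable_errProf_fiber
  refine lt_of_le_of_lt (lintegral_mono_ae ?_) hI.lintegral_lt_top
  have c1 : ∀ᵐ t ∂(volume.restrict (Ioi (0 : ℝ))), 0 < t ∧ t ≠ 1 :=
    (ae_restrict_mem measurableSet_Ioi).and (ae_restrict_of_ae (Measure.ae_ne volume 1))
  have c2 : ∀ᵐ η ∂(volume : Measure ℝ), η ≠ 0 := Measure.ae_ne volume 0
  filter_upwards [Measure.quasiMeasurePreserving_fst.ae c1,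
    Measure.quasiMeasurePreserving_snd.ae c2] with x hx hx2
  obtain ⟨t, η⟩ := x
  obtain ⟨ht, ht1⟩ := hx
  dsimp only at *
  refine ENNReal.ofReal_le_ofReal ?_
  have b1 := inv_sqrt_add_sq_le (sub_ne_zero.2 ht1) hx2
  have b2 : ((1 + t ^ 2 + η ^ 2) ^ 2)⁻¹ ≤ (1 + t ^ 2) ^ (-(5 / 4) : ℝ) *
      (1 + η ^ 2) ^ (-(3 / 4) : ℝ) := by
    have hs : 0 < 1 + t ^ 2 + η ^ 2 := by positivity
    calc ((1 + t ^ 2 + η ^ 2) ^ 2)⁻¹ = (1 + t ^ 2 + η ^ 2) ^ (-(5 / 4) : ℝ) *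
        (1 + t ^ 2 + η ^ 2) ^ (-(3 / 4) : ℝ) := by
          rw [← rpow_add hs, ← rpow_natCast, ← rpow_neg hs.le]; norm_num
      _ ≤ _ := by
          refine mul_le_mul (rpow_le_rpow_of_nonpos (by positivity) (by nlinarith) (by norm_num))
            (rpow_le_rpow_of_nonpos (by positivity) (by nlinarith) (by norm_num))
            (by positivity) (by positivity)
  unfold errProf
  rw [show (1 - t) ^ 2 = (t - 1) ^ 2 by ring, div_eq_mul_inv, mul_inv,
    show 2 - γ - 2 / p = 2 - γ + -(2 / p) by ring, rpow_add ht]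
  have b3 := mul_le_mul b2 b1 (by positivity) (by positivity)
  have p1 : 0 ≤ t ^ (2 - γ) * t ^ (-(2 / p)) := by positivity
  have b4 := mul_le_mul_of_nonneg_left b3 p1
  refine le_trans (le_of_eq ?_) (b4.trans (le_of_eq ?_)) <;> ring

lemma exists_lintegral_errKer_rpow_le {γ p : ℝ} (hp : 1 < p) (h1 : -1 < 2 - γ - 2 / p)
    (h2 : 2 - γ - 2 / p < 2) : ∃ C : ℝ, 0 ≤ C ∧ ∀ G : ℝ × ℝ → ENNReal, Measurable G →
      ∫⁻ w, (∫⁻ v, ENNReal.ofReal (errKer γ w.1 v.1 (v.2 - w.2)) * G v ∂halfPlane) ^ p ∂halfPlane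
        ≤ ENNReal.ofReal C * ∫⁻ w, G w ^ p ∂halfPlane := by
  have hN := lintegral_errProf_lt_top h1 h2
  refine ⟨((∫⁻ x, ENNReal.ofReal (errProf γ x.1 x.2 * x.1 ^ (-(2 / p)))
      ∂((volume.restrict (Ioi 0)).prod volume)) ^ p).toReal, ENNReal.toReal_nonneg,
    fun G hG => ?_⟩
  rw [ENNReal.ofReal_toReal (ENNReal.rpow_lt_top_of_nonneg (by linarith) hN.ne).ne]
  exact lintegral_errKer_rpow_le γ hp hG

/-- The coordinate directions of the half plane. -/
def hpAxis (i : Fin 2) : ℝ × ℝ := if i = 0 then (1, 0) else (0, 1)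

/-- Partial derivatives on the half plane. -/
def pd (i : Fin 2) (u : ℝ × ℝ → ℝ) (v : ℝ × ℝ) : ℝ := fderiv ℝ u v (hpAxis i)

lemma hasLineDerivAt_axis_zero {N : ℝ × ℝ → ℝ} {N' : ℝ} {v : ℝ × ℝ}
    (h : HasDerivAt (fun x => N (x, v.2)) N' v.1) : HasLineDerivAt ℝ N N' v (hpAxis 0) := by
  have h' : HasDerivAt (fun x => N (x, v.2)) N' (v.1 + 0) := by rwa [add_zero]
  have := h'.comp_const_add v.1 0
  refine this.congr_of_eventuallyEq (Filter.Eventually.of_forall fun t => ?_)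
  simp [hpAxis, Prod.add_def]

lemma hasLineDerivAt_axis_one {N : ℝ × ℝ → ℝ} {N' : ℝ} {v : ℝ × ℝ}
    (h : HasDerivAt (fun x => N (v.1, x)) N' v.2) : HasLineDerivAt ℝ N N' v (hpAxis 1) := by
  have h' : HasDerivAt (fun x => N (v.1, x)) N' (v.2 + 0) := by rwa [add_zero]
  have := h'.comp_const_add v.2 0
  refine this.congr_of_eventuallyEq (Filter.Eventually.of_forall fun t => ?_)
  simp [hpAxis, Prod.add_def]

lemma hasDerivAt_fst_of_differentiable {u : ℝ × ℝ → ℝ} (hu : Differentiable ℝ u) (x y : ℝ) :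
    HasDerivAt (fun s => u (s, y)) (pd 0 u (x, y)) x := by
  have h1 : HasDerivAt (fun s : ℝ => (s, y)) ((1 : ℝ), (0 : ℝ)) x :=
    (hasDerivAt_id x).prodMk (hasDerivAt_const x y)
  exact (hu (x, y)).hasFDerivAt.comp_hasDerivAt x h1

lemma hasDerivAt_snd_of_differentiable {u : ℝ × ℝ → ℝ} (hu : Differentiable ℝ u) (x y : ℝ) :
    HasDerivAt (fun s => u (x, s)) (pd 1 u (x, y)) y := by
  have h1 : HasDerivAt (fun s : ℝ => (x, s)) ((0 : ℝ), (1 : ℝ)) y :=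
    (hasDerivAt_const y x).prodMk (hasDerivAt_id y)
  exact (hu (x, y)).hasFDerivAt.comp_hasDerivAt y h1

lemma contDiff_pd {u : ℝ × ℝ → ℝ} (hu : ContDiff ℝ (⊤ : ℕ∞) u) (i : Fin 2) :
    ContDiff ℝ (⊤ : ℕ∞) (pd i u) :=
  (hu.fderiv_right (by simp)).clm_apply contDiff_const

lemma hasCompactSupport_pd {u : ℝ × ℝ → ℝ} (hu : HasCompactSupport u) (i : Fin 2) :
    HasCompactSupport (pd i u) :=
  hu.fderiv_apply ℝ (hpAxis i)

lemma integral_pd_mul {u N N' : ℝ × ℝ → ℝ} (hu : ContDiff ℝ (⊤ : ℕ∞) u)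
    (hs : HasCompactSupport u) {i : Fin 2} (hN : Continuous N) (hN' : Continuous N')
    (h : ∀ v, HasLineDerivAt ℝ N (N' v) v (hpAxis i)) :
    ∫ v, pd i u v * N v = - ∫ v, u v * N' v := by
  have hsp := hasCompactSupport_pd hs i
  have cp := (contDiff_pd hu i).continuous
  have key := integral_bilinear_hasLineDerivAt_right_eq_neg_left_of_integrable
    (μ := (volume : Measure (ℝ × ℝ))) (f := N) (f' := N') (g := u) (g' := pd i u) (v := hpAxis i)
    (B := ContinuousLinearMap.mul ℝ ℝ)
    ((hN'.mul hu.continuous).integrable_of_hasCompactSupport hs.mul_left)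
    ((hN.mul cp).integrable_of_hasCompactSupport hsp.mul_left)
    ((hN.mul hu.continuous).integrable_of_hasCompactSupport hs.mul_left)
    (fun v _ => h v) (fun v _ => ((hu.differentiable (by simp)) v).hasFDerivAt.hasLineDerivAt _)
  simpa [mul_comm] using key

section
variable {δ r ζ θ : ℝ}

lemma hasDerivAt_dsq_fst (r' : ℝ) :
    HasDerivAt (fun x => dsq δ r x ζ θ) (2 * dvec r r' ζ θ 0) r' := by
  unfold dsq dvec
  have h := (((((hasDerivAt_id r').pow 2).const_add (r ^ 2)).add_const (ζ ^ 2)).sub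
    ((hasDerivAt_id r').const_mul (2 * r * cos θ))).add_const δ
  refine (h.congr_deriv ?_).congr_of_eventuallyEq (Filter.Eventually.of_forall fun x => ?_)
  · simp; ring
  · simp; ring

lemma hasDerivAt_dsq_snd (r' : ℝ) :
    HasDerivAt (fun x => dsq δ r r' x θ) (2 * dvec r r' ζ θ 1) ζ := by
  unfold dsq dvec
  have h := ((((hasDerivAt_id ζ).pow 2).const_add (r ^ 2 + r' ^ 2)).sub_const
    (2 * r * r' * cos θ)).add_const δ
  refine (h.congr_deriv ?_).congr_of_eventuallyEq (Filter.Eventually.of_forall fun x => ?_)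
  · simp
  · simp

lemma hasDerivAt_dsq_rpow_fst (hδ : 0 < δ) (r' : ℝ) (s : ℝ) :
    HasDerivAt (fun x => dsq δ r x ζ θ ^ s)
      (2 * s * (dvec r r' ζ θ 0 * dsq δ r r' ζ θ ^ (s - 1))) r' :=
  ((hasDerivAt_dsq_fst r').rpow_const (Or.inl (dsq_pos hδ θ).ne')).congr_deriv (by ring)

lemma hasDerivAt_dsq_rpow_snd (hδ : 0 < δ) (r' : ℝ) (s : ℝ) :
    HasDerivAt (fun x => dsq δ r r' x θ ^ s)
      (2 * s * (dvec r r' ζ θ 1 * dsq δ r r' ζ θ ^ (s - 1))) ζ :=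
  ((hasDerivAt_dsq_snd r').rpow_const (Or.inl (dsq_pos hδ θ).ne')).congr_deriv (by ring)

lemma hasDerivAt_dsq_half_fst (hδ : 0 < δ) (r' : ℝ) :
    HasDerivAt (fun x => dsq δ r x ζ θ ^ (-(1 / 2) : ℝ)) (-kernGrad δ 0 r r' ζ θ) r' := by
  refine (hasDerivAt_dsq_rpow_fst hδ r' _).congr_deriv ?_
  unfold kernGrad; norm_num

lemma hasDerivAt_dsq_half_snd (hδ : 0 < δ) (r' : ℝ) :
    HasDerivAt (fun x => dsq δ r r' x θ ^ (-(1 / 2) : ℝ)) (-kernGrad δ 1 r r' ζ θ) ζ := by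
  refine (hasDerivAt_dsq_rpow_snd hδ r' _).congr_deriv ?_
  unfold kernGrad; norm_num

lemma hasDerivAt_kernGrad_fst (hδ : 0 < δ) (i : Fin 2) (r' : ℝ) :
    HasDerivAt (fun x => kernGrad δ i r x ζ θ) (-kern δ i 0 r r' ζ θ) r' := by
  have h1 : HasDerivAt (fun x => dvec r x ζ θ i) (if i = 0 then 1 else 0) r' := by
    fin_cases i
    · simpa [dvec] using hasDerivAt_id' r'
    · simpa [dvec] using hasDerivAt_const r' ζ
  refine (h1.mul (hasDerivAt_dsq_rpow_fst hδ r' (-(3 / 2)))).congr_deriv ?_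
  unfold kern
  norm_num
  ring

lemma hasDerivAt_kernGrad_snd (hδ : 0 < δ) (i : Fin 2) (r' : ℝ) :
    HasDerivAt (fun x => kernGrad δ i r r' x θ) (-kern δ i 1 r r' ζ θ) ζ := by
  have h1 : HasDerivAt (fun x => dvec r r' x θ i) (if i = 1 then 1 else 0) ζ := by
    fin_cases i
    · simpa [dvec] using hasDerivAt_const ζ (r' - r * cos θ)
    · simpa [dvec] using hasDerivAt_id' ζ
  refine (h1.mul (hasDerivAt_dsq_rpow_snd hδ r' (-(3 / 2)))).congr_deriv ?_
  unfold kern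
  norm_num
  ring

lemma continuous_dsq_rpow_all (hδ : 0 < δ) (s : ℝ) : Continuous fun x : ℝ × ℝ × ℝ × ℝ =>
    dsq δ x.1 x.2.1 x.2.2.1 x.2.2.2 ^ s :=
  Continuous.rpow_const (by unfold dsq; fun_prop) fun _ => Or.inl (dsq_pos hδ _).ne'

lemma continuous_kernGrad (hδ : 0 < δ) (i : Fin 2) : Continuous fun x : ℝ × ℝ × ℝ × ℝ =>
    kernGrad δ i x.1 x.2.1 x.2.2.1 x.2.2.2 := by
  refine Continuous.mul ?_ (continuous_dsq_rpow_all hδ _)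
  fin_cases i <;> simp [dvec] <;> fun_prop

end

/-- The coefficient of the first order term in `integral_pd_pd_mul`. -/
def gradCoeff (i j : Fin 2) : ℝ := if i = 0 then (if j = 0 then 2 else 1) else 0

lemma integral_pd_pd_mul {u : ℝ × ℝ → ℝ} (hu : ContDiff ℝ (⊤ : ℕ∞) u) (hs : HasCompactSupport u)
    {δ : ℝ} (hδ : 0 < δ) (r z θ : ℝ) {i j : Fin 2} (hij : i ≤ j) :
    ∫ v, pd i (pd j u) v * (v.1 * dsq δ r v.1 (v.2 - z) θ ^ (-(1 / 2) : ℝ)) =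
      ∫ v, u v * (v.1 * kern δ i j r v.1 (v.2 - z) θ -
        gradCoeff i j * kernGrad δ j r v.1 (v.2 - z) θ) := by
  have cn : ∀ s : ℝ, Continuous fun v : ℝ × ℝ => dsq δ r v.1 (v.2 - z) θ ^ s := fun s =>
    (continuous_dsq_rpow_all hδ s).comp (by fun_prop :
      Continuous fun v : ℝ × ℝ => (r, v.1, v.2 - z, θ))
  have cg : ∀ i, Continuous fun v : ℝ × ℝ => kernGrad δ i r v.1 (v.2 - z) θ := fun i =>
    (continuous_kernGrad hδ i).comp (by fun_prop :
      Continuous fun v : ℝ × ℝ => (r, v.1, v.2 - z, θ))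
  have ck : ∀ i j, Continuous fun v : ℝ × ℝ => kern δ i j r v.1 (v.2 - z) θ := fun i j =>
    (continuous_kern hδ i j).comp (by fun_prop :
      Continuous fun v : ℝ × ℝ => (((r, v.1), v.2 - z), θ))
  have hj := contDiff_pd hu j
  have hsj := hasCompactSupport_pd hs j
  have sndD : ∀ {φ : ℝ → ℝ} {φ' : ℝ} {y : ℝ}, HasDerivAt φ φ' (y - z) →
      HasDerivAt (fun x => φ (x - z)) φ' y := fun h => h.comp_sub_const _ _
  have d0 : ∀ v : ℝ × ℝ, HasDerivAt (fun x => x * dsq δ r x (v.2 - z) θ ^ (-(1 / 2) : ℝ))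
      (dsq δ r v.1 (v.2 - z) θ ^ (-(1 / 2) : ℝ) - v.1 * kernGrad δ 0 r v.1 (v.2 - z) θ) v.1 :=
    fun v => ((hasDerivAt_id' v.1).mul (hasDerivAt_dsq_half_fst hδ v.1)).congr_deriv (by ring)
  have d00 : ∀ v : ℝ × ℝ, HasDerivAt (fun x => dsq δ r x (v.2 - z) θ ^ (-(1 / 2) : ℝ) -
      x * kernGrad δ 0 r x (v.2 - z) θ) (-(2 * kernGrad δ 0 r v.1 (v.2 - z) θ) +
        v.1 * kern δ 0 0 r v.1 (v.2 - z) θ) v.1 := fun v =>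
    ((hasDerivAt_dsq_half_fst hδ v.1).sub
      ((hasDerivAt_id' v.1).mul (hasDerivAt_kernGrad_fst hδ 0 v.1))).congr_deriv (by ring)
  have d01 : ∀ v : ℝ × ℝ, HasDerivAt (fun y => dsq δ r v.1 (y - z) θ ^ (-(1 / 2) : ℝ) -
      v.1 * kernGrad δ 0 r v.1 (y - z) θ) (-kernGrad δ 1 r v.1 (v.2 - z) θ +
        v.1 * kern δ 0 1 r v.1 (v.2 - z) θ) v.2 := fun v =>
    ((sndD (hasDerivAt_dsq_half_snd hδ v.1)).sub
      ((sndD (hasDerivAt_kernGrad_snd hδ 0 v.1)).const_mul v.1)).congr_deriv (by ring)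
  have d1 : ∀ v : ℝ × ℝ, HasDerivAt (fun y => v.1 * dsq δ r v.1 (y - z) θ ^ (-(1 / 2) : ℝ))
      (-(v.1 * kernGrad δ 1 r v.1 (v.2 - z) θ)) v.2 := fun v =>
    ((sndD (hasDerivAt_dsq_half_snd hδ v.1)).const_mul v.1).congr_deriv (by ring)
  have d11 : ∀ v : ℝ × ℝ, HasDerivAt (fun y => -(v.1 * kernGrad δ 1 r v.1 (y - z) θ))
      (v.1 * kern δ 1 1 r v.1 (v.2 - z) θ) v.2 := fun v =>
    ((sndD (hasDerivAt_kernGrad_snd hδ 1 v.1)).const_mul v.1).neg.congr_deriv (by ring)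
  fin_cases i
  · have e1 := integral_pd_mul (i := 0) hj hsj
      (N := fun v => v.1 * dsq δ r v.1 (v.2 - z) θ ^ (-(1 / 2) : ℝ))
      (N' := fun v => dsq δ r v.1 (v.2 - z) θ ^ (-(1 / 2) : ℝ) -
        v.1 * kernGrad δ 0 r v.1 (v.2 - z) θ)
      (continuous_fst.mul (cn _)) ((cn _).sub (continuous_fst.mul (cg 0)))
      (fun v => hasLineDerivAt_axis_zero (d0 v))
    fin_cases j
    · have e2 := integral_pd_mul (i := 0) hu hs
        (N := fun v => dsq δ r v.1 (v.2 - z) θ ^ (-(1 / 2) : ℝ) -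
          v.1 * kernGrad δ 0 r v.1 (v.2 - z) θ)
        (N' := fun v => -(2 * kernGrad δ 0 r v.1 (v.2 - z) θ) +
          v.1 * kern δ 0 0 r v.1 (v.2 - z) θ)
        ((cn _).sub (continuous_fst.mul (cg 0)))
        ((continuous_const.mul (cg 0)).neg.add (continuous_fst.mul (ck 0 0)))
        (fun v => hasLineDerivAt_axis_zero (d00 v))
      refine e1.trans ?_
      erw [e2]
      rw [neg_neg]
      congr 1; funext v; simp [gradCoeff]; left; ring
    · have e2 := integral_pd_mul (i := 1) hu hs
        (N := fun v => dsq δ r v.1 (v.2 - z) θ ^ (-(1 / 2) : ℝ) -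
          v.1 * kernGrad δ 0 r v.1 (v.2 - z) θ)
        (N' := fun v => -kernGrad δ 1 r v.1 (v.2 - z) θ +
          v.1 * kern δ 0 1 r v.1 (v.2 - z) θ)
        ((cn _).sub (continuous_fst.mul (cg 0)))
        ((cg 1).neg.add (continuous_fst.mul (ck 0 1)))
        (fun v => hasLineDerivAt_axis_one (d01 v))
      refine e1.trans ?_
      erw [e2]
      rw [neg_neg]
      congr 1; funext v; simp [gradCoeff]; left; ring
  · obtain rfl : j = 1 := by revert hij; fin_cases j <;> simp
    have e1 := integral_pd_mul (i := 1) hj hsj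
      (N := fun v => v.1 * dsq δ r v.1 (v.2 - z) θ ^ (-(1 / 2) : ℝ))
      (N' := fun v => -(v.1 * kernGrad δ 1 r v.1 (v.2 - z) θ))
      (continuous_fst.mul (cn _)) (continuous_fst.mul (cg 1)).neg
      (fun v => hasLineDerivAt_axis_one (d1 v))
    have e2 := integral_pd_mul (i := 1) hu hs
      (N := fun v => -(v.1 * kernGrad δ 1 r v.1 (v.2 - z) θ))
      (N' := fun v => v.1 * kern δ 1 1 r v.1 (v.2 - z) θ)
      (continuous_fst.mul (cg 1)).neg (continuous_fst.mul (ck 1 1))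
      (fun v => hasLineDerivAt_axis_one (d11 v))
    refine e1.trans ?_
    erw [e2]
    rw [neg_neg]
    congr 1; funext v; simp [gradCoeff]

section

open Filter Topology

lemma continuous_hat (m : ℕ) {k : ℝ × ℝ → ℝ → ℝ} (hk : Continuous fun x : (ℝ × ℝ) × ℝ => k x.1 x.2) :
    Continuous fun v => hat m (k v) := by
  have hc : Continuous (fun x : (ℝ × ℝ) × ℝ => k x.1 x.2 * cos (m * x.2)) := by fun_prop
  have := continuous_parametric_integral_of_continuous (μ := (volume : Measure ℝ))
    (f := fun (v : ℝ × ℝ) (θ : ℝ) => k v θ * cos (m * θ)) hc (isCompact_Icc (a := -π) (b := π))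
  unfold hat angle
  simpa only [integral_Icc_eq_integral_Ioo] using this

lemma integrable_angle {k : ℝ → ℝ} (hk : Continuous k) : Integrable k angle :=
  (hk.continuousOn.integrableOn_compact (isCompact_Icc (a := -π) (b := π))).mono_set
    Ioo_subset_Icc_self

lemma integral_mul_hat (m : ℕ) {H : ℝ × ℝ → ℝ} (hH : Continuous H) (hs : HasCompactSupport H)
    {k : ℝ × ℝ → ℝ → ℝ} (hk : Continuous fun x : (ℝ × ℝ) × ℝ => k x.1 x.2) :
    ∫ v, H v * hat m (k v) = ∫ θ, (∫ v, H v * k v θ) * cos (m * θ) ∂angle := by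
  have hc : Continuous (fun x : (ℝ × ℝ) × ℝ => H x.1 * (k x.1 x.2 * cos (m * x.2))) := by fun_prop
  have hI : Integrable (fun x : (ℝ × ℝ) × ℝ => H x.1 * (k x.1 x.2 * cos (m * x.2)))
      ((volume : Measure (ℝ × ℝ)).prod angle) := by
    have h1 : IntegrableOn (fun x : (ℝ × ℝ) × ℝ => H x.1 * (k x.1 x.2 * cos (m * x.2)))
        (tsupport H ×ˢ Icc (-π) π) ((volume : Measure (ℝ × ℝ)).prod volume) :=
      hc.continuousOn.integrableOn_compact (hs.isCompact.prod isCompact_Icc)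
    have h2 : (volume : Measure (ℝ × ℝ)).prod angle =
        ((volume : Measure (ℝ × ℝ)).prod volume).restrict (univ ×ˢ Ioo (-π) π) := by
      rw [← Measure.prod_restrict, Measure.restrict_univ]; rfl
    rw [h2]
    refine IntegrableOn.of_forall_sdiff_eq_zero h1 (MeasurableSet.univ.prod measurableSet_Ioo) ?_
    intro x hx
    have : x.1 ∉ tsupport H := fun h => hx.2 ⟨h, Ioo_subset_Icc_self hx.1.2⟩
    rw [image_eq_zero_of_notMem_tsupport this, zero_mul]
  calc ∫ v, H v * hat m (k v)
      = ∫ v, ∫ θ, H v * (k v θ * cos (m * θ)) ∂angle := by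
        simp only [hat, integral_const_mul]
    _ = ∫ θ, (∫ v, H v * (k v θ * cos (m * θ))) ∂angle := integral_integral_swap hI
    _ = _ := by
        simp only [← mul_assoc, integral_mul_const]

section
variable {δ : ℝ} (r z : ℝ)

lemma continuous_dsq_rpow_at (hδ : 0 < δ) (s : ℝ) : Continuous fun x : (ℝ × ℝ) × ℝ =>
    dsq δ r x.1.1 (x.1.2 - z) x.2 ^ s :=
  (continuous_dsq_rpow_all hδ s).comp (by fun_prop :
    Continuous fun x : (ℝ × ℝ) × ℝ => (r, x.1.1, x.1.2 - z, x.2))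

lemma continuous_kernGrad_at (hδ : 0 < δ) (i : Fin 2) : Continuous fun x : (ℝ × ℝ) × ℝ =>
    kernGrad δ i r x.1.1 (x.1.2 - z) x.2 :=
  (continuous_kernGrad hδ i).comp (by fun_prop :
    Continuous fun x : (ℝ × ℝ) × ℝ => (r, x.1.1, x.1.2 - z, x.2))

lemma continuous_kern_at (hδ : 0 < δ) (i j : Fin 2) : Continuous fun x : (ℝ × ℝ) × ℝ =>
    kern δ i j r x.1.1 (x.1.2 - z) x.2 :=
  (continuous_kern hδ i j).comp (by fun_prop :
    Continuous fun x : (ℝ × ℝ) × ℝ => (((r, x.1.1), x.1.2 - z), x.2))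

end

lemma integral_pd_pd_mul_hat {u : ℝ × ℝ → ℝ} (hu : ContDiff ℝ (⊤ : ℕ∞) u)
    (hs : HasCompactSupport u) {δ : ℝ} (hδ : 0 < δ) (r z : ℝ) (m : ℕ) {i j : Fin 2} (hij : i ≤ j) :
    ∫ v, pd i (pd j u) v * (v.1 * hat m fun θ => dsq δ r v.1 (v.2 - z) θ ^ (-(1 / 2) : ℝ)) =
      ∫ v, u v * (v.1 * hat m (kern δ i j r v.1 (v.2 - z)) -
        gradCoeff i j * hat m (kernGrad δ j r v.1 (v.2 - z))) := by
  have c1 := (contDiff_pd (contDiff_pd hu j) i).continuous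
  have s1 := hasCompactSupport_pd (hasCompactSupport_pd hs j) i
  have cn := continuous_dsq_rpow_at r z hδ (-(1 / 2))
  have ck := continuous_kern_at r z hδ i j
  have cg := continuous_kernGrad_at r z hδ j
  have e1 := integral_mul_hat m c1 s1
    (k := fun v θ => v.1 * dsq δ r v.1 (v.2 - z) θ ^ (-(1 / 2) : ℝ)) (by fun_prop)
  have e2 := integral_mul_hat m hu.continuous hs
    (k := fun v θ => v.1 * kern δ i j r v.1 (v.2 - z) θ -
      gradCoeff i j * kernGrad δ j r v.1 (v.2 - z) θ) (by fun_prop)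
  simp only [integral_pd_pd_mul hu hs hδ r z _ hij] at e1
  rw [← e2] at e1
  calc _ = ∫ v, pd i (pd j u) v *
        hat m fun θ => v.1 * dsq δ r v.1 (v.2 - z) θ ^ (-(1 / 2) : ℝ) := by
        congr 1; funext v; congr 1
        unfold hat; rw [← integral_const_mul]; congr 1; funext θ; ring
    _ = _ := e1
    _ = _ := by
        congr 1; funext v; congr 1
        have k1 : Integrable (fun θ => v.1 * (kern δ i j r v.1 (v.2 - z) θ * cos (m * θ))) angle :=
          integrable_angle (continuous_const.mul
            ((continuous_kern_angle hδ i j).mul (by fun_prop)))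
        have k2 : Integrable (fun θ => gradCoeff i j *
            (kernGrad δ j r v.1 (v.2 - z) θ * cos (m * θ))) angle :=
          integrable_angle (continuous_const.mul
            ((continuous_kernGrad_angle hδ j).mul (by fun_prop)))
        unfold hat
        rw [← integral_const_mul, ← integral_const_mul, ← integral_sub k1 k2]
        congr 1; funext θ; ring

lemma two_mul_Fm_mul_sqrt (m : ℕ) {r r' : ℝ} (hr : 0 < r) (hr' : 0 < r') (z z' : ℝ) :
    2 * (Fm m (xiSq r r' z z') * √(r' / r)) =
      r' * hat m fun θ => dsq 0 r r' (z' - z) θ ^ (-(1 / 2) : ℝ) := by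
  have hpt : ∀ θ, cos (m * θ) / √(xiSq r r' z z' + 2 * (1 - cos θ)) * √(r' / r) =
      r' * (dsq 0 r r' (z' - z) θ ^ (-(1 / 2) : ℝ) * cos (m * θ)) := by
    intro θ
    have h0 := le_dsq 0 r r' (z' - z) θ
    have e : xiSq r r' z z' + 2 * (1 - cos θ) = dsq 0 r r' (z' - z) θ / (r * r') := by
      unfold xiSq dsq; field_simp; ring
    rw [e, rpow_neg h0, ← sqrt_eq_rpow, sqrt_div h0, sqrt_div hr'.le, sqrt_mul hr.le]
    have a1 := sqrt_pos.2 hr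
    have a2 := sqrt_pos.2 hr'
    have a3 := mul_self_sqrt hr'.le
    by_cases h : √(dsq 0 r r' (z' - z) θ) = 0
    · simp [h]
    · field_simp
      linear_combination (cos (m * θ)) * a3
  have hsym : ∫ θ in (-π)..π, cos (m * θ) / √(xiSq r r' z z' + 2 * (1 - cos θ)) =
      2 * Fm m (xiSq r r' z z') := by
    set f : ℝ → ℝ := fun θ => cos (m * θ) / √(xiSq r r' z z' + 2 * (1 - cos θ)) with hf
    have heven : ∀ θ, f |θ| = f θ := by
      intro θ
      rcases abs_choice θ with h | h <;> rw [h]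
      simp [hf]
    have h := integral_comp_abs (f := (Iio π).indicator f)
    rw [setIntegral_indicator measurableSet_Iio, Ioi_inter_Iio, ← integral_Ioc_eq_integral_Ioo,
      ← intervalIntegral.integral_of_le pi_pos.le] at h
    rw [← integral_angle, angle, ← integral_indicator measurableSet_Ioo]
    unfold Fm
    rw [← h]
    refine integral_congr_ae (Eventually.of_forall fun θ => ?_)
    dsimp only
    by_cases hθ : θ ∈ Ioo (-π) π
    · rw [indicator_of_mem hθ, indicator_of_mem (by exact abs_lt.2 hθ), heven]
    · have hn : |θ| ∉ Iio π := fun h => hθ (abs_lt.1 h)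
      rw [indicator_of_notMem hθ, indicator_of_notMem hn]
  unfold hat
  rw [integral_angle, ← intervalIntegral.integral_const_mul]
  simp only [← hpt]
  rw [intervalIntegral.integral_mul_const, hsym]
  ring

lemma dsq_rpow_le {δ r r' ζ : ℝ} (hδ : 0 ≤ δ) (hr : 0 < r) (hr' : 0 < r') (h1 : r' ≠ r)
    (h2 : ζ ≠ 0) (θ : ℝ) : 0 < dsq δ r r' ζ θ ∧
      dsq δ r r' ζ θ ^ (-(1 / 2) : ℝ) ≤ |r' - r| ^ (-(1 / 2) : ℝ) * |ζ| ^ (-(1 / 2) : ℝ) := by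
  have h3 : r' - r ≠ 0 := sub_ne_zero.2 h1
  have hpos : 0 < (r' - r) ^ 2 + ζ ^ 2 := by positivity
  have hle : (r' - r) ^ 2 + ζ ^ 2 ≤ dsq δ r r' ζ θ := by
    have := mul_nonneg (mul_pos hr hr').le (sub_nonneg.2 (cos_le_one θ))
    unfold dsq; nlinarith
  refine ⟨hpos.trans_le hle, ?_⟩
  calc dsq δ r r' ζ θ ^ (-(1 / 2) : ℝ) ≤ ((r' - r) ^ 2 + ζ ^ 2) ^ (-(1 / 2) : ℝ) :=
        rpow_le_rpow_of_nonpos hpos hle (by norm_num)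
    _ = (√((r' - r) ^ 2 + ζ ^ 2))⁻¹ := by rw [rpow_neg hpos.le, ← sqrt_eq_rpow]
    _ ≤ _ := inv_sqrt_add_sq_le h3 h2

lemma measureReal_angle_univ : angle.real univ = 2 * π := by
  rw [angle, measureReal_restrict_apply_univ, volume_real_Ioo_of_le (by linarith [pi_pos])]
  ring

lemma norm_dsq_rpow_mul_cos_le {δ r r' ζ : ℝ} (hδ : 0 ≤ δ) (hr : 0 < r) (hr' : 0 < r') (h1 : r' ≠ r)
    (h2 : ζ ≠ 0) (m : ℕ) (θ : ℝ) : ‖dsq δ r r' ζ θ ^ (-(1 / 2) : ℝ) * cos (m * θ)‖ ≤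
      |r' - r| ^ (-(1 / 2) : ℝ) * |ζ| ^ (-(1 / 2) : ℝ) := by
  obtain ⟨h3, h4⟩ := dsq_rpow_le hδ hr hr' h1 h2 θ
  have h5 := rpow_nonneg h3.le (-(1 / 2))
  rw [norm_mul, norm_eq_abs, norm_eq_abs, abs_of_nonneg h5]
  exact (mul_le_of_le_one_right h5 (abs_cos_le_one _)).trans h4

lemma abs_hat_dsq_le {δ r r' ζ : ℝ} (hδ : 0 ≤ δ) (hr : 0 < r) (hr' : 0 < r') (h1 : r' ≠ r)
    (h2 : ζ ≠ 0) (m : ℕ) : |hat m fun θ => dsq δ r r' ζ θ ^ (-(1 / 2) : ℝ)| ≤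
      |r' - r| ^ (-(1 / 2) : ℝ) * |ζ| ^ (-(1 / 2) : ℝ) * (2 * π) := by
  rw [← measureReal_angle_univ, ← norm_eq_abs]
  exact norm_integral_le_of_norm_le_const
    (Eventually.of_forall fun θ => norm_dsq_rpow_mul_cos_le hδ hr hr' h1 h2 m θ)

lemma tendsto_hat_dsq {r r' ζ : ℝ} (hr : 0 < r) (hr' : 0 < r') (h1 : r' ≠ r) (h2 : ζ ≠ 0) (m : ℕ) :
    Tendsto (fun n : ℕ => hat m fun θ => dsq (1 / ((n : ℝ) + 1)) r r' ζ θ ^ (-(1 / 2) : ℝ)) atTop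
      (𝓝 (hat m fun θ => dsq 0 r r' ζ θ ^ (-(1 / 2) : ℝ))) := by
  refine tendsto_integral_of_dominated_convergence
    (fun _ => |r' - r| ^ (-(1 / 2) : ℝ) * |ζ| ^ (-(1 / 2) : ℝ)) (fun n => ?_) (integrable_const _)
    (fun n => Eventually.of_forall fun θ =>
      norm_dsq_rpow_mul_cos_le (by positivity) hr hr' h1 h2 m θ)
    (Eventually.of_forall fun θ => ?_)
  · exact ((continuous_dsq_rpow (by positivity) _).mul (by fun_prop)).aestronglyMeasurable
  · have h3 := (dsq_rpow_le le_rfl hr hr' h1 h2 θ).1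
    have h4 : Tendsto (fun n : ℕ => dsq (1 / ((n : ℝ) + 1)) r r' ζ θ) atTop
        (𝓝 (dsq 0 r r' ζ θ)) := by
      unfold dsq
      exact tendsto_const_nhds.add tendsto_one_div_add_atTop_nhds_zero_nat
    exact (h4.rpow_const (Or.inl h3.ne')).mul_const _

lemma tendsto_integral_mul_hat_dsq {h : ℝ × ℝ → ℝ} (hc : Continuous h) (hs : HasCompactSupport h)
    (h0 : ∀ v, v.1 ≤ 0 → h v = 0) (m : ℕ) {r : ℝ} (hr : 0 < r) (z : ℝ) :
    Tendsto (fun n : ℕ => ∫ v, h v * (v.1 * hat m fun θ =>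
        dsq (1 / ((n : ℝ) + 1)) r v.1 (v.2 - z) θ ^ (-(1 / 2) : ℝ))) atTop
      (𝓝 (4 * π * Lminv m (fun r z => h (r, z)) r z)) := by
  obtain ⟨M, hM⟩ := hs.exists_bound_of_continuous hc
  obtain ⟨R, hR0, hR⟩ : ∃ R : ℝ, 0 ≤ R ∧ tsupport h ⊆ Metric.closedBall 0 R := by
    obtain ⟨R, hR⟩ := hs.isCompact.isBounded.subset_closedBall 0
    exact ⟨max R 0, le_max_right _ _, hR.trans (Metric.closedBall_subset_closedBall (le_max_left _ _))⟩
  have hM0 : 0 ≤ M := (norm_nonneg _).trans (hM 0)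
  have hsupp : ∀ v, h v ≠ 0 → v.1 ∈ Icc (-R) R ∧ v.2 ∈ Icc (-R) R := by
    intro v hv
    have h1 := hR (subset_tsupport h hv)
    rw [mem_closedBall_zero_iff] at h1
    exact ⟨abs_le.1 ((norm_fst_le v).trans h1), abs_le.1 ((norm_snd_le v).trans h1)⟩
  set K : ℝ → ℝ → ℝ := fun c => (Icc (-R) R).indicator fun x => |x - c| ^ (-(1 / 2) : ℝ) with hK
  have hKi : ∀ c, Integrable (K c) := by
    intro c
    rw [hK]
    refine (integrable_indicator_iff measurableSet_Icc).2 ?_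
    exact (intervalIntegrable_iff_integrableOn_Icc_of_le (by linarith)).1
      (intervalIntegrable_abs_rpow_neg_half _ _ c)
  set G : ℝ × ℝ → ℝ := fun v => (M * R * (2 * π)) * (K r v.1 * K z v.2) with hG
  have hGi : Integrable G := ((hKi r).mul_prod (hKi z)).const_mul _
  have hne : ∀ᵐ v : ℝ × ℝ, v.1 ≠ r ∧ v.2 ≠ z :=
    (Measure.quasiMeasurePreserving_fst.ae (Measure.ae_ne volume r)).and
      (Measure.quasiMeasurePreserving_snd.ae (Measure.ae_ne volume z))
  have hbd : ∀ δ : ℝ, 0 ≤ δ → ∀ v : ℝ × ℝ, v.1 ≠ r → v.2 ≠ z →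
      ‖h v * (v.1 * hat m fun θ => dsq δ r v.1 (v.2 - z) θ ^ (-(1 / 2) : ℝ))‖ ≤ G v := by
    intro δ hδ v h1 h2
    by_cases hv : h v = 0
    · rw [hv, zero_mul, norm_zero, hG]
      have hk : ∀ c x, 0 ≤ K c x := fun c x =>
        indicator_nonneg (fun y _ => rpow_nonneg (abs_nonneg _) _) x
      have := hk r v.1; have := hk z v.2; positivity
    · have hv1 : 0 < v.1 := by
        by_contra! hcon
        exact hv (h0 v hcon)
      obtain ⟨m1, m2⟩ := hsupp v hv
      have hb := abs_hat_dsq_le hδ hr hv1 h1 (sub_ne_zero.2 h2) m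
      have hb0 := (abs_nonneg _).trans hb
      rw [norm_mul, norm_mul, norm_eq_abs v.1, abs_of_pos hv1, norm_eq_abs (hat _ _), hG]
      simp only [hK, indicator_of_mem m1, indicator_of_mem m2]
      calc _ ≤ M * (R * (|v.1 - r| ^ (-(1 / 2) : ℝ) * |v.2 - z| ^ (-(1 / 2) : ℝ) * (2 * π))) :=
            mul_le_mul (hM v) (mul_le_mul m1.2 hb (abs_nonneg _) (hv1.le.trans m1.2))
              (mul_nonneg hv1.le (abs_nonneg _)) hM0
        _ = _ := by ring
  have hmeas : ∀ n : ℕ, AEStronglyMeasurable (fun v => h v * (v.1 * hat m fun θ =>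
      dsq (1 / ((n : ℝ) + 1)) r v.1 (v.2 - z) θ ^ (-(1 / 2) : ℝ))) volume := by
    intro n
    have hd : 0 < 1 / ((n : ℝ) + 1) := by positivity
    have := continuous_hat m
      (k := fun v θ => dsq (1 / ((n : ℝ) + 1)) r v.1 (v.2 - z) θ ^ (-(1 / 2) : ℝ))
      (continuous_dsq_rpow_at r z hd (-(1 / 2)))
    exact (hc.mul (continuous_fst.mul this)).aestronglyMeasurable
  have hlim : ∀ᵐ v : ℝ × ℝ, Tendsto (fun n : ℕ => h v * (v.1 * hat m fun θ =>
      dsq (1 / ((n : ℝ) + 1)) r v.1 (v.2 - z) θ ^ (-(1 / 2) : ℝ))) atTop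
      (𝓝 (h v * (v.1 * hat m fun θ => dsq 0 r v.1 (v.2 - z) θ ^ (-(1 / 2) : ℝ)))) := by
    filter_upwards [hne] with v hv
    rcases le_or_gt v.1 0 with hv0 | hv0
    · simp only [h0 v hv0, zero_mul]; exact tendsto_const_nhds
    · exact ((tendsto_hat_dsq hr hv0 hv.1 (sub_ne_zero.2 hv.2) m).const_mul _).const_mul _
  have hI : Integrable fun v => h v * (v.1 * hat m fun θ =>
      dsq 0 r v.1 (v.2 - z) θ ^ (-(1 / 2) : ℝ)) := by
    refine hGi.mono' (aestronglyMeasurable_of_tendsto_ae atTop hmeas hlim) ?_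
    filter_upwards [hne] with v hv using hbd 0 le_rfl v hv.1 hv.2
  have hT := tendsto_integral_of_dominated_convergence G hmeas hGi
    (fun n => by filter_upwards [hne] with v hv using hbd _ (by positivity) v hv.1 hv.2) hlim
  have hval : ∫ v, h v * (v.1 * hat m fun θ => dsq 0 r v.1 (v.2 - z) θ ^ (-(1 / 2) : ℝ)) =
      4 * π * Lminv m (fun r z => h (r, z)) r z := by
    have hzero : ∀ x ∉ Ioi (0 : ℝ), (∫ y, h (x, y) * (x * hat m fun θ =>
        dsq 0 r x (y - z) θ ^ (-(1 / 2) : ℝ))) = 0 := by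
      intro x hx
      simp [h0 (x, _) (not_lt.1 hx)]
    rw [Measure.volume_eq_prod, integral_prod _ hI,
      ← setIntegral_eq_integral_of_forall_compl_eq_zero hzero, Lminv, ← mul_assoc,
      show 4 * π * (1 / (2 * π)) = 2 by field_simp; norm_num, ← integral_const_mul]
    refine setIntegral_congr_fun measurableSet_Ioi fun x hx => ?_
    rw [← integral_const_mul]
    refine integral_congr_ae (Eventually.of_forall fun y => ?_)
    have := two_mul_Fm_mul_sqrt m hr hx z y
    dsimp only
    rw [← this]
    ring
  rwa [← hval]

lemma lintegral_halfPlane_eq_volume {F : ℝ × ℝ → ENNReal} (hF : Measurable F) :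
    ∫⁻ v, F v ∂halfPlane = ∫⁻ v, ENNReal.ofReal v.1 * F v := by
  have h : Measurable fun v : ℝ × ℝ => ENNReal.ofReal v.1 * F v := by fun_prop
  rw [lintegral_halfPlane hF, Measure.volume_eq_prod, lintegral_prod _ h.aemeasurable,
    ← lintegral_indicator measurableSet_Ioi]
  congr 1; funext x
  by_cases hx : x ∈ Ioi (0 : ℝ)
  · rw [indicator_of_mem hx]
  · rw [indicator_of_notMem hx]
    simp [ENNReal.ofReal_of_nonpos (not_lt.1 hx)]

lemma integral_halfPlane {F : ℝ × ℝ → ℝ} (hF : ∀ v, v.1 ≤ 0 → F v = 0) :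
    ∫ v, F v ∂halfPlane = ∫ v, v.1 * F v := by
  have h : halfPlane = ((volume : Measure (ℝ × ℝ)).restrict (Ioi 0 ×ˢ univ)).withDensity
      fun v => ENNReal.ofReal v.1 := by
    rw [halfPlane, Measure.volume_eq_prod, ← Measure.prod_restrict, Measure.restrict_univ,
      prod_withDensity_left (by fun_prop)]
  rw [h, integral_withDensity_eq_integral_toReal_smul (by fun_prop) (by simp)]
  rw [← integral_indicator (measurableSet_Ioi.prod MeasurableSet.univ)]
  congr 1; funext v
  by_cases hv : 0 < v.1
  · rw [indicator_of_mem (by simpa using hv), ENNReal.toReal_ofReal hv.le, smul_eq_mul]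
  · rw [indicator_of_notMem (by simpa using hv), hF v (not_lt.1 hv), mul_zero]

lemma abs_rpow_sub_one_le {γ t : ℝ} (h0 : 0 ≤ γ) (h2 : γ ≤ 2) (ht : 0 < t) :
    |1 - t ^ γ| ≤ |1 - t ^ 2| := by
  rcases le_total t 1 with h | h
  · have h1 : t ^ (2 : ℝ) ≤ t ^ γ := rpow_le_rpow_of_exponent_ge ht h h2
    have h3 : t ^ γ ≤ 1 := rpow_le_one ht.le h h0
    rw [rpow_two] at h1
    rw [abs_of_nonneg (by linarith), abs_of_nonneg (by linarith)]
    linarith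
  · have h1 : t ^ γ ≤ t ^ (2 : ℝ) := rpow_le_rpow_of_exponent_le h h2
    have h3 : 1 ≤ t ^ γ := one_le_rpow h h0
    rw [rpow_two] at h1
    rw [abs_of_nonpos (by linarith), abs_of_nonpos (by linarith)]
    linarith

lemma abs_div_rpow_sub_one_le {γ r r' d σ : ℝ} (h0 : 0 ≤ γ) (h2 : γ ≤ 2) (hr : 0 < r)
    (hr' : 0 < r') (hd : |r - r'| ≤ d) (hσ : r + r' ≤ 2 * σ) :
    |(r / r') ^ γ - 1| ≤ (r / r') ^ γ * (d * (2 * σ) / r ^ 2) := by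
  have hρ : 0 < (r / r') ^ γ := rpow_pos_of_pos (div_pos hr hr') _
  have e : (r / r') ^ γ - 1 = (r / r') ^ γ * (1 - (r' / r) ^ γ) := by
    rw [mul_sub, ← mul_rpow (by positivity) (by positivity)]
    rw [show r / r' * (r' / r) = 1 by field_simp, one_rpow, mul_one]
  rw [e, abs_mul, abs_of_pos hρ]
  refine mul_le_mul_of_nonneg_left ((abs_rpow_sub_one_le h0 h2 (div_pos hr' hr)).trans ?_) hρ.le
  have e2 : 1 - (r' / r) ^ 2 = (r - r') * (r + r') / r ^ 2 := by field_simp; ring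
  rw [e2, abs_div, abs_mul, abs_of_pos (by positivity : 0 < r + r'), abs_of_pos (pow_pos hr 2)]
  have := (abs_nonneg _).trans hd
  gcongr

lemma abs_gradCoeff_le (i j : Fin 2) : |gradCoeff i j| ≤ 2 := by
  fin_cases i <;> fin_cases j <;> simp [gradCoeff]

lemma exists_abs_commutator_le : ∃ C : ℝ, 0 ≤ C ∧ ∀ (γ δ r r' ζ : ℝ) (m : ℕ) (i j : Fin 2),
    0 ≤ γ → γ ≤ 2 → 0 < δ → 0 < r → 0 < r' → r' ≠ r → 3 ≤ m →
      |(r / r') ^ γ * (r' * hat m (kern δ i j r r' ζ) -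
          gradCoeff i j * hat m (kernGrad δ j r r' ζ)) - r' * hat m (kern δ i j r r' ζ)| ≤
        r' * (C * errKer γ r r' ζ) := by
  obtain ⟨C, hC, H⟩ := exists_hat_bounds
  refine ⟨4 * C, by positivity, fun γ δ r r' ζ m i j h0 h2 hδ hr hr' hne hm => ?_⟩
  have hrr : 0 < (r - r') ^ 2 := by
    have := sub_ne_zero.2 hne.symm
    positivity
  set d := √((r - r') ^ 2 + ζ ^ 2) with hd
  set σ := √(r ^ 2 + r' ^ 2 + ζ ^ 2) with hσ
  have hd0 : 0 < d := sqrt_pos.2 (by positivity)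
  have hσ0 : 0 < σ := sqrt_pos.2 (by positivity)
  have hd2 : d ^ 2 = (r - r') ^ 2 + ζ ^ 2 := sq_sqrt (by positivity)
  have hσ2 : σ ^ 2 = r ^ 2 + r' ^ 2 + ζ ^ 2 := sq_sqrt (by positivity)
  obtain ⟨H1, H2⟩ := H δ r r' ζ d σ m hδ hr hr' hm hd0 hd2 hσ0 hσ2
  have h1 := H1 i j
  have h3 := H2 j
  have hρ := abs_div_rpow_sub_one_le h0 h2 hr hr' (d := d) (σ := σ)
    (abs_le_of_sq_le_sq (by nlinarith [sq_nonneg ζ]) hd0.le)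
    (by
      refine abs_le_of_sq_le_sq' ?_ (by positivity) |>.2
      nlinarith [sq_nonneg ζ, sq_nonneg (r - r')])
  have hρ0 : 0 < (r / r') ^ γ := rpow_pos_of_pos (div_pos hr hr') _
  have he : errKer γ r r' ζ = (r / r') ^ γ * (r * r') / (σ ^ 4 * d) := by
    unfold errKer; rw [← hσ2, ← hd]; ring
  set ρ := (r / r') ^ γ
  set a := hat m (kern δ i j r r' ζ)
  set b := hat m (kernGrad δ j r r' ζ)
  calc |ρ * (r' * a - gradCoeff i j * b) - r' * a|
      = |(ρ - 1) * (r' * a) - ρ * (gradCoeff i j * b)| := by ring_nf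
    _ ≤ |(ρ - 1) * (r' * a)| + |ρ * (gradCoeff i j * b)| := abs_sub _ _
    _ = |ρ - 1| * (r' * |a|) + ρ * (|gradCoeff i j| * |b|) := by
        rw [abs_mul, abs_mul, abs_mul, abs_mul, abs_of_pos hr', abs_of_pos hρ0]
    _ ≤ (ρ * (d * (2 * σ) / r ^ 2)) * (r' * (C * (r ^ 3 * r') / (σ ^ 5 * d ^ 2))) +
        ρ * (2 * (C * (r * r' ^ 2) / (σ ^ 4 * d))) := by
        have := abs_gradCoeff_le i j
        gcongr
    _ = r' * (4 * C * errKer γ r r' ζ) := by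
        rw [he]; field_simp; ring

/-- The integral against the kernel of `L_m⁻¹ ∂ᵢ∂ⱼ` regularised at scale `δ`. -/
def regInt (δ : ℝ) (m : ℕ) (i j : Fin 2) (u : ℝ × ℝ → ℝ) (w : ℝ × ℝ) : ℝ :=
  ∫ v, u v * (v.1 * hat m (kern δ i j w.1 v.1 (v.2 - w.2)) -
    gradCoeff i j * hat m (kernGrad δ j w.1 v.1 (v.2 - w.2)))

lemma exists_enorm_rpow_mul_regInt_le : ∃ C : ℝ, 0 ≤ C ∧
    ∀ (γ δ : ℝ) (m : ℕ) (i j : Fin 2) (u g : ℝ × ℝ → ℝ) (w : ℝ × ℝ),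
      0 ≤ γ → γ ≤ 2 → 0 < δ → 3 ≤ m → 0 < w.1 →
      Continuous u → HasCompactSupport u → (∀ v, v.1 ≤ 0 → u v = 0) →
      Continuous g → (∀ v, g v = v.1 ^ γ * u v) →
      ‖w.1 ^ γ * regInt δ m i j u w‖ₑ ≤ ‖singOp δ m i j g w‖ₑ + ENNReal.ofReal C *
        ∫⁻ v, ENNReal.ofReal (errKer γ w.1 v.1 (v.2 - w.2)) * ‖g v‖ₑ ∂halfPlane := by
  obtain ⟨C, hC, H⟩ := exists_abs_commutator_le
  refine ⟨C, hC, fun γ δ m i j u g w h0 h2 hδ hm hw cu su u0 cg hg => ?_⟩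
  obtain ⟨r, z⟩ := w
  simp only at hw ⊢
  have sg : HasCompactSupport g := by
    have : g = fun v => v.1 ^ γ * u v := funext hg
    rw [this]; exact su.mul_left
  have ck := continuous_hat m (k := fun v => kern δ i j r v.1 (v.2 - z))
    (continuous_kern_at r z hδ i j)
  have cg' := continuous_hat m (k := fun v => kernGrad δ j r v.1 (v.2 - z))
    (continuous_kernGrad_at r z hδ j)
  have g0 : ∀ v, v.1 ≤ 0 → g v = 0 := fun v hv => by rw [hg, u0 v hv, mul_zero]
  have hS : singOp δ m i j g (r, z) =
      ∫ v, g v * (v.1 * hat m (kern δ i j r v.1 (v.2 - z))) := by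
    have : singOp δ m i j g (r, z) =
      ∫ v, g v * hat m (kern δ i j r v.1 (v.2 - z)) ∂halfPlane := rfl
    rw [this, integral_halfPlane fun v hv => by rw [g0 v hv, zero_mul]]
    congr 1; funext v; ring
  have i1 : Integrable fun v => g v * (v.1 * hat m (kern δ i j r v.1 (v.2 - z))) :=
    (cg.mul (continuous_fst.mul ck)).integrable_of_hasCompactSupport sg.mul_right
  have i2 : Integrable fun v => r ^ γ * (u v * (v.1 * hat m (kern δ i j r v.1 (v.2 - z)) -
      gradCoeff i j * hat m (kernGrad δ j r v.1 (v.2 - z)))) :=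
    ((cu.mul ((continuous_fst.mul ck).sub (continuous_const.mul cg'))).integrable_of_hasCompactSupport
      su.mul_right).const_mul _
  have hdiff : r ^ γ * regInt δ m i j u (r, z) = singOp δ m i j g (r, z) +
      ∫ v, (r ^ γ * (u v * (v.1 * hat m (kern δ i j r v.1 (v.2 - z)) -
        gradCoeff i j * hat m (kernGrad δ j r v.1 (v.2 - z)))) -
        g v * (v.1 * hat m (kern δ i j r v.1 (v.2 - z)))) := by
    rw [integral_sub i2 i1, hS, integral_const_mul, regInt]; ring
  rw [hdiff]
  refine (enorm_add_le _ _).trans (add_le_add le_rfl ?_)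
  have hme : Measurable fun v : ℝ × ℝ => ENNReal.ofReal (errKer γ r v.1 (v.2 - z)) * ‖g v‖ₑ := by
    have h1 := measurable_errKer γ
    have h3 : Measurable fun v : ℝ × ℝ => errKer γ r v.1 (v.2 - z) :=
      h1.comp (by fun_prop : Measurable fun v : ℝ × ℝ => (r, v.1, v.2 - z))
    exact h3.ennreal_ofReal.mul cg.measurable.enorm
  rw [← lintegral_const_mul _ hme, lintegral_halfPlane_eq_volume (hme.const_mul _)]
  refine (enorm_integral_le_lintegral_enorm _).trans (lintegral_mono_ae ?_)
  filter_upwards [Measure.quasiMeasurePreserving_fst.ae (Measure.ae_ne volume r)] with v hv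
  rcases le_or_gt v.1 0 with hv0 | hv0
  · simp [u0 v hv0, g0 v hv0]
  · have e : r ^ γ * (u v * (v.1 * hat m (kern δ i j r v.1 (v.2 - z)) -
        gradCoeff i j * hat m (kernGrad δ j r v.1 (v.2 - z)))) -
        g v * (v.1 * hat m (kern δ i j r v.1 (v.2 - z))) =
        ((r / v.1) ^ γ * (v.1 * hat m (kern δ i j r v.1 (v.2 - z)) -
          gradCoeff i j * hat m (kernGrad δ j r v.1 (v.2 - z))) -
          v.1 * hat m (kern δ i j r v.1 (v.2 - z))) * g v := by
      have := (rpow_pos_of_pos hv0 γ).ne'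
      rw [hg, div_rpow hw.le hv0.le]; field_simp
    rw [e, enorm_mul, ← mul_assoc (ENNReal.ofReal C), ← ENNReal.ofReal_mul hC, ← mul_assoc,
      ← ENNReal.ofReal_mul hv0.le]
    gcongr
    rw [← ofReal_norm]
    exact ENNReal.ofReal_le_ofReal (H γ δ r v.1 (v.2 - z) m i j h0 h2 hδ hw hv0 hv hm)

lemma tsupport_pd_subset (u : ℝ × ℝ → ℝ) (i : Fin 2) : tsupport (pd i u) ⊆ tsupport u := by
  refine closure_minimal (fun v hv => ?_) (isClosed_tsupport u)
  by_contra hcon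
  exact hv (by rw [pd, fderiv_of_notMem_tsupport ℝ hcon]; simp)

lemma exists_le_and_lintegral_le {p γ : ℝ} (hp : 1 < p) (h0 : 0 ≤ γ) (h2 : γ ≤ 2)
    (ha : -1 < 2 - γ - 2 / p) (hb : 2 - γ - 2 / p < 2) : ∃ C : ℝ, 0 ≤ C ∧
    ∀ (m : ℕ) (i j : Fin 2) (u : ℝ × ℝ → ℝ), 3 ≤ m → i ≤ j → ContDiff ℝ (⊤ : ℕ∞) u →
      HasCompactSupport u → tsupport u ⊆ Ioi (0 : ℝ) ×ˢ univ →
      ∃ H : ℝ × ℝ → ENNReal, Measurable H ∧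
        (∀ r z, 0 < r →
          ‖r ^ γ * Lminv m (fun r z => pd i (pd j u) (r, z)) r z‖ₑ ^ p ≤ H (r, z)) ∧
        ∫⁻ w, H w ∂halfPlane ≤
          ENNReal.ofReal C * ∫⁻ w, ‖w.1 ^ γ * u w‖ₑ ^ p ∂halfPlane := by
  obtain ⟨C₁, hC₁, H₁⟩ := lintegral_singOp_rpow_le hp
  obtain ⟨C₂, hC₂, H₂⟩ := exists_lintegral_errKer_rpow_le hp ha hb
  obtain ⟨C₃, hC₃, H₃⟩ := exists_enorm_rpow_mul_regInt_le
  have hp0 : 0 < p := by linarith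
  refine ⟨2 ^ (p - 1) * (C₁ + C₃ ^ p * C₂), by positivity, fun m i j u hm hij hu hs hsupp => ?_⟩
  have hz : ∀ {h : ℝ × ℝ → ℝ}, tsupport h ⊆ tsupport u → ∀ v, v.1 ≤ 0 → h v = 0 := by
    intro h hh v hv
    exact image_eq_zero_of_notMem_tsupport fun hc => absurd (hsupp (hh hc)).1 (not_lt.2 hv)
  set g : ℝ × ℝ → ℝ := fun v => v.1 ^ γ * u v with hg
  have cg : Continuous g :=
    (continuous_fst.rpow_const fun _ => Or.inr h0).mul hu.continuous
  have sg : HasCompactSupport g := hs.mul_left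
  have hn : ∀ x : ℝ, ENNReal.ofReal (|x| ^ p) = ‖x‖ₑ ^ p := fun x => by
    rw [← ENNReal.ofReal_rpow_of_nonneg (abs_nonneg x) hp0.le, ← norm_eq_abs, ofReal_norm]
  set δ : ℕ → ℝ := fun n => 1 / ((n : ℝ) + 1) with hδ
  have hδ0 : ∀ n, 0 < δ n := fun n => by rw [hδ]; positivity
  set E : ℝ × ℝ → ENNReal := fun w =>
    ∫⁻ v, ENNReal.ofReal (errKer γ w.1 v.1 (v.2 - w.2)) * ‖g v‖ₑ ∂halfPlane with hE
  have mE : Measurable E := by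
    have h1 : Measurable fun x : (ℝ × ℝ) × ℝ × ℝ =>
        ENNReal.ofReal (errKer γ x.1.1 x.2.1 (x.2.2 - x.1.2)) * ‖g x.2‖ₑ := by
      have h3 : Measurable fun x : (ℝ × ℝ) × ℝ × ℝ => errKer γ x.1.1 x.2.1 (x.2.2 - x.1.2) :=
        (measurable_errKer γ).comp (by fun_prop :
          Measurable fun x : (ℝ × ℝ) × ℝ × ℝ => (x.1.1, x.2.1, x.2.2 - x.1.2))
      exact h3.ennreal_ofReal.mul (cg.measurable.comp measurable_snd).enorm
    exact h1.lintegral_prod_right'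
  set T : ℕ → ℝ × ℝ → ENNReal := fun n w =>
    (‖singOp (δ n) m i j g w‖ₑ + ENNReal.ofReal C₃ * E w) ^ p with hT
  have mS : ∀ n, Measurable fun w => ‖singOp (δ n) m i j g w‖ₑ := fun n =>
    (measurable_singOp cg.measurable (hδ0 n) m i j).enorm
  have mT : ∀ n, Measurable (T n) := fun n => ((mS n).add (mE.const_mul _)).pow_const p
  have hhalf : ∃ ρ M, 0 ≤ ρ ∧ HalfSupp g ρ M := by
    obtain ⟨M, hM⟩ := sg.exists_bound_of_continuous cg
    obtain ⟨R, hR⟩ := sg.isCompact.isBounded.subset_closedBall 0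
    have hsup : ∀ w, max R 0 < ‖w‖ → g w = 0 := fun w hw =>
      image_eq_zero_of_notMem_tsupport fun hc => by
        have := mem_closedBall_zero_iff.1 (hR hc)
        have := le_max_left R 0
        linarith
    exact ⟨max R 0, M, le_max_right _ _, cg.measurable, hM,
      fun w hw => hsup w (hw.trans_le (norm_fst_le w)),
      fun w hw => hsup w (hw.trans_le (norm_snd_le w))⟩
  obtain ⟨ρ, M, hρ, hHS⟩ := hhalf
  refine ⟨fun w => liminf (fun n => T n w) atTop, .liminf mT, fun r z hr => ?_, ?_⟩
  · have hlim := tendsto_integral_mul_hat_dsq (contDiff_pd (contDiff_pd hu j) i).continuous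
      (hasCompactSupport_pd (hasCompactSupport_pd hs j) i)
      (hz ((tsupport_pd_subset _ i).trans (tsupport_pd_subset _ j))) m hr z
    have he : ∀ n : ℕ, ∫ v, pd i (pd j u) v * (v.1 * hat m fun θ =>
        dsq (1 / ((n : ℝ) + 1)) r v.1 (v.2 - z) θ ^ (-(1 / 2) : ℝ)) =
        regInt (δ n) m i j u (r, z) := fun n =>
      integral_pd_pd_mul_hat hu hs (hδ0 n) r z m hij
    simp only [he] at hlim
    have hlim2 := (ENNReal.continuous_rpow_const (y := p)).tendsto _ |>.comp
      ((hlim.const_mul (r ^ γ)).enorm)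
    calc ‖r ^ γ * Lminv m (fun r z => pd i (pd j u) (r, z)) r z‖ₑ ^ p
        ≤ ‖r ^ γ * (4 * π * Lminv m (fun r z => pd i (pd j u) (r, z)) r z)‖ₑ ^ p := by
          refine ENNReal.rpow_le_rpow ?_ hp0.le
          rw [← ofReal_norm, ← ofReal_norm]
          refine ENNReal.ofReal_le_ofReal ?_
          rw [norm_mul, norm_mul, norm_mul (4 * π), norm_eq_abs (4 * π),
            abs_of_pos (by positivity)]
          refine mul_le_mul_of_nonneg_left ?_ (norm_nonneg _)
          exact le_mul_of_one_le_left (norm_nonneg _) (by linarith [pi_gt_three])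
      _ = _ := hlim2.liminf_eq.symm
      _ ≤ _ := by
          refine liminf_le_liminf (Eventually.of_forall fun n => ?_)
          exact ENNReal.rpow_le_rpow (H₃ γ (δ n) m i j u g (r, z) h0 h2 (hδ0 n) hm hr
            hu.continuous hs (hz subset_rfl) cg fun v => rfl) hp0.le
  · refine (lintegral_liminf_le mT).trans ?_
    set G := ∫⁻ w, ‖g w‖ₑ ^ p ∂halfPlane
    have hb : ∀ n, ∫⁻ w, T n w ∂halfPlane ≤
        ENNReal.ofReal (2 ^ (p - 1) * (C₁ + C₃ ^ p * C₂)) * G := by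
      intro n
      have b1 : ∫⁻ w, ‖singOp (δ n) m i j g w‖ₑ ^ p ∂halfPlane ≤ ENNReal.ofReal C₁ * G := by
        simpa only [hn] using H₁ (δ n) ρ M m g (hδ0 n) hρ (by omega) hHS i j
      have b2 : ∫⁻ w, E w ^ p ∂halfPlane ≤ ENNReal.ofReal C₂ * G :=
        H₂ (fun w => ‖g w‖ₑ) cg.measurable.enorm
      calc ∫⁻ w, T n w ∂halfPlane
          ≤ ∫⁻ w, 2 ^ (p - 1) * (‖singOp (δ n) m i j g w‖ₑ ^ p +
              ENNReal.ofReal C₃ ^ p * E w ^ p) ∂halfPlane := by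
            refine lintegral_mono fun w => ?_
            rw [← ENNReal.mul_rpow_of_nonneg _ _ hp0.le]
            exact ENNReal.rpow_add_le_mul_rpow_add_rpow _ _ hp.le
        _ = 2 ^ (p - 1) * ((∫⁻ w, ‖singOp (δ n) m i j g w‖ₑ ^ p ∂halfPlane) +
              ENNReal.ofReal C₃ ^ p * ∫⁻ w, E w ^ p ∂halfPlane) := by
            have m1 := (mS n).pow_const p
            have m2 := mE.pow_const p
            have m3 : Measurable fun w => ‖singOp (δ n) m i j g w‖ₑ ^ p +
                ENNReal.ofReal C₃ ^ p * E w ^ p := m1.add (m2.const_mul _)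
            rw [lintegral_const_mul _ m3, lintegral_add_left m1,
              lintegral_const_mul _ m2]
        _ ≤ 2 ^ (p - 1) * (ENNReal.ofReal C₁ * G +
              ENNReal.ofReal C₃ ^ p * (ENNReal.ofReal C₂ * G)) :=
            mul_le_mul_right (add_le_add b1 (mul_le_mul_right b2 _)) _
        _ = _ := by
            rw [ENNReal.ofReal_mul (by positivity), ENNReal.ofReal_add hC₁ (by positivity),
              ENNReal.ofReal_mul (by positivity), ← ENNReal.ofReal_rpow_of_nonneg hC₃ hp0.le,
              ← ENNReal.ofReal_rpow_of_nonneg (by norm_num) (by linarith), ENNReal.ofReal_ofNat]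
            ring
    exact (liminf_le_liminf (Eventually.of_forall hb)).trans (liminf_const _).le

lemma ofReal_iterated_le {p : ℝ} (hp : 0 ≤ p) {F : ℝ → ℝ → ℝ} {H : ℝ × ℝ → ENNReal}
    (hH : Measurable H) (hle : ∀ r z, 0 < r → ‖F r z‖ₑ ^ p ≤ H (r, z)) :
    ENNReal.ofReal (∫ r in Ioi (0 : ℝ), ∫ z : ℝ, |F r z| ^ p * r) ≤ ∫⁻ w, H w ∂halfPlane := by
  rw [lintegral_halfPlane hH]
  refine (ofReal_le_enorm _).trans ((enorm_integral_le_lintegral_enorm _).trans ?_)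
  refine setLIntegral_mono' measurableSet_Ioi fun r hr => ?_
  refine (enorm_integral_le_lintegral_enorm _).trans (lintegral_mono fun z => ?_)
  rw [enorm_mul, mul_comm, enorm_of_nonneg (le_of_lt hr), enorm_of_nonneg (by positivity),
    ← ENNReal.ofReal_rpow_of_nonneg (abs_nonneg _) hp, ← norm_eq_abs, ofReal_norm]
  exact mul_le_mul_right (hle r z hr) _

lemma lintegral_enorm_rpow_halfPlane {p : ℝ} (hp : 0 < p) {g : ℝ × ℝ → ℝ} (hg : Continuous g)
    (hs : HasCompactSupport g) (h0 : ∀ v, v.1 ≤ 0 → g v = 0) :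
    ∫⁻ w, ‖g w‖ₑ ^ p ∂halfPlane =
      ENNReal.ofReal (∫ r in Ioi (0 : ℝ), ∫ z : ℝ, |g (r, z)| ^ p * r) := by
  have hI : Integrable fun v : ℝ × ℝ => |g v| ^ p * v.1 := by
    refine Continuous.integrable_of_hasCompactSupport
      ((hg.abs.rpow_const fun _ => Or.inr hp.le).mul continuous_fst) ?_
    exact (hs.comp_left (g := fun x : ℝ => |x| ^ p) (by simp [hp.ne'])).mul_right
  have hnn : ∀ v : ℝ × ℝ, 0 ≤ |g v| ^ p * v.1 := by
    intro v
    rcases le_total v.1 0 with h | h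
    · simp [h0 v h, hp.ne']
    · positivity
  have hzero : ∀ x ∉ Ioi (0 : ℝ), (∫ y, |g (x, y)| ^ p * x) = 0 := by
    intro x hx
    simp [h0 (x, _) (not_lt.1 hx), hp.ne']
  rw [lintegral_halfPlane_eq_volume (hg.measurable.enorm.pow_const p),
    setIntegral_eq_integral_of_forall_compl_eq_zero hzero]
  have := integral_prod _ hI
  rw [← this, ← Measure.volume_eq_prod, ofReal_integral_eq_lintegral_ofReal hI (.of_forall hnn)]
  congr 1; funext v
  rcases le_total v.1 0 with h | h
  · simp [h0 v h, hp.ne', hp, ENNReal.ofReal_of_nonpos h]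
  · rw [mul_comm, ENNReal.ofReal_mul (by positivity),
      ← ENNReal.ofReal_rpow_of_nonneg (abs_nonneg _) hp.le, ← norm_eq_abs, ofReal_norm]

lemma cylLp_nonneg (p : ℝ) (F : ℝ → ℝ → ℝ) : 0 ≤ cylLp p F := by
  unfold cylLp
  refine rpow_nonneg (mul_nonneg (by positivity) ?_) _
  exact setIntegral_nonneg measurableSet_Ioi fun r hr =>
    integral_nonneg fun z => mul_nonneg (by positivity) (le_of_lt hr)

lemma exists_cylLp_Lminv_pd_le {p γ : ℝ} (hp : 1 < p) (h0 : 0 ≤ γ) (h2 : γ ≤ 2)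
    (ha : -1 < 2 - γ - 2 / p) (hb : 2 - γ - 2 / p < 2) : ∃ C : ℝ, 0 ≤ C ∧
    ∀ (m : ℕ) (i j : Fin 2) (f : ℝ → ℝ → ℝ), 3 ≤ m → i ≤ j → TestFun f →
      cylLp p (fun r z => r ^ γ *
          Lminv m (fun r z => pd i (pd j (Function.uncurry f)) (r, z)) r z) ≤
        C * cylLp p (fun r z => r ^ γ * f r z) := by
  obtain ⟨C, hC, H⟩ := exists_le_and_lintegral_le hp h0 h2 ha hb
  have hp0 : 0 < p := by linarith
  refine ⟨C ^ (1 / p), by positivity, fun m i j f hm hij ⟨hu, hs, hsupp⟩ => ?_⟩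
  obtain ⟨K, mK, hK, hKi⟩ := H m i j _ hm hij hu hs hsupp
  have hle := (ofReal_iterated_le hp0.le mK hK).trans hKi
  have hnn : ∀ F : ℝ → ℝ → ℝ, 0 ≤ ∫ r in Ioi (0 : ℝ), ∫ z : ℝ, |F r z| ^ p * r := fun F =>
    setIntegral_nonneg measurableSet_Ioi fun r hr =>
      integral_nonneg fun z => mul_nonneg (by positivity) (le_of_lt hr)
  rw [lintegral_enorm_rpow_halfPlane (g := fun w => w.1 ^ γ * Function.uncurry f w) hp0
      ((continuous_fst.rpow_const fun _ => Or.inr h0).mul hu.continuous) hs.mul_left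
      (fun v hv => by
        rw [image_eq_zero_of_notMem_tsupport fun hc => absurd (hsupp hc).1 (not_lt.2 hv),
          mul_zero]),
    ← ENNReal.ofReal_mul hC, ENNReal.ofReal_le_ofReal_iff (mul_nonneg hC (hnn _))] at hle
  unfold cylLp
  rw [← mul_rpow hC (mul_nonneg (by positivity) (hnn _))]
  refine rpow_le_rpow (mul_nonneg (by positivity) (hnn _)) ?_ (by positivity)
  refine (mul_le_mul_of_nonneg_left hle (by positivity)).trans (le_of_eq ?_)
  simp only [Function.uncurry]
  ring

lemma d2rr_eq_pd {f : ℝ → ℝ → ℝ} (hf : ContDiff ℝ (⊤ : ℕ∞) (Function.uncurry f)) :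
    d2rr f = fun r z => pd 0 (pd 0 (Function.uncurry f)) (r, z) := by
  have h1 : ∀ r z, deriv (fun s => f s z) r = pd 0 (Function.uncurry f) (r, z) := fun r z =>
    (hasDerivAt_fst_of_differentiable (hf.differentiable (by simp)) r z).deriv
  funext r z
  simp only [d2rr, h1]
  exact (hasDerivAt_fst_of_differentiable ((contDiff_pd hf 0).differentiable (by simp)) r z).deriv

lemma d2rz_eq_pd {f : ℝ → ℝ → ℝ} (hf : ContDiff ℝ (⊤ : ℕ∞) (Function.uncurry f)) :
    d2rz f = fun r z => pd 0 (pd 1 (Function.uncurry f)) (r, z) := by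
  have h1 : ∀ r z, deriv (fun s => f r s) z = pd 1 (Function.uncurry f) (r, z) := fun r z =>
    (hasDerivAt_snd_of_differentiable (hf.differentiable (by simp)) r z).deriv
  funext r z
  simp only [d2rz, h1]
  exact (hasDerivAt_fst_of_differentiable ((contDiff_pd hf 1).differentiable (by simp)) r z).deriv

lemma d2zz_eq_pd {f : ℝ → ℝ → ℝ} (hf : ContDiff ℝ (⊤ : ℕ∞) (Function.uncurry f)) :
    d2zz f = fun r z => pd 1 (pd 1 (Function.uncurry f)) (r, z) := by
  have h1 : ∀ r z, deriv (fun s => f r s) z = pd 1 (Function.uncurry f) (r, z) := fun r z =>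
    (hasDerivAt_snd_of_differentiable (hf.differentiable (by simp)) r z).deriv
  funext r z
  simp only [d2zz, h1]
  exact (hasDerivAt_snd_of_differentiable ((contDiff_pd hf 1).differentiable (by simp)) r z).deriv

end

/-- Proposition 2.8 (lemLmweightedRiesz): `r`-weighted bounds for `L_m^{-1} ∇̃∇̃`,
for each of the three second derivatives separately. -/
theorem Lminv_weighted_double_Riesz (p q γ : ℝ)
    (hq1 : 1 < q) (hqp : q < p) (hγ0 : 0 < γ) (hγ : γ < 3/2)
    (hscal : 1/q = 1/p + γ/3) :
    ∃ ε₀ : ℝ, 0 < ε₀ ∧ ∀ ε : ℝ, 0 < ε → ε < ε₀ →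
      ∃ C : ℝ, 0 < C ∧ ∀ m : ℕ, 3 ≤ m → ∀ f : ℝ → ℝ → ℝ, TestFun f →
        ∀ D2 : (ℝ → ℝ → ℝ) → ℝ → ℝ → ℝ, (D2 = d2rr ∨ D2 = d2rz ∨ D2 = d2zz) →
          cylLp p (fun r z => r ^ γ * Lminv m (D2 f) r z)
            ≤ C * ((m : ℝ) ^ (-(1:ℝ)/2 + γ/3 + ε) * cylLp q (Lminv m (D2 f))
              + cylLp p (fun r z => r ^ γ * f r z)
              + cylLp p (Lminv m (fun r z => (1/r) * deriv (fun s => s ^ γ * f s z) r))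
              + cylLp p (Lminv m (fun r z => (1/r) * deriv (fun s => r ^ γ * f r s) z))
              + cylLp p (Lminv m (fun r z => r ^ (γ - 2) * f r z))) := by
  have hp : 1 < p := hq1.trans hqp
  have hq : 1 / q < 1 := by rw [div_lt_one (by linarith)]; exact hq1
  have hp2 : 2 / p = 2 * (1 / p) := by ring
  have hp3 : 0 < 1 / p := by positivity
  obtain ⟨C, hC, H⟩ := exists_cylLp_Lminv_pd_le hp hγ0.le (by linarith : γ ≤ 2)
    (by linarith) (by linarith)
  refine ⟨1, one_pos, fun ε _ _ => ⟨C + 1, by linarith, fun m hm f hf D2 hD => ?_⟩⟩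
  have key : cylLp p (fun r z => r ^ γ * Lminv m (D2 f) r z) ≤
      C * cylLp p (fun r z => r ^ γ * f r z) := by
    rcases hD with rfl | rfl | rfl
    · rw [d2rr_eq_pd hf.1]; exact H m 0 0 f hm le_rfl hf
    · rw [d2rz_eq_pd hf.1]; exact H m 0 1 f hm (by decide) hf
    · rw [d2zz_eq_pd hf.1]; exact H m 1 1 f hm le_rfl hf
  have n1 := mul_nonneg (rpow_nonneg (Nat.cast_nonneg m : (0 : ℝ) ≤ m) (-(1:ℝ)/2 + γ/3 + ε))
    (cylLp_nonneg q (Lminv m (D2 f)))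
  have n2 := cylLp_nonneg p (fun r z => r ^ γ * f r z)
  have n3 := cylLp_nonneg p (Lminv m (fun r z => (1/r) * deriv (fun s => s ^ γ * f s z) r))
  have n4 := cylLp_nonneg p (Lminv m (fun r z => (1/r) * deriv (fun s => r ^ γ * f r s) z))
  have n5 := cylLp_nonneg p (Lminv m (fun r z => r ^ (γ - 2) * f r z))
  refine key.trans (mul_le_mul (by linarith) (by linarith) n2 (by linarith))

end
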